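/- arXiv:1509.04977 — 8 statements merged into one kernel-verified Lean document; each statement's English description precedes it below -/
import Mathlib

section
/- The Fermat ideal admits the decomposition I = (f, g) ∩ (x, y) ∩ (y, z) ∩ (z, x) as an intersection of ideals of R = K[x,y,z]; that is, the ideal generated by x(y^n−z^n), y(z^n−x^n), z(x^n−y^n) equals (y^n−z^n, z^n−x^n) ∩ (x, y) ∩ (y, z) ∩ (z, x). -/
open MvPolynomial

/-- A variable outside `s` is a nonzerodivisor modulo the ideal generated by the variables in `s`. -/
theorem mem_span_X_image_of_X_mul_mem {σ R : Type*} [CommSemiring R] {s : Set σ} {k : σ}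
    (hk : k ∉ s) {q : MvPolynomial σ R} (h : X k * q ∈ Ideal.span (X '' s)) :
    q ∈ Ideal.span (X '' s) := by
  classical
  rw [mem_ideal_span_X_image] at h ⊢
  intro m hm
  obtain ⟨i, hi, hne⟩ := h (Finsupp.single k 1 + m) (by
    rw [mem_support_iff, coeff_X_mul]
    exact mem_support_iff.mp hm)
  refine ⟨i, hi, ?_⟩
  have hki : k ≠ i := fun e => hk (e ▸ hi)
  simpa [Finsupp.single_apply, hki] using hne

theorem mem_span_X_image_of_X_pow_mul_mem {σ R : Type*} [CommSemiring R] {s : Set σ} {k : σ}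
    (hk : k ∉ s) (n : ℕ) {q : MvPolynomial σ R} (h : X k ^ n * q ∈ Ideal.span (X '' s)) :
    q ∈ Ideal.span (X '' s) := by
  induction n with
  | zero => simpa using h
  | succ n ih =>
    refine ih (mem_span_X_image_of_X_mul_mem hk ?_)
    rwa [← mul_assoc, ← pow_succ']

theorem mem_span_X_pair_of_X_pow_mul_mem {σ R : Type*} [CommSemiring R] {i j k : σ}
    (hki : k ≠ i) (hkj : k ≠ j) (n : ℕ) {q : MvPolynomial σ R}
    (h : X k ^ n * q ∈ Ideal.span {X i, X j}) : q ∈ Ideal.span {X i, X j} := by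
  rw [← Set.image_pair] at h ⊢
  exact mem_span_X_image_of_X_pow_mul_mem (by simp [hki, hkj]) n h

/-- The Fermat ideal `(x(yⁿ−zⁿ), y(zⁿ−xⁿ), z(xⁿ−yⁿ))` in `R = K[x,y,z]`
decomposes as `(f, g) ∩ (x, y) ∩ (y, z) ∩ (z, x)`. -/
theorem fermat_ideal_decomposition {K : Type*} [Field K] (n : ℕ) (hn : 2 ≤ n)
    (hζ : ∃ ζ : K, IsPrimitiveRoot ζ n) (hinv : IsUnit (n : K)) :
    (Ideal.span {(X 0 : MvPolynomial (Fin 3) K) * (X 1 ^ n - X 2 ^ n),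
        X 1 * (X 2 ^ n - X 0 ^ n), X 2 * (X 0 ^ n - X 1 ^ n)}) =
      Ideal.span {(X 1 : MvPolynomial (Fin 3) K) ^ n - X 2 ^ n, X 2 ^ n - X 0 ^ n} ⊓
        Ideal.span {(X 0 : MvPolynomial (Fin 3) K), X 1} ⊓
        Ideal.span {(X 1 : MvPolynomial (Fin 3) K), X 2} ⊓
        Ideal.span {(X 2 : MvPolynomial (Fin 3) K), X 0} := by
  obtain ⟨m, rfl⟩ : ∃ m, n = m + 1 := ⟨n - 1, by omega⟩
  clear hζ hinv hn
  generalize hx : (X 0 : MvPolynomial (Fin 3) K) = x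
  generalize hy : (X 1 : MvPolynomial (Fin 3) K) = y
  generalize hz : (X 2 : MvPolynomial (Fin 3) K) = z
  apply le_antisymm
  · rw [Ideal.span_le]
    rintro p (rfl | rfl | rfl)
    all_goals
      simp only [SetLike.mem_coe, Submodule.mem_inf, Ideal.mem_span_pair]
    · exact ⟨⟨⟨⟨x, 0, by ring⟩, ⟨y ^ (m + 1) - z ^ (m + 1), 0, by ring⟩⟩,
        ⟨x * y ^ m, -x * z ^ m, by ring⟩⟩, ⟨0, y ^ (m + 1) - z ^ (m + 1), by ring⟩⟩
    · exact ⟨⟨⟨⟨0, y, by ring⟩, ⟨0, z ^ (m + 1) - x ^ (m + 1), by ring⟩⟩,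
        ⟨z ^ (m + 1) - x ^ (m + 1), 0, by ring⟩⟩, ⟨y * z ^ m, -y * x ^ m, by ring⟩⟩
    · exact ⟨⟨⟨⟨-z, -z, by ring⟩, ⟨z * x ^ m, -z * y ^ m, by ring⟩⟩,
        ⟨0, x ^ (m + 1) - y ^ (m + 1), by ring⟩⟩, ⟨x ^ (m + 1) - y ^ (m + 1), 0, by ring⟩⟩
  · rintro p ⟨⟨⟨hfg, hxy⟩, hyz⟩, hzx⟩
    simp only [SetLike.mem_coe] at hfg hxy hyz hzx
    obtain ⟨a, b, rfl⟩ := Ideal.mem_span_pair.mp hfg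
    have ha : a ∈ Ideal.span {z, x} := by
      obtain ⟨u, v, huv⟩ := Ideal.mem_span_pair.mp hzx
      subst hx hy hz
      refine mem_span_X_pair_of_X_pow_mul_mem (k := 1) (by decide) (by decide) (m + 1)
        (Ideal.mem_span_pair.mpr ⟨u + a * X 2 ^ m - b * X 2 ^ m, v + b * X 0 ^ m, ?_⟩)
      linear_combination huv
    have hb : b ∈ Ideal.span {y, z} := by
      obtain ⟨u, v, huv⟩ := Ideal.mem_span_pair.mp hyz
      subst hx hy hz
      refine mem_span_X_pair_of_X_pow_mul_mem (k := 0) (by decide) (by decide) (m + 1)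
        (Ideal.mem_span_pair.mpr ⟨-u + a * X 1 ^ m, -v - a * X 2 ^ m + b * X 2 ^ m, ?_⟩)
      linear_combination -huv
    obtain ⟨a₁, a₂, rfl⟩ := Ideal.mem_span_pair.mp ha
    obtain ⟨b₁, b₂, rfl⟩ := Ideal.mem_span_pair.mp hb
    have hc : b₂ - a₁ ∈ Ideal.span {x, y} := by
      obtain ⟨u, v, huv⟩ := Ideal.mem_span_pair.mp hxy
      subst hx hy hz
      refine mem_span_X_pair_of_X_pow_mul_mem (k := 2) (by decide) (by decide) (m + 2)
        (Ideal.mem_span_pair.mpr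
          ⟨u + (b₁ * X 1 + b₂ * X 2) * X 0 ^ m + a₂ * X 2 ^ (m + 1),
            v - (a₁ * X 2 + a₂ * X 0) * X 1 ^ m - b₁ * X 2 ^ (m + 1), ?_⟩)
      linear_combination huv
    obtain ⟨c₁, c₂, hc⟩ := Ideal.mem_span_pair.mp hc
    obtain rfl : b₂ = a₁ + c₁ * x + c₂ * y := by linear_combination -hc
    rw [Ideal.mem_span_insert]
    refine ⟨a₂ - z * c₁, _, Ideal.mem_span_pair.mpr ⟨b₁ + z * c₂, -a₁ - x * c₁, rfl⟩, ?_⟩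
    ring
end

section
/- The kernel of the R-algebra homomorphism φ : R[T₁, T₂, T₃] → R[t] determined by φ(T₁) = t·x(y^n−z^n), φ(T₂) = t·y(z^n−x^n), φ(T₃) = t·z(x^n−y^n) (and fixing x, y, z) is the ideal generated by the two elements yz·T₁ + zx·T₂ + xy·T₃ and x^{n−1}·T₁ + y^{n−1}·T₂ + z^{n−1}·T₃. In particular, the Rees algebra of the Fermat ideal is a complete intersection defined by two forms of bidegree (n+3, 1) and (2n, 1). -/
open MvPolynomial

/-- The `R`-algebra map `R[T₁,T₂,T₃] → R[t]` sending `Tᵢ` to `t·(i-th generator of the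
Fermat ideal)`, whose image is the Rees algebra of the Fermat ideal. -/
noncomputable def fermatReesMap (K : Type*) [Field K] (n : ℕ) :
    MvPolynomial (Fin 3) (MvPolynomial (Fin 3) K) →ₐ[MvPolynomial (Fin 3) K]
      Polynomial (MvPolynomial (Fin 3) K) :=
  MvPolynomial.aeval
    ![Polynomial.C (X 0 * (X 1 ^ n - X 2 ^ n)) * Polynomial.X,
      Polynomial.C (X 1 * (X 2 ^ n - X 0 ^ n)) * Polynomial.X,
      Polynomial.C (X 2 * (X 0 ^ n - X 1 ^ n)) * Polynomial.X]

/-- Up to multiplication by powers of `b`, every element of `R[s]` is congruent modulo `J` to an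
element of `U`, as soon as this holds for the products `b • a` with `a ∈ s`. -/
theorem exists_smul_pow_sub_mem_of_adjoin {R S : Type*} [CommRing R] [CommRing S] [Algebra R S]
    (J : Ideal S) (U : Subalgebra R S) (b : R) (s : Set S)
    (hs : ∀ a ∈ s, ∃ u ∈ U, algebraMap R S b * a - u ∈ J) {F : S} (hF : F ∈ Algebra.adjoin R s) :
    ∃ N : ℕ, ∃ G ∈ U, algebraMap R S b ^ N * F - G ∈ J := by
  induction hF using Algebra.adjoin_induction with
  | mem a ha =>
    obtain ⟨u, hu, h⟩ := hs a ha
    exact ⟨1, u, hu, by simpa using h⟩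
  | algebraMap r => exact ⟨0, algebraMap R S r, U.algebraMap_mem r, by simp⟩
  | add p q _ _ hp hq =>
    obtain ⟨N, G, hG, h⟩ := hp
    obtain ⟨M, G', hG', h'⟩ := hq
    have hb (k : ℕ) : algebraMap R S b ^ k ∈ U := pow_mem (U.algebraMap_mem b) k
    refine ⟨N + M, algebraMap R S b ^ M * G + algebraMap R S b ^ N * G',
      add_mem (mul_mem (hb M) hG) (mul_mem (hb N) hG'), ?_⟩
    convert J.add_mem (J.mul_mem_left (algebraMap R S b ^ M) h)
      (J.mul_mem_left (algebraMap R S b ^ N) h') using 1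
    ring
  | mul p q _ _ hp hq =>
    obtain ⟨N, G, hG, h⟩ := hp
    obtain ⟨M, G', hG', h'⟩ := hq
    refine ⟨N + M, G * G', mul_mem hG hG', ?_⟩
    convert J.add_mem (J.mul_mem_left (algebraMap R S b ^ M * q) h) (J.mul_mem_left G h') using 1
    ring

/-- If `ρ` is reduction modulo `y` and `ρ a`, `ρ b` are coprime, then `y` is a nonzerodivisor
modulo `(a, b)`. -/
theorem mem_span_pair_of_mul_mem {S : Type*} [CommRing S] [IsDomain S] [DecompositionMonoid S]
    (ρ : S →+* S) {y a b F : S} (hy : y ≠ 0) (hρy : ρ y = 0) (hρ : ∀ u, y ∣ u - ρ u)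
    (ha : ρ a ≠ 0) (hab : IsRelPrime (ρ a) (ρ b)) (hF : y * F ∈ Ideal.span {a, b}) :
    F ∈ Ideal.span {a, b} := by
  obtain ⟨u, v, huv⟩ := Ideal.mem_span_pair.mp hF
  have h0 : ρ u * ρ a + ρ v * ρ b = 0 := by
    rw [← map_mul, ← map_mul, ← map_add, huv, map_mul, hρy, zero_mul]
  obtain ⟨c, hc⟩ : ρ a ∣ ρ v :=
    hab.dvd_of_dvd_mul_right ⟨-ρ u, by linear_combination h0⟩
  have hu : ρ u = -(c * ρ b) := by
    refine mul_right_cancel₀ ha ?_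
    linear_combination h0 - ρ b * hc
  obtain ⟨u', hu'⟩ := hρ u
  obtain ⟨v', hv'⟩ := hρ v
  obtain ⟨a', ha'⟩ := hρ a
  obtain ⟨b', hb'⟩ := hρ b
  refine Ideal.mem_span_pair.mpr ⟨u' + c * b', v' - c * a', mul_left_cancel₀ hy ?_⟩
  linear_combination huv - a * hu' - b * hv' - a * hu - b * hc - a * c * hb' + b * c * ha'

theorem Irreducible.isRelPrime_of_ringHom {S T : Type*} [CommRing S] [CommRing T]
    (e : S →+* T) {p q : S} (hp : Irreducible p) (h0 : e p = 0) (h1 : e q ≠ 0) :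
    IsRelPrime p q :=
  hp.isRelPrime_iff_not_dvd.mpr fun h ↦ h1 (zero_dvd_iff.mp (h0 ▸ map_dvd e h))

theorem Polynomial.Monic.isRelPrime_C {D : Type*} [CommRing D] [IsDomain D] {p : Polynomial D}
    (hp : p.Monic) {a : D} (ha : a ≠ 0) : IsRelPrime p (Polynomial.C a) := by
  intro q hq hqa
  have hdeg : q.natDegree = 0 := by
    simpa using Polynomial.natDegree_le_of_dvd hqa (Polynomial.C_ne_zero.mpr ha)
  rw [Polynomial.eq_C_of_natDegree_eq_zero hdeg] at hq ⊢
  exact Polynomial.isUnit_C.mpr (hp.isPrimitive _ hq)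

namespace MvPolynomial

theorem isRelPrime_C_C {σ R : Type*} [CommRing R] [IsDomain R] {a b : R} (ha : a ≠ 0)
    (h : IsRelPrime a b) : IsRelPrime (C a : MvPolynomial σ R) (C b) := by
  intro q hqa hqb
  obtain ⟨r, -, rfl⟩ := (dvd_C_iff_exists ha).mp hqa
  refine (h ?_ ?_).map C
  · simpa using map_dvd constantCoeff hqa
  · simpa using map_dvd constantCoeff hqb

section Field

variable {K : Type*} [Field K]

theorem X_pow_sub_X_pow_ne_zero {σ : Type*} {n : ℕ} (hn : n ≠ 0) {i j : σ} (hij : i ≠ j) :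
    (X i ^ n - X j ^ n : MvPolynomial σ K) ≠ 0 := by
  classical
  intro h
  simpa [hij.symm, hn] using congrArg (eval (Pi.single i (1 : K))) h

theorem isRelPrime_pow_sub_pow {n : ℕ} (hn : n ≠ 0) :
    IsRelPrime (X 0 ^ n - X 1 ^ n : MvPolynomial (Fin 3) K) (X 1 ^ n - X 2 ^ n) := by
  have h1 : finSuccEquiv K 2 (X 1) = Polynomial.C (X 0) := finSuccEquiv_X_succ (j := 0)
  have h2 : finSuccEquiv K 2 (X 2) = Polynomial.C (X 1) := finSuccEquiv_X_succ (j := 1)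
  refine IsRelPrime.of_map (finSuccEquiv K 2) ?_
  simp only [map_sub, map_pow, finSuccEquiv_X_zero, h1, h2]
  simp only [← map_pow, ← map_sub]
  exact (Polynomial.monic_X_pow_sub_C _ hn).isRelPrime_C
    (X_pow_sub_X_pow_ne_zero hn (by decide))

theorem isRelPrime_fermat_generators {n : ℕ} (hn : n ≠ 0) :
    IsRelPrime (X 0 * (X 1 ^ n - X 2 ^ n) : MvPolynomial (Fin 3) K)
      (X 2 * (X 0 ^ n - X 1 ^ n)) := by
  have hX (i : Fin 3) : Irreducible (X i : MvPolynomial (Fin 3) K) := X_prime.irreducible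
  refine .mul_left (.mul_right ?_ ?_) (.mul_right ?_ (isRelPrime_pow_sub_pow hn).symm)
  · exact (hX 0).isRelPrime_of_ringHom (eval ![0, 0, 1]) (by simp) (by simp)
  · exact (hX 0).isRelPrime_of_ringHom (eval ![0, 1, 0]) (by simp) (by simp [hn])
  · exact ((hX 2).isRelPrime_of_ringHom (eval ![0, 1, 0]) (by simp) (by simp [hn])).symm

/-- An element of the kernel of `fermatReesMap` not involving `T₂` is a multiple of
`d₁ T₃ - d₃ T₁`, where `d₁`, `d₃` are the first and the third generator of the Fermat ideal. -/
theorem dvd_of_fermatReesMap_eq_zero {n : ℕ} (hn : n ≠ 0)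
    {G : MvPolynomial (Fin 3) (MvPolynomial (Fin 3) K)}
    (hG : G ∈ Algebra.adjoin (MvPolynomial (Fin 3) K) {X 0, X 2})
    (h0 : fermatReesMap K n G = 0) :
    C (X 0 * (X 1 ^ n - X 2 ^ n)) * X 2 - C (X 2 * (X 0 ^ n - X 1 ^ n)) * X 0 ∣ G := by
  set d₁ : MvPolynomial (Fin 3) K := X 0 * (X 1 ^ n - X 2 ^ n) with hd₁
  set d₃ : MvPolynomial (Fin 3) K := X 2 * (X 0 ^ n - X 1 ^ n) with hd₃
  set E : MvPolynomial (Fin 3) (MvPolynomial (Fin 3) K) := C d₁ * X 2 - C d₃ * X 0 with hE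
  have hφ0 : fermatReesMap K n (X 0) = Polynomial.C d₁ * Polynomial.X := by
    simp [fermatReesMap, hd₁]
  have hφ2 : fermatReesMap K n (X 2) = Polynomial.C d₃ * Polynomial.X := by
    simp [fermatReesMap, hd₃]
  have hφC (r : MvPolynomial (Fin 3) K) : fermatReesMap K n (C r) = Polynomial.C r :=
    (fermatReesMap K n).commutes r
  have hd₁0 : d₁ ≠ 0 := mul_ne_zero (X_ne_zero 0) (X_pow_sub_X_pow_ne_zero hn (by decide))
  have hφE : fermatReesMap K n E = 0 := by
    rw [hE, map_sub, map_mul _ (C d₁), map_mul _ (C d₃), hφ0, hφ2, hφC, hφC]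
    ring
  obtain ⟨N, H, hH, hGH⟩ := exists_smul_pow_sub_mem_of_adjoin (Ideal.span {E})
    (Algebra.adjoin (MvPolynomial (Fin 3) K) {X 0}) d₁ _ (by
      have h0 := Algebra.self_mem_adjoin_singleton (MvPolynomial (Fin 3) K)
        (X 0 : MvPolynomial (Fin 3) (MvPolynomial (Fin 3) K))
      rintro a (rfl | rfl)
      · exact ⟨_, mul_mem (Subalgebra.algebraMap_mem _ d₁) h0, by simp⟩
      · exact ⟨_, mul_mem (Subalgebra.algebraMap_mem _ d₃) h0,
          Ideal.mem_span_singleton_self _⟩) hG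
  rw [Ideal.mem_span_singleton] at hGH
  have hφH : fermatReesMap K n H = 0 := by
    have := map_dvd (fermatReesMap K n) hGH
    rw [hφE, zero_dvd_iff, map_sub, map_mul, h0] at this
    simpa using this
  have hH0 : H = 0 := by
    rw [Algebra.adjoin_singleton_eq_range_aeval] at hH
    obtain ⟨p, rfl⟩ := hH
    have hp : p.comp (Polynomial.C d₁ * Polynomial.X) = 0 := by
      rw [← hφH, Polynomial.comp, ← hφ0]
      change _ = fermatReesMap K n (Polynomial.aeval (X 0) p)
      rw [← Polynomial.aeval_algHom_apply]
      rfl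
    have : p = 0 := by
      ext1 k
      have := congrArg (Polynomial.coeff · k) hp
      simpa [Polynomial.comp_C_mul_X_coeff, hd₁0] using this
    simp [this]
  rw [hH0, sub_zero] at hGH
  refine IsRelPrime.dvd_of_dvd_mul_left (IsRelPrime.pow_right ?_) hGH
  have hrel : IsRelPrime (C d₁) (C d₃ * X 0 : MvPolynomial (Fin 3) (MvPolynomial (Fin 3) K)) := by
    refine .mul_right (isRelPrime_C_C hd₁0 (isRelPrime_fermat_generators hn)) ?_
    refine (X_prime.irreducible.isRelPrime_of_ringHom
      (eval (0 : Fin 3 → MvPolynomial (Fin 3) K)) (by simp) ?_).symm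
    simpa using hd₁0
  rw [hE, ← neg_sub]
  exact (IsRelPrime.neg_right (by simpa using hrel)).symm

/-- `y` is a nonzerodivisor modulo the two linear forms in the `Tᵢ`. -/
theorem mem_span_fermat_of_mul_mem {m : ℕ} (hm : m ≠ 0)
    {F : MvPolynomial (Fin 3) (MvPolynomial (Fin 3) K)} :
    let J : Ideal (MvPolynomial (Fin 3) (MvPolynomial (Fin 3) K)) := Ideal.span
      {C (X 1 * X 2) * X 0 + C (X 2 * X 0) * X 1 + C (X 0 * X 1) * X 2,
        C (X 0 ^ m) * X 0 + C (X 1 ^ m) * X 1 + C (X 2 ^ m) * X 2}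
    C (X 1) * F ∈ J → F ∈ J := by
  let e : MvPolynomial (Fin 3) K →ₐ[K] MvPolynomial (Fin 3) K := aeval ![X 0, 0, X 2]
  have he0 : e (X 0) = X 0 := by simp [e]
  have he1 : e (X 1) = 0 := by simp [e]
  have he2 : e (X 2) = X 2 := by simp [e]
  have he (r) : X 1 ∣ r - e r := by
    induction r using MvPolynomial.induction_on with
    | C a => simp [e]
    | add p q hp hq =>
      rw [map_add, add_sub_add_comm]
      exact dvd_add hp hq
    | mul_X p i hp =>
      have hi : X 1 ∣ X i - e (X i) := by
        fin_cases i
        · exact ⟨0, by simp [e]⟩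
        · exact ⟨1, by simp [e]⟩
        · exact ⟨0, by simp [e]⟩
      rw [map_mul, show p * X i - e p * e (X i) = (p - e p) * X i + e p * (X i - e (X i)) by ring]
      exact dvd_add (hp.mul_right _) (hi.mul_left _)
  let ρ : MvPolynomial (Fin 3) (MvPolynomial (Fin 3) K) →+* _ := map e.toRingHom
  have hρ (u) : C (X 1) ∣ u - ρ u := by
    rw [C_dvd_iff_dvd_coeff]
    intro i
    simpa [ρ, coeff_map] using he (coeff i u)
  have hρC (r) : ρ (C r) = C (e r) := by simp [ρ]
  have hρX (i) : ρ (X i) = X i := by simp [ρ]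
  intro J
  refine mem_span_pair_of_mul_mem ρ (C_ne_zero.mpr (X_ne_zero 1)) (by simp [hρC, he1]) hρ ?_ ?_
  · simp [hρC, hρX, he0, he1, he2, X_ne_zero]
  · have hC (i : Fin 3) : Irreducible (C (X i) : MvPolynomial (Fin 3) (MvPolynomial (Fin 3) K)) :=
      ((prime_C_iff _).mpr X_prime).irreducible
    simp only [map_add, map_mul, map_pow, hρC, hρX, he0, he1, he2, map_zero, zero_mul, mul_zero,
      zero_pow hm, zero_add, add_zero]
    refine .mul_left (.mul_left ?_ ?_) ?_
    · exact (hC 2).isRelPrime_of_ringHom (eval₂Hom (eval ![1, 0, 0]) ![(1 : K), 0, 0])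
        (by simp) (by simp [hm])
    · exact (hC 0).isRelPrime_of_ringHom (eval₂Hom (eval ![0, 0, 1]) ![(0 : K), 0, 1])
        (by simp) (by simp [hm])
    · exact X_prime.irreducible.isRelPrime_of_ringHom (eval₂Hom (eval ![1, 0, 0]) ![(1 : K), 0, 0])
        (by simp) (by simp [hm])

end Field

end MvPolynomial

/-- the kernel of the map presenting the Rees algebra of the Fermat ideal is
generated by `yz·T₁ + zx·T₂ + xy·T₃` and `x^{n−1}·T₁ + y^{n−1}·T₂ + z^{n−1}·T₃`; in
particular the Rees algebra is a complete intersection defined by two forms of bidegree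
`(n+3,1)` and `(2n,1)`. -/
theorem fermat_rees_kernel {K : Type*} [Field K] (n : ℕ) (hn : 2 ≤ n)
    (hζ : ∃ ζ : K, IsPrimitiveRoot ζ n) (hinv : IsUnit (n : K)) :
    RingHom.ker (fermatReesMap K n) =
      Ideal.span
        { C ((X 1 : MvPolynomial (Fin 3) K) * X 2) * X 0 + C ((X 2 : MvPolynomial (Fin 3) K) * X 0) * X 1
            + C ((X 0 : MvPolynomial (Fin 3) K) * X 1) * X 2,
          C ((X 0 : MvPolynomial (Fin 3) K) ^ (n - 1)) * X 0 + C ((X 1 : MvPolynomial (Fin 3) K) ^ (n - 1)) * X 1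
            + C ((X 2 : MvPolynomial (Fin 3) K) ^ (n - 1)) * X 2 } := by
  obtain ⟨m, rfl⟩ : ∃ m, n = m + 1 := ⟨n - 1, by omega⟩
  rw [Nat.add_sub_cancel]
  set A : MvPolynomial (Fin 3) (MvPolynomial (Fin 3) K) :=
    C (X 1 * X 2) * X 0 + C (X 2 * X 0) * X 1 + C (X 0 * X 1) * X 2 with hA
  set B : MvPolynomial (Fin 3) (MvPolynomial (Fin 3) K) :=
    C (X 0 ^ m) * X 0 + C (X 1 ^ m) * X 1 + C (X 2 ^ m) * X 2 with hB
  have hφA : fermatReesMap K (m + 1) A = 0 := by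
    simp only [hA, fermatReesMap, map_add, map_mul, map_sub, map_pow, aeval_X, algHom_C,
      Polynomial.algebraMap_eq, Matrix.cons_val]
    ring
  have hφB : fermatReesMap K (m + 1) B = 0 := by
    simp only [hB, fermatReesMap, map_add, map_mul, map_sub, map_pow, aeval_X, algHom_C,
      Polynomial.algebraMap_eq, Matrix.cons_val]
    ring
  refine le_antisymm (fun F hF ↦ ?_) ?_
  · have hAJ : A ∈ Ideal.span {A, B} := Ideal.subset_span (by simp)
    have hBJ : B ∈ Ideal.span {A, B} := Ideal.subset_span (by simp)
    obtain ⟨N, G, hG, hFG⟩ := exists_smul_pow_sub_mem_of_adjoin (Ideal.span {B})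
      (Algebra.adjoin (MvPolynomial (Fin 3) K) {X 0, X 2}) (X 1 ^ m) (Set.range X) (by
        have h0 : X 0 ∈ Algebra.adjoin (MvPolynomial (Fin 3) K)
            ({X 0, X 2} : Set (MvPolynomial (Fin 3) (MvPolynomial (Fin 3) K))) :=
          Algebra.subset_adjoin (by simp)
        have h2 : X 2 ∈ Algebra.adjoin (MvPolynomial (Fin 3) K)
            ({X 0, X 2} : Set (MvPolynomial (Fin 3) (MvPolynomial (Fin 3) K))) :=
          Algebra.subset_adjoin (by simp)
        have hC (r : MvPolynomial (Fin 3) K) := Subalgebra.algebraMap_mem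
          (Algebra.adjoin (MvPolynomial (Fin 3) K)
            ({X 0, X 2} : Set (MvPolynomial (Fin 3) (MvPolynomial (Fin 3) K)))) r
        rintro _ ⟨i, rfl⟩
        fin_cases i
        · exact ⟨_, mul_mem (hC (X 1 ^ m)) h0, by simp⟩
        · refine ⟨_, neg_mem (add_mem (mul_mem (hC (X 0 ^ m)) h0) (mul_mem (hC (X 2 ^ m)) h2)), ?_⟩
          convert Ideal.mem_span_singleton_self B using 1
          simp only [hB, algebraMap_eq]
          change C (X 1 ^ m) * X 1 - _ = _
          ring
        · exact ⟨_, mul_mem (hC (X 1 ^ m)) h2, by simp⟩)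
      (F := F) (by rw [adjoin_range_X]; trivial)
    have hφG : fermatReesMap K (m + 1) G = 0 := by
      have := map_dvd (fermatReesMap K (m + 1)) (Ideal.mem_span_singleton.mp hFG)
      rw [hφB, zero_dvd_iff, map_sub, map_mul, RingHom.mem_ker.mp hF] at this
      simpa using this
    have hGJ : G ∈ Ideal.span {A, B} := by
      refine Ideal.mem_of_dvd _ (dvd_of_fermatReesMap_eq_zero m.succ_ne_zero hG hφG) ?_
      convert sub_mem (Ideal.mul_mem_left _ (C (X 1 ^ m)) hAJ)
        (Ideal.mul_mem_left _ (C (X 2 * X 0)) hBJ) using 1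
      simp only [hA, hB, map_mul, map_sub, map_pow, pow_succ]
      ring
    have hFJ : C (X 1) ^ (m * N) * F ∈ Ideal.span {A, B} := by
      have := add_mem (Ideal.span_mono (by simp) hFG) hGJ
      rwa [sub_add_cancel, algebraMap_eq, map_pow, ← pow_mul] at this
    generalize m * N = k at hFJ
    induction k with
    | zero => simpa using hFJ
    | succ k ih =>
      rw [pow_succ', mul_assoc] at hFJ
      exact ih (mem_span_fermat_of_mul_mem (by omega) hFJ)
  · rw [Ideal.span_le]
    rintro _ (rfl | rfl)
    · exact hφA
    · exact hφB
end

section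
/- Let I be an almost complete intersection ideal defining a reduced set of points in projective N-space; i.e., I ⊆ R = K[x₀,…,x_N] is a proper nonzero homogeneous radical ideal with Krull dimension of R/I equal to 1, generated by homogeneous polynomials f₁,…,f_m with m ≤ N+1. Then I is of linear type: the kernel of the R-algebra homomorphism R[T₁,…,T_m] → R[t] sending T_i ↦ f_i·t (and fixing R) is generated by the set of its elements of the form b₁T₁ + ⋯ + b_mT_m with b₁,…,b_m ∈ R satisfying b₁f₁ + ⋯ + b_mf_m = 0. -/
open MvPolynomial

/-- The ideal of linear relations among a family `f`: the defining ideal of the symmetric algebra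
of the ideal generated by `f`. -/
noncomputable def linearRelations {A ι : Type*} [CommRing A] [Fintype ι] (f : ι → A) :
    Ideal (MvPolynomial ι A) :=
  Ideal.span {p | ∃ b : ι → A, (∑ i, b i * f i = 0) ∧ p = ∑ i, C (b i) * X i}

section LinearRelations

attribute [local instance] MvPolynomial.gradedAlgebra

variable {A ι κ : Type*} [CommRing A] [Fintype ι] [Fintype κ]

theorem sum_mem_linearRelations {f : ι → A} {b : ι → A} (h : ∑ i, b i * f i = 0) :
    ∑ i, C (b i) * X i ∈ linearRelations f :=
  Ideal.subset_span ⟨b, h, rfl⟩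

theorem linearRelations_le_iff {f : ι → A} {J : Ideal (MvPolynomial ι A)} :
    linearRelations f ≤ J ↔
      ∀ b : ι → A, ∑ i, b i * f i = 0 → ∑ i, C (b i) * X i ∈ J := by
  rw [linearRelations, Ideal.span_le]
  exact ⟨fun h b hb => h ⟨b, hb, rfl⟩, by rintro h _ ⟨b, hb, rfl⟩; exact h b hb⟩

theorem eval_eq_zero_of_mem_linearRelations {f : ι → A} {p : MvPolynomial ι A}
    (hp : p ∈ linearRelations f) : eval f p = 0 := by
  have : linearRelations f ≤ RingHom.ker (eval f) :=
    linearRelations_le_iff.2 fun b hb => by simpa [RingHom.mem_ker] using hb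
  exact this hp

theorem linearRelations_le_ker (f : ι → A) :
    linearRelations f ≤ RingHom.ker (aeval fun i => Polynomial.C (f i) * Polynomial.X :
      MvPolynomial ι A →ₐ[A] Polynomial A) := by
  refine linearRelations_le_iff.2 fun b hb => ?_
  simp only [RingHom.mem_ker, map_sum, map_mul, aeval_C, aeval_X, Polynomial.algebraMap_eq,
    ← mul_assoc, ← Finset.sum_mul]
  simp only [← map_mul, ← map_sum, hb, map_zero, zero_mul]

/-- Every homogeneous polynomial relation among the members of `f` is a consequence of the linear
ones. -/
def IsLinearType (f : ι → A) : Prop :=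
  ∀ (d : ℕ) (F : MvPolynomial ι A), F.IsHomogeneous d → eval f F = 0 → F ∈ linearRelations f

theorem aeval_C_mul_X_of_isHomogeneous {ι : Type*} (f : ι → A) {d : ℕ} {F : MvPolynomial ι A}
    (hF : F.IsHomogeneous d) :
    aeval (fun i => Polynomial.C (f i) * Polynomial.X) F =
      Polynomial.C (eval f F) * Polynomial.X ^ d := by
  rw [aeval_def, eval₂_eq, eval_eq, map_sum, Finset.sum_mul]
  refine Finset.sum_congr rfl fun m hm => ?_
  have : ∑ i ∈ m.support, m i = d := by
    rw [← hF.degree_eq_sum_deg_support hm]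
  simp only [mul_pow, Finset.prod_mul_distrib, Finset.prod_pow_eq_pow_sum, this, map_mul, map_prod,
    map_pow, Polynomial.algebraMap_eq, mul_assoc]

theorem IsLinearType.ker_eq {f : ι → A} (hf : IsLinearType f) :
    RingHom.ker (aeval fun i => Polynomial.C (f i) * Polynomial.X :
      MvPolynomial ι A →ₐ[A] Polynomial A) = linearRelations f := by
  refine le_antisymm (fun F hF => ?_) (linearRelations_le_ker f)
  rw [RingHom.mem_ker, ← sum_homogeneousComponent F, map_sum] at hF
  rw [← sum_homogeneousComponent F]
  refine Ideal.sum_mem _ fun d hd => hf d _ (homogeneousComponent_isHomogeneous d F) ?_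
  have := congrArg (Polynomial.coeff · d) hF
  simpa [aeval_C_mul_X_of_isHomogeneous f (homogeneousComponent_isHomogeneous _ F),
    Polynomial.finsetSum_coeff, Polynomial.coeff_C_mul, Polynomial.coeff_X_pow,
    Finset.mem_range.1 hd] using this

/-- Being of linear type depends only on the ideal generated by the family. -/
theorem IsLinearType.of_span_eq {f : ι → A} {g : κ → A} (hg : IsLinearType g)
    (h : Ideal.span (Set.range f) = Ideal.span (Set.range g)) : IsLinearType f := by
  have hf' : ∀ i, ∃ c : κ → A, ∑ j, c j * g j = f i := fun i =>
    Ideal.mem_span_range_iff_exists_fun.1 (h ▸ Ideal.subset_span ⟨i, rfl⟩)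
  have hg' : ∀ j, ∃ e : ι → A, ∑ i, e i * f i = g j := fun j =>
    Ideal.mem_span_range_iff_exists_fun.1 (h ▸ Ideal.subset_span ⟨j, rfl⟩)
  choose c hc using hf'
  choose e he using hg'
  intro d F hF hF0
  let φ : MvPolynomial ι A →ₐ[A] MvPolynomial κ A := aeval fun i => ∑ j, C (c i j) * X j
  let ψ : MvPolynomial κ A →ₐ[A] MvPolynomial ι A := aeval fun j => ∑ i, C (e j i) * X i
  have h1 : φ F ∈ linearRelations g := by
    refine hg (1 * d) _ (hF.aeval _ fun i => IsHomogeneous.sum _ _ _ fun j _ =>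
      isHomogeneous_C_mul_X _ _) ?_
    have : (aeval g).comp φ = (aeval f : MvPolynomial ι A →ₐ[A] A) := by
      ext i
      simp [φ, hc]
    simpa [aeval_eq_eval] using (congrArg (· F) this).trans hF0
  have h2 : linearRelations g ≤ (linearRelations f).comap ψ := by
    refine linearRelations_le_iff.2 fun b hb => ?_
    have h3 : ψ (∑ j, C (b j) * X j) = ∑ i, C (∑ j, b j * e j i) * X i := by
      simp only [ψ, map_sum, map_mul, aeval_X, algHom_C, algebraMap_eq, Finset.mul_sum,
        Finset.sum_mul, mul_assoc]
      exact Finset.sum_comm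
    rw [Ideal.mem_comap, h3]
    refine sum_mem_linearRelations ?_
    rw [← hb]
    simp only [← he, Finset.mul_sum, Finset.sum_mul, mul_assoc]
    exact Finset.sum_comm
  have h3 : (Ideal.Quotient.mkₐ A (linearRelations f)).comp (ψ.comp φ) =
      Ideal.Quotient.mkₐ A (linearRelations f) := by
    classical
    ext i
    simp only [AlgHom.comp_apply, Ideal.Quotient.mkₐ_eq_mk]
    rw [Ideal.Quotient.mk_eq_mk_iff_sub_mem]
    have h4 : ψ (φ (X i)) - X i =
        ∑ k, C ((∑ j, c i j * e j k) - if k = i then 1 else 0) * X k := by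
      simp only [φ, ψ, aeval_X, map_sum, map_mul, algHom_C, algebraMap_eq, map_sub, sub_mul,
        Finset.sum_sub_distrib, Finset.mul_sum, Finset.sum_mul, mul_assoc]
      rw [Finset.sum_comm]
      simp [apply_ite C]
    rw [h4]
    refine sum_mem_linearRelations ?_
    simp only [sub_mul, Finset.sum_sub_distrib, Finset.sum_mul]
    rw [Finset.sum_comm]
    simp only [mul_assoc, ← Finset.mul_sum, he, hc]
    simp
  rw [← Ideal.Quotient.eq_zero_iff_mem, ← Ideal.Quotient.mkₐ_eq_mk A, ← h3, AlgHom.comp_apply,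
    Ideal.Quotient.mkₐ_eq_mk, Ideal.Quotient.eq_zero_iff_mem]
  exact h2 h1

theorem isHomogeneous_linearRelations (f : ι → A) :
    (linearRelations f).IsHomogeneous (homogeneousSubmodule ι A) := by
  refine Ideal.homogeneous_span _ _ ?_
  rintro _ ⟨b, -, rfl⟩
  exact ⟨1, IsHomogeneous.sum _ _ _ fun j _ => isHomogeneous_C_mul_X _ _⟩

end LinearRelations

section DSequence

attribute [local instance] MvPolynomial.gradedAlgebra

variable {A : Type*} [CommRing A] {n : ℕ}

theorem eval_mem_span_range_of_isHomogeneous {ι : Type*} (a : ι → A) {d : ℕ}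
    {G : MvPolynomial ι A} (hG : G.IsHomogeneous (d + 1)) :
    eval a G ∈ Ideal.span (Set.range a) := by
  classical
  rw [eval_eq]
  refine Ideal.sum_mem _ fun m hm => Ideal.mul_mem_left _ _ ?_
  have h : m.support.Nonempty := by
    rw [Finsupp.support_nonempty_iff]
    rintro rfl
    have := hG.degree_eq_sum_deg_support hm
    simp at this
  obtain ⟨i, hi⟩ := h
  rw [← Finset.mul_prod_erase _ (fun i => a i ^ m i) hi]
  exact Ideal.mul_mem_right _ _ (Ideal.pow_mem_of_mem _ (Ideal.subset_span (Set.mem_range_self i)) _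
    (Nat.pos_of_ne_zero (Finsupp.mem_support_iff.1 hi)))

theorem homogeneousComponent_succ_X_mul {ι : Type*} (i : ι) (d : ℕ) (G : MvPolynomial ι A) :
    homogeneousComponent (d + 1) (X i * G) = X i * homogeneousComponent d G := by
  classical
  ext m
  simp only [coeff_homogeneousComponent, coeff_X_mul']
  by_cases h2 : i ∈ m.support
  · have h4 : Finsupp.single i 1 + (m - Finsupp.single i 1) = m :=
      add_tsub_cancel_of_le (Finsupp.single_le_iff.2
        (Nat.one_le_iff_ne_zero.2 (Finsupp.mem_support_iff.1 h2)))
    have h5 := congrArg Finsupp.degree h4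
    rw [map_add, Finsupp.degree_single] at h5
    have h6 : m.degree = d + 1 ↔ (m - Finsupp.single i 1).degree = d := by omega
    simp only [h2, if_true, h6]
  · simp [h2]

theorem exists_sum_mul_eq_of_mem_span_image {ι : Type*} [Fintype ι] {a : ι → A} {s : Set ι} {x : A}
    (hx : x ∈ Ideal.span (a '' s)) :
    ∃ e : ι → A, (∀ j ∉ s, e j = 0) ∧ ∑ j, e j * a j = x := by
  obtain ⟨l, hl, rfl⟩ := (Finsupp.mem_span_image_iff_linearCombination A).1 hx
  refine ⟨l, fun j hj => by_contra fun h => hj (hl (Finsupp.mem_support_iff.2 h)), ?_⟩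
  rw [Finsupp.linearCombination_apply, Finsupp.sum_fintype _ _ (by simp)]
  simp

/-- If multiplication by each `a i` is injective on `(a 0, …, a (n - 1))` modulo
`(a 0, …, a (i - 1))`, then every homogeneous form whose value at `a` lies in `(a 0, …, a (i - 1))`
is, modulo linear relations, in the ideal of the first `i` variables. -/
theorem mem_linearRelations_sup_of_eval_mem (a : Fin n → A)
    (ha : ∀ i : Fin n, ∀ x ∈ Ideal.span (Set.range a),
      a i * x ∈ Ideal.span (a '' {j | j < i}) → x ∈ Ideal.span (a '' {j | j < i})) (d : ℕ) :
    ∀ k i : ℕ, i + k = n → ∀ F : MvPolynomial (Fin n) A, F.IsHomogeneous (d + 1) →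
      eval a F ∈ Ideal.span (a '' {j | j.val < i}) →
      F ∈ linearRelations a ⊔ Ideal.span (X '' {j : Fin n | j.val < i}) := by
  have hhom : ∀ s : Set (Fin n), (linearRelations a ⊔ Ideal.span (X '' s)).IsHomogeneous
      (homogeneousSubmodule (Fin n) A) := fun s =>
    (isHomogeneous_linearRelations a).sup <| Ideal.homogeneous_span _ _ <| by
      rintro _ ⟨j, -, rfl⟩
      exact ⟨1, isHomogeneous_X _ _⟩
  have heval : ∀ s : Set (Fin n), linearRelations a ⊔ Ideal.span (X '' s) ≤
      (Ideal.span (a '' s)).comap (eval a) := fun s => by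
    refine sup_le (fun p hp => ?_) (Ideal.span_le.2 ?_)
    · simp [Ideal.mem_comap, eval_eq_zero_of_mem_linearRelations hp]
    · rintro _ ⟨j, hj, rfl⟩
      simpa [Ideal.mem_comap] using Ideal.subset_span (Set.mem_image_of_mem a hj)
  induction d using Nat.strong_induction_on with
  | _ d ihd =>
  intro k
  induction k with
  | zero =>
    rintro i rfl F hF -
    refine Ideal.mem_sup_right (mem_ideal_span_X_image.2 fun m hm => ?_)
    have h : m.support.Nonempty := by
      rw [Finsupp.support_nonempty_iff]
      rintro rfl
      have := hF.degree_eq_sum_deg_support hm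
      simp at this
    obtain ⟨j, hj⟩ := h
    exact ⟨j, j.2, Finsupp.mem_support_iff.1 hj⟩
  | succ k ihk =>
    intro i hi F hF hFi
    have hin : i < n := by omega
    have hset : {j : Fin n | j.val < i + 1} = insert ⟨i, hin⟩ {j : Fin n | j.val < i} := by
      ext j
      simp only [Set.mem_ofPred_eq, Set.mem_insert_iff, Fin.ext_iff]
      omega
    have h1 := ihk (i + 1) (by omega) F hF
      (Ideal.span_mono (Set.image_mono fun j hj => Nat.lt_succ_of_lt hj) hFi)
    rw [hset, Set.image_insert_eq, Ideal.span_insert, sup_left_comm, Submodule.mem_sup] at h1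
    obtain ⟨_, hy, u, hu, rfl⟩ := h1
    obtain ⟨G, rfl⟩ := Ideal.mem_span_singleton'.1 hy
    replace hu : u ∈ linearRelations a ⊔ Ideal.span (X '' {j : Fin n | j.val < i}) := hu
    have hG := homogeneousComponent_isHomogeneous d G
    have h2 : G * X ⟨i, hin⟩ + u -
        X ⟨i, hin⟩ * homogeneousComponent d G ∈
          linearRelations a ⊔ Ideal.span (X '' {j : Fin n | j.val < i}) := by
      have h3 := homogeneousComponent_mem_of_mem (hhom _) hu (d + 1)
      have h4 := homogeneousComponent_eq_self hF
      rw [map_add, mul_comm, homogeneousComponent_succ_X_mul] at h4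
      rw [mul_comm, ← h4]
      simpa using h3
    have h3 : a ⟨i, hin⟩ * eval a (homogeneousComponent d G) ∈
        Ideal.span (a '' {j | j.val < i}) := by
      have h4 := sub_mem hFi (heval _ h2)
      simpa using h4
    refine (Submodule.sub_mem_iff_left _ ?_).1 h2
    cases d with
    | zero =>
      rw [homogeneousComponent_zero] at h3 ⊢
      obtain ⟨e, he, hea⟩ := exists_sum_mul_eq_of_mem_span_image h3
      have h5 : ∑ j, C (e j - if j = ⟨i, hin⟩ then coeff 0 G else 0) * X j ∈ linearRelations a := by
        refine sum_mem_linearRelations ?_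
        simp only [sub_mul, Finset.sum_sub_distrib, hea]
        simp [mul_comm]
      have h6 : X ⟨i, hin⟩ * C (coeff 0 G) = ∑ j, C (e j) * X j -
          ∑ j, C (e j - if j = ⟨i, hin⟩ then coeff 0 G else 0) * X j := by
        simp only [map_sub, sub_mul, Finset.sum_sub_distrib, sub_sub_cancel]
        simp [apply_ite C, mul_comm]
      rw [h6]
      refine sub_mem (Ideal.mem_sup_right (Ideal.sum_mem _ fun j _ => ?_)) (Ideal.mem_sup_left h5)
      by_cases hj : j.val < i
      · exact Ideal.mul_mem_left _ _ (Ideal.subset_span (Set.mem_image_of_mem X hj))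
      · simp [he j hj]
    | succ d =>
      exact Ideal.mul_mem_left _ _ (ihd d (Nat.lt_succ_self d) (k + 1) i hi _ hG
        (ha ⟨i, hin⟩ _ (eval_mem_span_range_of_isHomogeneous a hG) h3))

/-- A `d`-sequence is of linear type. -/
theorem isLinearType_of_forall_mem (a : Fin n → A)
    (ha : ∀ i : Fin n, ∀ x ∈ Ideal.span (Set.range a),
      a i * x ∈ Ideal.span (a '' {j | j < i}) → x ∈ Ideal.span (a '' {j | j < i})) :
    IsLinearType a := by
  intro d F hF hF0
  cases d with
  | zero =>
    rw [← mem_homogeneousSubmodule, homogeneousSubmodule_zero, Submodule.mem_one] at hF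
    obtain ⟨c, rfl⟩ := hF
    rw [algebraMap_eq, eval_C] at hF0
    simp [hF0]
  | succ d =>
    simpa using mem_linearRelations_sup_of_eval_mem a ha d n 0 (zero_add n) F hF (by simp [hF0])

end DSequence

section Depth

open CategoryTheory Abelian

universe u

variable {A : Type u} [CommRing A] [IsLocalRing A]

open IsLocalRing

/-- The depth of `A ⧸ J` is at least `k`, in terms of the vanishing of
`Ext (A ⧸ 𝔪) (A ⧸ J) j` for `j < k`. -/
def DepthAtLeast (k : ℕ) (J : Ideal A) : Prop :=
  ∀ j < k, Subsingleton (Ext (ModuleCat.of A (A ⧸ maximalIdeal A)) (ModuleCat.of A (A ⧸ J)) j)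

theorem DepthAtLeast.mono {k l : ℕ} {J : Ideal A} (h : DepthAtLeast l J) (hkl : k ≤ l) :
    DepthAtLeast k J := fun j hj ↦ h j (hj.trans_le hkl)

/-- If `A ⧸ J` has positive depth, then its socle vanishes. -/
theorem DepthAtLeast.mem_of_forall_mul_mem {J : Ideal A} (h : DepthAtLeast 1 J) {x : A}
    (hx : ∀ r ∈ maximalIdeal A, r * x ∈ J) : x ∈ J := by
  have : Subsingleton (ModuleCat.of A (A ⧸ maximalIdeal A) ⟶ ModuleCat.of A (A ⧸ J)) :=
    Ext.addEquiv₀.subsingleton_congr.mp (h 0 one_pos)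
  have : Subsingleton ((A ⧸ maximalIdeal A) →ₗ[A] (A ⧸ J)) :=
    (ModuleCat.homAddEquiv (M := ModuleCat.of A (A ⧸ maximalIdeal A))
      (N := ModuleCat.of A (A ⧸ J))).symm.subsingleton
  let φ : (A ⧸ maximalIdeal A) →ₗ[A] (A ⧸ J) :=
    Submodule.liftQ (maximalIdeal A) (LinearMap.toSpanSingleton A (A ⧸ J) (Ideal.Quotient.mk J x))
      (fun r hr ↦ by
        rw [LinearMap.mem_ker, LinearMap.toSpanSingleton_apply]
        exact Ideal.Quotient.eq_zero_iff_mem.mpr (hx r hr))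
  have h1 : φ (Submodule.Quotient.mk 1) = Ideal.Quotient.mk J x := by
    simp only [φ, Submodule.liftQ_apply, LinearMap.toSpanSingleton_apply, one_smul]
  rw [Subsingleton.elim φ 0, LinearMap.zero_apply] at h1
  exact Ideal.Quotient.eq_zero_iff_mem.mp h1.symm

theorem DepthAtLeast.sup_span_singleton {k : ℕ} {J : Ideal A} (h : DepthAtLeast (k + 1) J) {a : A}
    (ha : ∀ x, a * x ∈ J → x ∈ J) : DepthAtLeast k (J ⊔ Ideal.span {a}) := by
  let f : (A ⧸ J) →ₗ[A] (A ⧸ J) := LinearMap.lsmul A (A ⧸ J) a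
  let g : (A ⧸ J) →ₗ[A] (A ⧸ (J ⊔ Ideal.span {a})) := Submodule.factor le_sup_left
  have hf : Function.Injective f := by
    refine (injective_iff_map_eq_zero f).mpr fun x hx ↦ ?_
    obtain ⟨x, rfl⟩ := Ideal.Quotient.mk_surjective x
    exact Ideal.Quotient.eq_zero_iff_mem.mpr (ha x (Ideal.Quotient.eq_zero_iff_mem.mp hx))
  have hg : Function.Surjective g := Submodule.factor_surjective le_sup_left
  have hfg : Function.Exact f g := by
    intro x
    obtain ⟨x, rfl⟩ := Ideal.Quotient.mk_surjective x
    have : g (Ideal.Quotient.mk J x) = 0 ↔ x ∈ J ⊔ Ideal.span {a} :=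
      Ideal.Quotient.eq_zero_iff_mem
    rw [this, sup_comm, Ideal.mem_span_singleton_sup]
    constructor
    · rintro ⟨r, b, hb, rfl⟩
      refine ⟨Ideal.Quotient.mk J r, ?_⟩
      change Ideal.Quotient.mk J (a * r) = _
      rw [Ideal.Quotient.eq]
      convert J.neg_mem hb using 1
      ring
    · rintro ⟨y, hy⟩
      obtain ⟨y, rfl⟩ := Ideal.Quotient.mk_surjective y
      have hy : Ideal.Quotient.mk J (a * y) = Ideal.Quotient.mk J x := hy
      rw [Ideal.Quotient.eq] at hy
      exact ⟨y, x - a * y, by rw [← neg_sub]; exact J.neg_mem hy, by ring⟩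
  let S : ShortComplex (ModuleCat A) :=
    ModuleCat.shortComplexOfCompEqZero f g hfg.linearMap_comp_eq_zero
  have hS : S.ShortExact :=
    { exact := ModuleCat.shortComplex_exact _ hfg
      mono_f := (ModuleCat.mono_iff_injective _).mpr hf
      epi_g := (ModuleCat.epi_iff_surjective _).mpr hg }
  intro j hj
  have zero1 := AddCommGrpCat.isZero_of_iff_subsingleton.mpr (h j (by omega))
  have zero2 := AddCommGrpCat.isZero_of_iff_subsingleton.mpr (h (j + 1) (by omega))
  exact AddCommGrpCat.subsingleton_of_isZero <| ShortComplex.Exact.isZero_of_both_zeros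
    (Ext.covariant_sequence_exact₃' _ hS j (j + 1) rfl)
    (zero1.eq_zero_of_src _) (zero2.eq_zero_of_tgt _)

end Depth

section Avoidance

variable {A ι : Type*} [CommRing A]

/-- Prime avoidance in which each prime `q` of a finite family is replaced by an ideal `W` with
`W : r = W` for `r ∉ q`, and where the element is sought in a coset of an ideal. -/
theorem exists_add_notMem_of_finset [DecidableEq ι] (s : Finset ι) (q W : ι → Ideal A)
    (hinj : Function.Injective q) (hq : ∀ i ∈ s, (q i).IsPrime)
    (hW : ∀ i ∈ s, ∀ r x, r ∉ q i → r * x ∈ W i → x ∈ W i) {I B : Ideal A} (hB : B ≤ I)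
    (hqI : ∀ i ∈ s, ∀ r ∈ q i, ∀ x ∈ I, r * x ∈ W i) {f : A}
    (h : ∀ i ∈ s, f ∈ W i → ¬ B ≤ W i) : ∃ b ∈ B, ∀ i ∈ s, f + b ∉ W i := by
  induction s using Finset.strongInduction with
  | H s ih =>
    rcases s.eq_empty_or_nonempty with rfl | hs
    · exact ⟨0, B.zero_mem, by simp⟩
    obtain ⟨i, hi, hmin⟩ := s.exists_minimalFor q hs
    have hsub : ∀ j ∈ s.erase i, j ∈ s := fun j hj ↦ Finset.mem_of_mem_erase hj
    obtain ⟨b, hb, hbW⟩ := ih (s.erase i) (Finset.erase_ssubset hi)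
      (fun j hj ↦ hq j (hsub j hj)) (fun j hj ↦ hW j (hsub j hj))
      (fun j hj ↦ hqI j (hsub j hj)) (fun j hj ↦ h j (hsub j hj))
    by_cases hbi : f + b ∈ W i
    · have hBW : ¬ B ≤ W i := by
        intro hBW
        exact h i hi (by simpa using (W i).sub_mem hbi (hBW hb)) hBW
      obtain ⟨c, hc, hcW⟩ := SetLike.not_le_iff_exists.mp hBW
      obtain ⟨r, hr, hrq⟩ : ∃ r, r ∈ (s.erase i).inf q ∧ r ∉ q i := by
        refine SetLike.not_le_iff_exists.mp fun hle ↦ ?_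
        obtain ⟨j, hj, hji⟩ := ((hq i hi).inf_le').mp hle
        refine Finset.ne_of_mem_erase hj (hinj (le_antisymm hji (hmin (hsub j hj) hji)))
      refine ⟨b + r * c, B.add_mem hb (B.mul_mem_left _ hc), fun j hj hmem ↦ ?_⟩
      rw [← add_assoc] at hmem
      by_cases hji : j = i
      · subst hji
        exact hcW (hW j hj r c hrq (by simpa using (W j).sub_mem hmem hbi))
      · have hj' := Finset.mem_erase.mpr ⟨hji, hj⟩
        refine hbW j hj' ?_
        have := (W j).sub_mem hmem (hqI j hj r ((Finset.inf_le hj' : _ ≤ q j) hr) c (hB hc))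
        simpa using this
    · refine ⟨b, hb, fun j hj ↦ ?_⟩
      by_cases hji : j = i
      · rwa [hji]
      · exact hbW j (Finset.mem_erase.mpr ⟨hji, hj⟩)

end Avoidance

section Chain

variable {B : Type*} [CommRing B] [IsLocalRing B] [IsNoetherianRing B]

open IsLocalRing Module

theorem eq_maximalIdeal_of_chain {N : ℕ} (hN : finrank (ResidueField B) (CotangentSpace B) ≤ N)
    (J : ℕ → Ideal B) (hJm : ∀ i ≤ N, J i ≤ maximalIdeal B) (hmono : ∀ i < N, J i ≤ J (i + 1))
    (hJ : ∀ i < N, ¬ J (i + 1) ≤ J i ⊔ maximalIdeal B ^ 2) : J N = maximalIdeal B := by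
  let V : ℕ → Submodule (ResidueField B) (CotangentSpace B) := fun i ↦
    Submodule.span (ResidueField B) ((maximalIdeal B).toCotangent '' {x | (x : B) ∈ J i})
  have hV : ∀ i, (V i).restrictScalars B =
      (Submodule.comap (maximalIdeal B).subtype (J i)).map (maximalIdeal B).toCotangent := by
    intro i
    simp only [V]
    rw [Submodule.restrictScalars_span _ _ Ideal.Quotient.mk_surjective, ← Submodule.map_span]
    congr 1
    exact Submodule.span_eq (Submodule.comap (maximalIdeal B).subtype (J i))
  have hmemV : ∀ i (x : maximalIdeal B), (maximalIdeal B).toCotangent x ∈ V i →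
      (x : B) ∈ J i ⊔ maximalIdeal B ^ 2 := by
    intro i x hx
    rw [← Submodule.restrictScalars_mem B, hV] at hx
    obtain ⟨y, hy, hyx⟩ := hx
    rw [Ideal.toCotangent_eq] at hyx
    have hy : (y : B) ∈ J i := hy
    have h2 := sub_mem (Ideal.mem_sup_left hy) (Ideal.mem_sup_right (S := J i) hyx)
    rwa [sub_sub_cancel] at h2
  have hlt : ∀ i < N, V i < V (i + 1) := by
    intro i hi
    refine lt_of_le_of_ne (Submodule.span_mono (Set.image_mono fun x hx ↦ hmono i hi hx)) ?_
    intro heq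
    refine hJ i hi fun x hx ↦ ?_
    refine hmemV i ⟨x, hJm (i + 1) hi hx⟩ ?_
    rw [heq]
    exact Submodule.subset_span ⟨_, hx, rfl⟩
  have hrank : ∀ i ≤ N, i ≤ finrank (ResidueField B) (V i) := by
    intro i
    induction i with
    | zero => simp
    | succ i ih =>
      intro hi
      have := Submodule.finrank_lt_finrank_of_lt (hlt i (by omega))
      have := ih (by omega)
      omega
  have htop : V N = ⊤ := Submodule.eq_top_of_finrank_eq
    (le_antisymm (Submodule.finrank_le _) (hN.trans (hrank N le_rfl)))
  have h1 := hV N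
  rw [htop, Submodule.restrictScalars_top, eq_comm, CotangentSpace.map_eq_top_iff] at h1
  exact le_antisymm (hJm N le_rfl) (Submodule.comap_subtype_eq_top.mp h1)

end Chain

section AssociatedPrimes

variable {A : Type*} [CommRing A] [IsNoetherianRing A]

theorem isAssociatedPrime_quotient_iff {J Q : Ideal A} :
    IsAssociatedPrime Q (A ⧸ J) ↔ Q.IsPrime ∧ ∃ y, ∀ r, r ∈ Q ↔ r * y ∈ J := by
  rw [isAssociatedPrime_iff]
  refine and_congr_right fun _ ↦ ?_
  rw [Ideal.Quotient.mk_surjective.exists]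
  refine exists_congr fun y ↦ ?_
  rw [SetLike.ext_iff]
  refine forall_congr' fun r ↦ ?_
  rw [Submodule.mem_colon_singleton, Submodule.mem_bot, ← Ideal.Quotient.eq_zero_iff_mem (I := J)]
  rfl

theorem exists_isAssociatedPrime_of_notMem {J : Ideal A} {x : A} (hx : x ∉ J) :
    ∃ Q, IsAssociatedPrime Q (A ⧸ J) ∧ ∀ r, r * x ∈ J → r ∈ Q := by
  obtain ⟨Q, hQ, hle⟩ := exists_le_isAssociatedPrime_of_isNoetherianRing A
    (Ideal.Quotient.mk J x) (fun h ↦ hx (Ideal.Quotient.eq_zero_iff_mem.mp h))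
  refine ⟨Q, hQ, fun r hr ↦ hle ?_⟩
  rw [Submodule.mem_colon_singleton, Submodule.mem_bot]
  exact Ideal.Quotient.eq_zero_iff_mem.mpr hr

theorem exists_forall_mul_mem_of_forall_exists {P J K : Ideal A} [P.IsPrime]
    (h : ∀ x ∈ K, ∃ s ∉ P, s * x ∈ J) : ∃ s ∉ P, ∀ x ∈ K, s * x ∈ J := by
  obtain ⟨t, rfl⟩ := IsNoetherian.noetherian K
  obtain ⟨s, hs, hst⟩ : ∃ s ∉ P, ∀ x ∈ t, s * x ∈ J := by
    have h : ∀ x ∈ t, ∃ s ∉ P, s * x ∈ J := fun x hx ↦ h x (Submodule.subset_span hx)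
    clear * - h
    classical
    induction t using Finset.induction_on with
    | empty => exact ⟨1, (Ideal.ne_top_iff_one P).mp Ideal.IsPrime.ne_top', by simp⟩
    | insert x t hx ih =>
      obtain ⟨s, hs, hst⟩ := ih fun y hy ↦ h y (Finset.mem_insert_of_mem hy)
      obtain ⟨r, hr, hrx⟩ := h x (Finset.mem_insert_self x t)
      refine ⟨r * s, fun hrs ↦ ((‹P.IsPrime›.mem_or_mem hrs).elim hr hs), fun y hy ↦ ?_⟩
      rcases Finset.mem_insert.mp hy with rfl | hy
      · rw [mul_right_comm]
        exact J.mul_mem_right _ hrx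
      · rw [mul_assoc]
        exact J.mul_mem_left _ (hst y hy)
  refine ⟨s, hs, fun x hx ↦ ?_⟩
  have hle : Submodule.span A (t : Set A) ≤ Submodule.comap (LinearMap.mulLeft A s) J :=
    Submodule.span_le.mpr hst
  exact hle hx

end AssociatedPrimes

section AssociatedPrimesOfDepth

universe u

variable {A : Type u} [CommRing A] [IsLocalRing A] [IsNoetherianRing A]

open IsLocalRing

theorem DepthAtLeast.not_isAssociatedPrime_maximalIdeal {J : Ideal A} (h : DepthAtLeast 1 J) :
    ¬ IsAssociatedPrime (maximalIdeal A) (A ⧸ J) := by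
  rw [isAssociatedPrime_quotient_iff]
  rintro ⟨-, y, hy⟩
  have hyJ : y ∈ J := h.mem_of_forall_mul_mem fun r hr ↦ (hy r).mp hr
  exact (Ideal.ne_top_iff_one _).mp (maximalIdeal.isMaximal A).ne_top ((hy 1).mpr (by simpa))

theorem DepthAtLeast.exists_regular {J : Ideal A} (h : DepthAtLeast 1 J) :
    ∃ z ∈ maximalIdeal A, ∀ x, z * x ∈ J → x ∈ J := by
  have hnot : ¬ (maximalIdeal A : Set A) ⊆ ⋃ q ∈ associatedPrimes A (A ⧸ J), q := by
    rw [Ideal.subset_union_prime_finite (associatedPrimes.finite A (A ⧸ J)) ⊥ ⊥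
      fun q hq _ _ ↦ hq.isPrime]
    rintro ⟨q, hq, hle⟩
    have := (maximalIdeal.isMaximal A).eq_of_le hq.isPrime.ne_top hle
    exact h.not_isAssociatedPrime_maximalIdeal (this ▸ hq)
  obtain ⟨z, hz, hzq⟩ := Set.not_subset.mp hnot
  refine ⟨z, hz, fun x hx ↦ by_contra fun hxJ ↦ ?_⟩
  obtain ⟨Q, hQ, hQx⟩ := exists_isAssociatedPrime_of_notMem hxJ
  exact hzq (Set.mem_biUnion hQ (hQx z hx))

/-- An associated prime of a quotient of depth at least two has dimension at least two. -/
theorem DepthAtLeast.not_isAssociatedPrime {J P : Ideal A} (h : DepthAtLeast 2 J)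
    (hP : ∀ Q : Ideal A, Q.IsPrime → P < Q → Q = maximalIdeal A) :
    ¬ IsAssociatedPrime P (A ⧸ J) := by
  rw [isAssociatedPrime_quotient_iff]
  rintro ⟨hprime, y, hy⟩
  obtain ⟨z, hz, hreg⟩ := (h.mono one_le_two).exists_regular
  have hyJ : y ∉ J := fun hyJ ↦ (Ideal.ne_top_iff_one P).mp hprime.ne_top ((hy 1).mpr (by simpa))
  obtain ⟨x, hxP, hxJ⟩ : ∃ x, (∀ p ∈ P, p * x ∈ J) ∧ x ∉ J ⊔ Ideal.span {z} := by
    by_contra! hcon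
    let H : Ideal A := J.colon (P : Set A)
    have hH : ∀ x, x ∈ H ↔ ∀ p ∈ P, p * x ∈ J := by
      intro x
      rw [Submodule.mem_colon]
      exact forall₂_congr fun p _ ↦ by rw [smul_eq_mul, mul_comm]
    have hle : H ≤ J ⊔ Ideal.span {z} • H := by
      intro x hx
      rw [hH] at hx
      have hx' := hcon x hx
      rw [sup_comm, Ideal.mem_span_singleton_sup] at hx'
      obtain ⟨c, j, hj, rfl⟩ := hx'
      refine add_mem (Ideal.mem_sup_right ?_) (Ideal.mem_sup_left hj)
      rw [mul_comm, smul_eq_mul]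
      refine Ideal.mul_mem_mul (Ideal.mem_span_singleton_self z) ((hH c).mpr fun p hp ↦ ?_)
      refine hreg _ ?_
      have := J.sub_mem (hx p hp) (J.mul_mem_left p hj)
      convert this using 1
      ring
    have hHJ : H ≤ J := Submodule.le_of_le_smul_of_le_jacobson_bot (IsNoetherian.noetherian H)
      ((Ideal.span_singleton_le_iff_mem _).mpr
        ((jacobson_eq_maximalIdeal (⊥ : Ideal A) bot_ne_top).symm ▸ hz)) hle
    exact hyJ (hHJ ((hH y).mpr fun p hp ↦ (hy p).mp hp))
  obtain ⟨Q, hQ, hQx⟩ := exists_isAssociatedPrime_of_notMem hxJ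
  have hPQ : P < Q := by
    refine lt_of_le_of_ne (fun p hp ↦ hQx p (Ideal.mem_sup_left (hxP p hp))) ?_
    rintro rfl
    refine hyJ (hreg y ((hy z).mp (hQx z (Ideal.mem_sup_right ?_))))
    exact Ideal.mul_mem_right _ _ (Ideal.mem_span_singleton_self z)
  rw [hP Q hQ.isPrime hPQ] at hQ
  exact (h.sup_span_singleton hreg).not_isAssociatedPrime_maximalIdeal hQ

end AssociatedPrimesOfDepth

section Contraction

variable {A : Type*} [CommRing A]

/-- The contraction to `A` of the extension of `J ⊔ P ^ 2` to the localization at `P`. -/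
def cotangentHull (P : PrimeSpectrum A) (J : Ideal A) : Ideal A :=
  ((J ⊔ P.asIdeal ^ 2).map (algebraMap A (Localization.AtPrime P.asIdeal))).comap
    (algebraMap A (Localization.AtPrime P.asIdeal))

theorem mem_cotangentHull {P : PrimeSpectrum A} {J : Ideal A} {x : A} :
    x ∈ cotangentHull P J ↔ ∃ s ∉ P.asIdeal, s * x ∈ J ⊔ P.asIdeal ^ 2 := by
  rw [cotangentHull, Ideal.mem_comap,
    IsLocalization.algebraMap_mem_map_algebraMap_iff P.asIdeal.primeCompl]
  rfl

theorem le_cotangentHull (P : PrimeSpectrum A) (J : Ideal A) :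
    J ⊔ P.asIdeal ^ 2 ≤ cotangentHull P J :=
  Ideal.le_comap_map

theorem exists_forall_mul_mem_of_le_cotangentHull [IsNoetherianRing A] {P : PrimeSpectrum A}
    {I J : Ideal A} (hIP : ∀ x ∈ P.asIdeal, ∃ s ∉ P.asIdeal, s * x ∈ I)
    (h : I ≤ cotangentHull P J) : ∃ s ∉ P.asIdeal, ∀ x ∈ P.asIdeal, s * x ∈ J := by
  refine exists_forall_mul_mem_of_forall_exists fun x hx ↦ ?_
  let φ := algebraMap A (Localization.AtPrime P.asIdeal)
  have hle : P.asIdeal.map φ ≤ J.map φ := by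
    refine Submodule.le_of_le_smul_of_le_jacobson_bot (IsNoetherian.noetherian _)
      (IsLocalRing.jacobson_eq_maximalIdeal _ bot_ne_top).ge ?_
    rw [smul_eq_mul, ← Localization.AtPrime.map_eq_maximalIdeal, ← pow_two, ← Ideal.map_pow,
      ← Ideal.map_sup]
    refine Ideal.map_le_iff_le_comap.mpr fun x hx ↦ ?_
    obtain ⟨s, hs, hsx⟩ := hIP x hx
    obtain ⟨r, hr, hrx⟩ := mem_cotangentHull.mp (h hsx)
    rw [Ideal.mem_comap, IsLocalization.algebraMap_mem_map_algebraMap_iff P.asIdeal.primeCompl]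
    exact ⟨r * s, fun hrs ↦ (P.isPrime.mem_or_mem hrs).elim hr hs, by rwa [mul_assoc]⟩
  have hx' := hle (Ideal.mem_map_of_mem φ hx)
  rwa [IsLocalization.algebraMap_mem_map_algebraMap_iff P.asIdeal.primeCompl] at hx'

end Contraction

section GeneralElements

universe u

variable {A : Type u} [CommRing A] [IsLocalRing A]

open IsLocalRing

theorem primeSpectrum_asIdeal_injective {A : Type*} [CommRing A] :
    Function.Injective (PrimeSpectrum.asIdeal : PrimeSpectrum A → Ideal A) :=
  fun _ _ ↦ PrimeSpectrum.ext

/-- The primes containing `I` in the punctured spectrum of a local ring. -/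
def puncturedZeroLocus (I : Ideal A) : Set (PrimeSpectrum A) :=
  {P | I ≤ P.asIdeal ∧ P.asIdeal ≠ maximalIdeal A}

variable [IsNoetherianRing A]

theorem puncturedZeroLocus_finite {I : Ideal A}
    (hdim : ∀ P Q : PrimeSpectrum A, I ≤ P.asIdeal → P < Q → Q.asIdeal = maximalIdeal A) :
    (puncturedZeroLocus I).Finite := by
  refine ((I.finite_minimalPrimes_of_isNoetherianRing A).preimage
    (primeSpectrum_asIdeal_injective.injOn)).subset fun P hP ↦ ?_
  refine ⟨⟨P.isPrime, hP.1⟩, fun q hq hqP ↦ ?_⟩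
  by_contra hne
  exact hP.2 (hdim ⟨q, hq.1⟩ P hq.2 (lt_of_le_not_ge hqP hne))

theorem exists_regular_add_mem {I J B : Ideal A} {f : A} (hI : J ⊔ Ideal.span {f} ⊔ B = I)
    (hJ : DepthAtLeast 2 J)
    (hdim : ∀ P Q : PrimeSpectrum A, I ≤ P.asIdeal → P < Q → Q.asIdeal = maximalIdeal A)
    (hred : ∀ P ∈ puncturedZeroLocus I, ∀ x ∈ P.asIdeal, ∃ s ∉ P.asIdeal, s * x ∈ I) :
    ∃ b ∈ B, (∀ x, (f + b) * x ∈ J → x ∈ J) ∧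
      ∀ P ∈ puncturedZeroLocus I, f + b ∉ cotangentHull P J := by
  classical
  have hnot : ∀ P ∈ puncturedZeroLocus I, ¬ IsAssociatedPrime P.asIdeal (A ⧸ J) := fun P hP ↦
    hJ.not_isAssociatedPrime fun Q hQ hPQ ↦ hdim P ⟨Q, hQ⟩ hP.1 hPQ
  have hJI : J ≤ I := hI ▸ le_sup_left.trans le_sup_left
  have hfI : f ∈ I := hI ▸ Ideal.mem_sup_left
    (Ideal.mem_sup_right (Ideal.mem_span_singleton_self f))
  have hfin : (PrimeSpectrum.asIdeal ⁻¹' associatedPrimes A (A ⧸ J) ∪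
      puncturedZeroLocus I).Finite :=
    ((associatedPrimes.finite A (A ⧸ J)).preimage primeSpectrum_asIdeal_injective.injOn).union
      (puncturedZeroLocus_finite hdim)
  let W : PrimeSpectrum A → Ideal A := fun q ↦
    if IsAssociatedPrime q.asIdeal (A ⧸ J) then q.asIdeal else cotangentHull q J
  have hWa : ∀ q : PrimeSpectrum A, IsAssociatedPrime q.asIdeal (A ⧸ J) → W q = q.asIdeal :=
    fun q hq ↦ if_pos hq
  have hWn : ∀ q : PrimeSpectrum A, ¬ IsAssociatedPrime q.asIdeal (A ⧸ J) →
    W q = cotangentHull q J := fun q hq ↦ if_neg hq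
  have hmem : ∀ q ∈ hfin.toFinset, ¬ IsAssociatedPrime q.asIdeal (A ⧸ J) →
      q ∈ puncturedZeroLocus I := by
    intro q hq hqa
    exact ((Set.Finite.mem_toFinset hfin).mp hq).resolve_left hqa
  have hW : ∀ q ∈ hfin.toFinset, ∀ r x, r ∉ q.asIdeal → r * x ∈ W q → x ∈ W q := by
    intro q hq r x hr hrx
    by_cases hqa : IsAssociatedPrime q.asIdeal (A ⧸ J)
    · rw [hWa q hqa] at hrx ⊢
      exact (q.isPrime.mem_or_mem hrx).resolve_left hr
    · rw [hWn q hqa, mem_cotangentHull] at hrx ⊢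
      obtain ⟨s, hs, hsx⟩ := hrx
      exact ⟨s * r, fun hrs ↦ (q.isPrime.mem_or_mem hrs).elim hs hr, by rwa [mul_assoc]⟩
  have hqI : ∀ q ∈ hfin.toFinset, ∀ r ∈ q.asIdeal, ∀ x ∈ I, r * x ∈ W q := by
    intro q hq r hr x hx
    by_cases hqa : IsAssociatedPrime q.asIdeal (A ⧸ J)
    · rw [hWa q hqa]
      exact q.asIdeal.mul_mem_right _ hr
    · rw [hWn q hqa]
      refine le_cotangentHull q J (Ideal.mem_sup_right ?_)
      rw [pow_two]
      exact Ideal.mul_mem_mul hr ((hmem q hq hqa).1 hx)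
  have hle : ∀ q ∈ hfin.toFinset, f ∈ W q → ¬ B ≤ W q := by
    intro q hq hfW hBW
    have hJW : J ≤ W q := by
      by_cases hqa : IsAssociatedPrime q.asIdeal (A ⧸ J)
      · rw [hWa q hqa]
        obtain ⟨-, y, hy⟩ := isAssociatedPrime_quotient_iff.mp hqa
        exact fun r hr ↦ (hy r).mpr (J.mul_mem_right _ hr)
      · rw [hWn q hqa]
        exact le_sup_left.trans (le_cotangentHull q J)
    have hIW : I ≤ W q :=
      hI ▸ sup_le (sup_le hJW ((Ideal.span_singleton_le_iff_mem _).mpr hfW)) hBW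
    by_cases hqa : IsAssociatedPrime q.asIdeal (A ⧸ J)
    · rw [hWa q hqa] at hIW
      by_cases hqm : q.asIdeal = maximalIdeal A
      · exact (hJ.mono one_le_two).not_isAssociatedPrime_maximalIdeal (hqm ▸ hqa)
      · exact hnot q ⟨hIW, hqm⟩ hqa
    · have hqp := hmem q hq hqa
      rw [hWn q hqa] at hIW
      obtain ⟨s, hs, hsJ⟩ := exists_forall_mul_mem_of_le_cotangentHull (hred q hqp) hIW
      refine hqa (isAssociatedPrime_quotient_iff.mpr ⟨q.isPrime, s, fun r ↦ ⟨fun hr ↦ ?_, ?_⟩⟩)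
      · rw [mul_comm]
        exact hsJ r hr
      · exact fun hr ↦ (q.isPrime.mem_or_mem (hqp.1 (hJI hr))).resolve_right hs
  obtain ⟨b, hb, hbW⟩ := exists_add_notMem_of_finset hfin.toFinset PrimeSpectrum.asIdeal W
    primeSpectrum_asIdeal_injective (fun q _ ↦ q.isPrime) hW (hI ▸ le_sup_right) hqI hle
  refine ⟨b, hb, fun x hx ↦ by_contra fun hxJ ↦ ?_, fun P hP ↦ ?_⟩
  · obtain ⟨Q, hQ, hQx⟩ := exists_isAssociatedPrime_of_notMem hxJ
    have hQs : (⟨Q, hQ.isPrime⟩ : PrimeSpectrum A) ∈ hfin.toFinset :=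
      (Set.Finite.mem_toFinset hfin).mpr (Or.inl hQ)
    refine hbW _ hQs ?_
    rw [hWa ⟨Q, hQ.isPrime⟩ hQ]
    exact hQx _ hx
  · rw [← hWn P (hnot P hP)]
    exact hbW P ((Set.Finite.mem_toFinset hfin).mpr (Or.inr hP))

end GeneralElements

section InitialIdeal

variable {A : Type*} [CommRing A]

/-- The ideal generated by the first `i` terms of a sequence. -/
def initialIdeal (a : ℕ → A) (i : ℕ) : Ideal A := Ideal.span (a '' {j | j < i})

@[simp]
theorem initialIdeal_zero (a : ℕ → A) : initialIdeal a 0 = ⊥ := by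
  simp [initialIdeal]

theorem initialIdeal_succ (a : ℕ → A) (i : ℕ) :
    initialIdeal a (i + 1) = initialIdeal a i ⊔ Ideal.span {a i} := by
  rw [initialIdeal, initialIdeal, ← Ideal.span_union, ← Set.image_singleton, ← Set.image_union]
  congr 2
  ext j
  simp only [Set.mem_ofPred_eq, Set.mem_union, Set.mem_singleton_iff]
  omega

theorem initialIdeal_mono (a : ℕ → A) : Monotone (initialIdeal a) := fun _ _ h ↦
  Ideal.span_mono (Set.image_mono fun _ hj ↦ lt_of_lt_of_le hj h)

theorem mem_initialIdeal (a : ℕ → A) {i j : ℕ} (h : j < i) : a j ∈ initialIdeal a i :=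
  Ideal.subset_span ⟨j, h, rfl⟩

theorem span_range_eq_initialIdeal (a : ℕ → A) (n : ℕ) :
    Ideal.span (Set.range fun i : Fin n ↦ a i) = initialIdeal a n := by
  rw [initialIdeal]
  congr 1
  ext x
  simp [Fin.exists_iff]

theorem span_image_eq_initialIdeal (a : ℕ → A) {n : ℕ} (i : Fin n) :
    Ideal.span ((fun j : Fin n ↦ a j) '' {j | j < i}) = initialIdeal a i := by
  rw [initialIdeal]
  congr 1
  ext x
  constructor
  · rintro ⟨j, hj, rfl⟩
    exact ⟨j, hj, rfl⟩
  · rintro ⟨j, hj, rfl⟩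
    exact ⟨⟨j, lt_trans hj i.isLt⟩, hj, rfl⟩

theorem initialIdeal_update (a : ℕ → A) (x : A) {i j : ℕ} (h : j ≤ i) :
    initialIdeal (Function.update a i x) j = initialIdeal a j := by
  rw [initialIdeal, initialIdeal]
  congr 1
  refine Set.image_congr fun k hk ↦ Function.update_of_ne ?_ _ _
  exact (lt_of_lt_of_le hk h).ne

end InitialIdeal

section LocalLinearType

universe u

variable {A : Type u} [CommRing A] [IsLocalRing A] [IsNoetherianRing A]

open IsLocalRing Module

theorem exists_general_sequence {N : ℕ} {f : ℕ → A} {I : Ideal A}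
    (hI : Ideal.span (f '' {k | k < N + 1}) = I) (hA : DepthAtLeast (N + 1) (⊥ : Ideal A))
    (hdim : ∀ P Q : PrimeSpectrum A, I ≤ P.asIdeal → P < Q → Q.asIdeal = maximalIdeal A)
    (hred : ∀ P ∈ puncturedZeroLocus I, ∀ x ∈ P.asIdeal, ∃ s ∉ P.asIdeal, s * x ∈ I)
    (i : ℕ) (hi : i ≤ N) :
    ∃ a : ℕ → A, DepthAtLeast (N + 1 - i) (initialIdeal a i) ∧
      initialIdeal a i ⊔ Ideal.span (f '' {k | i ≤ k ∧ k < N + 1}) = I ∧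
      ∀ j < i, (∀ x, a j * x ∈ initialIdeal a j → x ∈ initialIdeal a j) ∧
        ∀ P ∈ puncturedZeroLocus I, a j ∉ cotangentHull P (initialIdeal a j) := by
  induction i with
  | zero => exact ⟨0, by simpa using hA, by simpa using hI, by simp⟩
  | succ i ih =>
    obtain ⟨a, hdepth, hspan, ha⟩ := ih (by omega)
    let B : Ideal A := Ideal.span (f '' {k | i + 1 ≤ k ∧ k < N + 1})
    have hB : Ideal.span (f '' {k | i ≤ k ∧ k < N + 1}) = Ideal.span {f i} ⊔ B := by
      rw [← Ideal.span_union, ← Set.image_singleton, ← Set.image_union]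
      congr 2
      ext k
      simp only [Set.mem_ofPred_eq, Set.mem_union, Set.mem_singleton_iff]
      omega
    rw [hB, ← sup_assoc] at hspan
    obtain ⟨b, hb, hreg, hhull⟩ :=
      exists_regular_add_mem hspan (hdepth.mono (by omega)) hdim hred
    refine ⟨Function.update a i (f i + b), ?_, ?_, fun j hj ↦ ?_⟩
    · rw [initialIdeal_succ, initialIdeal_update a _ le_rfl, Function.update_self]
      refine DepthAtLeast.sup_span_singleton ?_ hreg
      convert hdepth using 1
      omega
    · rw [initialIdeal_succ, initialIdeal_update a _ le_rfl, Function.update_self]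
      refine le_antisymm (sup_le (sup_le ?_ ?_) ?_) (hspan ▸ sup_le (sup_le ?_ ?_) le_sup_right)
      · exact hspan ▸ le_sup_left.trans le_sup_left
      · rw [Ideal.span_singleton_le_iff_mem, ← hspan]
        exact add_mem (Ideal.mem_sup_left
          (Ideal.mem_sup_right (Ideal.mem_span_singleton_self _))) (Ideal.mem_sup_right hb)
      · exact hspan ▸ le_sup_right
      · exact le_sup_left.trans le_sup_left
      · rw [Ideal.span_singleton_le_iff_mem]
        have := sub_mem (Ideal.mem_sup_left (Ideal.mem_sup_right (S := initialIdeal a i)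
          (Ideal.mem_span_singleton_self (f i + b)))) (Ideal.mem_sup_right hb)
        rwa [add_sub_cancel_right] at this
    · rw [initialIdeal_update a _ (Nat.lt_succ_iff.mp hj)]
      rcases Nat.lt_succ_iff_lt_or_eq.mp hj with hj | rfl
      · rw [Function.update_of_ne hj.ne]
        exact ha j hj
      · rw [Function.update_self]
        exact ⟨hreg, hhull⟩

theorem exists_isLinearType {N : ℕ} {f : ℕ → A} {I : Ideal A}
    (hI : Ideal.span (f '' {k | k < N + 1}) = I) (hA : DepthAtLeast (N + 1) (⊥ : Ideal A))
    (hdim : ∀ P Q : PrimeSpectrum A, I ≤ P.asIdeal → P < Q → Q.asIdeal = maximalIdeal A)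
    (hred : ∀ P ∈ puncturedZeroLocus I, ∀ x ∈ P.asIdeal, ∃ s ∉ P.asIdeal, s * x ∈ I)
    (hcot : ∀ P ∈ puncturedZeroLocus I, finrank (ResidueField (Localization.AtPrime P.asIdeal))
      (CotangentSpace (Localization.AtPrime P.asIdeal)) ≤ N) :
    ∃ a : Fin (N + 1) → A, Ideal.span (Set.range a) = I ∧ IsLinearType a := by
  obtain ⟨a, hdepth, hspan, ha⟩ := exists_general_sequence hI hA hdim hred N le_rfl
  have hset : {k | N ≤ k ∧ k < N + 1} = {N} := by
    ext k
    simp only [Set.mem_ofPred_eq, Set.mem_singleton_iff]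
    omega
  rw [hset, Set.image_singleton] at hspan
  rw [Nat.add_sub_cancel_left] at hdepth
  have hJI : initialIdeal a N ≤ I := hspan ▸ le_sup_left
  have hlast : ∀ x ∈ I, f N * x ∈ initialIdeal a N → x ∈ initialIdeal a N := by
    intro x hx hfx
    by_contra hxJ
    obtain ⟨Q, hQ, hQx⟩ := exists_isAssociatedPrime_of_notMem hxJ
    have hprime := hQ.isPrime
    have hIQ : I ≤ Q := by
      rw [← hspan]
      refine sup_le (fun r hr ↦ hQx r (Ideal.mul_mem_right _ _ hr)) ?_
      exact (Ideal.span_singleton_le_iff_mem _).mpr (hQx _ hfx)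
    have hQm : Q ≠ maximalIdeal A := by
      rintro rfl
      exact hdepth.not_isAssociatedPrime_maximalIdeal hQ
    let P : PrimeSpectrum A := ⟨Q, hprime⟩
    have hP : P ∈ puncturedZeroLocus I := ⟨hIQ, hQm⟩
    let φ := algebraMap A (Localization.AtPrime P.asIdeal)
    have hmax : (initialIdeal a N).map φ = maximalIdeal (Localization.AtPrime P.asIdeal) := by
      refine eq_maximalIdeal_of_chain (hcot P hP) (fun i ↦ (initialIdeal a i).map φ) ?_ ?_ ?_
      · intro i hi
        rw [← Localization.AtPrime.map_eq_maximalIdeal]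
        exact Ideal.map_mono ((initialIdeal_mono a hi).trans (hJI.trans hIQ))
      · exact fun i _ ↦ Ideal.map_mono (initialIdeal_mono a i.le_succ)
      · intro i hi hle
        refine (ha i hi).2 P hP ?_
        rw [← Localization.AtPrime.map_eq_maximalIdeal, ← Ideal.map_pow, ← Ideal.map_sup] at hle
        exact hle (Ideal.mem_map_of_mem φ (mem_initialIdeal a i.lt_succ_self))
    have hxQ : φ x ∈ (initialIdeal a N).map φ := by
      rw [hmax, ← Localization.AtPrime.map_eq_maximalIdeal]
      exact Ideal.mem_map_of_mem φ (hIQ hx)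
    rw [IsLocalization.algebraMap_mem_map_algebraMap_iff P.asIdeal.primeCompl] at hxQ
    obtain ⟨s, hs, hsx⟩ := hxQ
    exact hs (hQx s hsx)
  have hspan' : initialIdeal (Function.update a N (f N)) (N + 1) = I := by
    rw [initialIdeal_succ, initialIdeal_update a _ le_rfl, Function.update_self, hspan]
  refine ⟨fun i ↦ Function.update a N (f N) i, ?_, isLinearType_of_forall_mem _ fun i x hx hix ↦ ?_⟩
  · rw [span_range_eq_initialIdeal, hspan']
  · rw [span_range_eq_initialIdeal, hspan'] at hx
    have hi : (i : ℕ) ≤ N := Nat.lt_succ_iff.mp i.isLt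
    rw [span_image_eq_initialIdeal, initialIdeal_update a _ hi] at hix ⊢
    rcases hi.lt_or_eq with hi | hi
    · rw [Function.update_of_ne hi.ne] at hix
      exact (ha i hi).1 x hix
    · rw [hi] at hix ⊢
      rw [Function.update_self] at hix
      exact hlast x hx hix

end LocalLinearType

section Geometry

open IsLocalRing Module

theorem eq_maximal_of_ringKrullDim_quotient_le_one {R : Type*} [CommRing R] {I M : Ideal R}
    [hM : M.IsPrime] (hdim : ringKrullDim (R ⧸ I) ≤ 1) {p q : PrimeSpectrum R}
    (hIp : I ≤ p.asIdeal) (hpq : p < q) (hqM : q.asIdeal ≤ M) : q.asIdeal = M := by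
  rw [ringKrullDim_quotient, Order.krullDim_le_one_iff] at hdim
  have hq : I ≤ q.asIdeal := hIp.trans hpq.le
  rcases hdim ⟨q, hq⟩ with h | h
  · exact absurd (h (b := ⟨p, hIp⟩) hpq.le) hpq.not_ge
  · exact le_antisymm hqM (h (b := ⟨⟨M, hM⟩, hq.trans hqM⟩) hqM)

theorem finrank_cotangentSpace_localization_le {R : Type*} [CommRing R] [IsRegularRing R] {N : ℕ}
    (hR : ringKrullDim R ≤ N + 1) (M : Ideal R) [M.IsPrime]
    (P : PrimeSpectrum (Localization.AtPrime M))
    (hP : P.asIdeal ≠ maximalIdeal (Localization.AtPrime M)) :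
    finrank (ResidueField (Localization.AtPrime P.asIdeal))
      (CotangentSpace (Localization.AtPrime P.asIdeal)) ≤ N := by
  have : IsRegularLocalRing (Localization.AtPrime P.asIdeal) := IsRegularLocalRing.of_ringEquiv
    (IsLocalization.localizationLocalizationAtPrimeIsoLocalization M.primeCompl
      P.asIdeal).toRingEquiv
  have h1 := (IsRegularLocalRing.iff_finrank_cotangentSpace _).mp this
  rw [IsLocalization.AtPrime.ringKrullDim_eq_height P.asIdeal] at h1
  have h2 : P.asIdeal.height = finrank (ResidueField (Localization.AtPrime P.asIdeal))
      (CotangentSpace (Localization.AtPrime P.asIdeal)) := by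
    exact_mod_cast h1.symm
  have hlt : P.asIdeal < maximalIdeal (Localization.AtPrime M) :=
    lt_of_le_of_ne (le_maximalIdeal P.isPrime.ne_top) hP
  have h3 := Ideal.height_add_one_le_of_lt_of_isPrime hlt
  have h4 : ((maximalIdeal (Localization.AtPrime M)).height : WithBot ℕ∞) ≤ N + 1 := by
    rw [maximalIdeal_height_eq_ringKrullDim, IsLocalization.AtPrime.ringKrullDim_eq_height M]
    exact Ideal.height_le_ringKrullDim_of_isPrime.trans hR
  have h5 : (maximalIdeal (Localization.AtPrime M)).height ≤ N + 1 := by exact_mod_cast h4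
  rw [h2] at h3
  have h6 := h3.trans h5
  have h7 : finrank (ResidueField (Localization.AtPrime P.asIdeal))
      (CotangentSpace (Localization.AtPrime P.asIdeal)) + 1 ≤ N + 1 := by exact_mod_cast h6
  omega

theorem exists_mul_mem_of_isRadical {A : Type*} [CommRing A] {I P : Ideal A} (hI : I.IsRadical)
    (hP : P ∈ I.minimalPrimes) {x : A} (hx : x ∈ P) : ∃ s ∉ P, s * x ∈ I := by
  have := hP.1.1
  have hx' : algebraMap A (Localization.AtPrime P) x ∈
      (I.map (algebraMap A (Localization.AtPrime P))).radical := by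
    rw [IsLocalization.AtPrime.radical_map_of_mem_minimalPrimes (Localization.AtPrime P) P I hP]
    exact Ideal.mem_map_of_mem _ hx
  rw [← IsLocalization.map_radical P.primeCompl, hI.radical,
    IsLocalization.algebraMap_mem_map_algebraMap_iff P.primeCompl] at hx'
  obtain ⟨s, hs, hsx⟩ := hx'
  exact ⟨s, hs, hsx⟩

variable {K : Type*} [Field K] {n : ℕ}

theorem isWeaklyRegular_X :
    RingTheory.Sequence.IsWeaklyRegular (MvPolynomial (Fin n) K)
      (List.ofFn (X : Fin n → MvPolynomial (Fin n) K)) := by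
  rw [RingTheory.Sequence.isWeaklyRegular_iff]
  intro i hi
  rw [isSMulRegular_quotient_iff_mem_of_smul_mem]
  intro p hp
  have hin : i < n := by simpa using hi
  have hideal : Ideal.ofList ((List.ofFn (X : Fin n → MvPolynomial (Fin n) K)).take i) •
      (⊤ : Submodule (MvPolynomial (Fin n) K) (MvPolynomial (Fin n) K)) =
      Ideal.span (X '' {j : Fin n | (j : ℕ) < i}) := by
    rw [smul_eq_mul, Ideal.mul_top, Ideal.ofList]
    congr 1
    ext p
    simp only [List.mem_take_iff_getElem, List.getElem_ofFn, List.length_ofFn, Set.mem_ofPred_eq,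
      Set.mem_image]
    constructor
    · rintro ⟨j, hj, rfl⟩
      exact ⟨⟨j, by omega⟩, by simp; omega, rfl⟩
    · rintro ⟨j, hj, rfl⟩
      exact ⟨j, by omega, rfl⟩
  rw [hideal, mem_ideal_span_X_image] at hp ⊢
  intro m hm
  rw [List.getElem_ofFn] at hp
  obtain ⟨j, hj, hmj⟩ := hp (m + Finsupp.single ⟨i, hin⟩ 1) (by
    rw [smul_eq_mul, mul_comm, MvPolynomial.mem_support_iff, coeff_mul_X]
    exact MvPolynomial.mem_support_iff.mp hm)
  refine ⟨j, hj, ?_⟩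
  have : (⟨i, hin⟩ : Fin n) ≠ j := by
    rintro rfl
    exact lt_irrefl i hj
  simpa [Finsupp.single_apply, this] using hmj

theorem depthAtLeast_localization (M : Ideal (MvPolynomial (Fin n) K)) [M.IsPrime]
    (hM : ∀ i, X i ∈ M) : DepthAtLeast n (⊥ : Ideal (Localization.AtPrime M)) := by
  have hreg := isWeaklyRegular_X.isRegular_of_isLocalization_of_mem (Localization.AtPrime M) M
    (rs := List.ofFn (X : Fin n → MvPolynomial (Fin n) K)) (by simpa [List.mem_ofFn] using hM)
  let A := Localization.AtPrime M
  have hreg' := ((Submodule.quotEquivOfEqBot (⊥ : Submodule A A) rfl).symm.isRegular_congr _).mp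
    hreg
  intro j hj
  refine ModuleCat.subsingleton_ext_of_exists_isRegular (maximalIdeal A)
    (ModuleCat.of A (A ⧸ maximalIdeal A)) ?_ (ModuleCat.of A (A ⧸ (⊥ : Ideal A))) ?_ _ ?_ hreg' j ?_
  · rw [Module.support_eq_zeroLocus, Ideal.annihilator_quotient]
  · rw [lt_top_iff_ne_top]
    intro h
    have : Nontrivial (A ⧸ (⊥ : Ideal A)) := Ideal.Quotient.nontrivial_iff.mpr bot_ne_top
    exact top_ne_bot (Submodule.eq_bot_of_le_smul_of_le_jacobson_bot (maximalIdeal A)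
      (⊤ : Submodule A (A ⧸ (⊥ : Ideal A))) Module.Finite.fg_top h.ge
      (IsLocalRing.maximalIdeal_le_jacobson _))
  · intro r hr
    simp only [List.map_ofFn, List.mem_ofFn, Function.comp_apply] at hr
    obtain ⟨i, rfl⟩ := hr
    exact (IsLocalization.AtPrime.to_map_mem_maximal_iff A M _).mpr (hM i)
  · simpa using hj

end Geometry

section LocalLinearType

open IsLocalRing Module

variable {K : Type*} [Field K]

theorem isLinearType_localization {N m : ℕ} (hm : m ≤ N + 1)
    {f : Fin m → MvPolynomial (Fin (N + 1)) K} {I : Ideal (MvPolynomial (Fin (N + 1)) K)}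
    (hI : I = Ideal.span (Set.range f)) (hrad : I.IsRadical)
    (hdim : ringKrullDim (MvPolynomial (Fin (N + 1)) K ⧸ I) ≤ 1)
    (M : Ideal (MvPolynomial (Fin (N + 1)) K)) [M.IsPrime] (hM : ∀ i, X i ∈ M) :
    IsLinearType fun i ↦ algebraMap _ (Localization.AtPrime M) (f i) := by
  let R := MvPolynomial (Fin (N + 1)) K
  let A := Localization.AtPrime M
  let IA : Ideal A := I.map (algebraMap R A)
  let g : ℕ → A := fun k ↦ if h : k < m then algebraMap R A (f ⟨k, h⟩) else 0
  have hspan : Ideal.span (Set.range fun i ↦ algebraMap R A (f i)) = IA := by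
    simp only [IA, hI]
    rw [Ideal.map_span, ← Set.range_comp]
    rfl
  have hg : Ideal.span (g '' {k | k < N + 1}) = IA := by
    rw [← hspan]
    refine le_antisymm (Ideal.span_le.mpr ?_) (Ideal.span_le.mpr ?_)
    · rintro _ ⟨k, -, rfl⟩
      by_cases h : k < m
      · simp only [g, h, dite_true]
        exact Ideal.subset_span ⟨_, rfl⟩
      · simp [g, h]
    · rintro _ ⟨i, rfl⟩
      refine Ideal.subset_span ⟨i, i.2.trans_le hm, ?_⟩
      simp [g]
  have hdimA : ∀ P Q : PrimeSpectrum A, IA ≤ P.asIdeal → P < Q → Q.asIdeal = maximalIdeal A := by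
    intro P Q hP hPQ
    have h1 : P.asIdeal.comap (algebraMap R A) < Q.asIdeal.comap (algebraMap R A) :=
      (IsLocalization.orderEmbedding M.primeCompl A).strictMono hPQ
    have h2 : Q.asIdeal.comap (algebraMap R A) ≤ M :=
      (Ideal.comap_mono (le_maximalIdeal Q.isPrime.ne_top)).trans
        (IsLocalization.AtPrime.under_maximalIdeal A M).le
    have h3 := eq_maximal_of_ringKrullDim_quotient_le_one hdim
      (p := PrimeSpectrum.comap (algebraMap R A) P) (q := PrimeSpectrum.comap (algebraMap R A) Q)
      (Ideal.map_le_iff_le_comap.mp hP) h1 h2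
    refine (IsLocalization.orderEmbedding M.primeCompl A).injective ?_
    exact h3.trans (IsLocalization.AtPrime.under_maximalIdeal A M).symm
  have hradA : IA.IsRadical := by
    rw [← Ideal.radical_eq_iff, show IA = _ from rfl, ← IsLocalization.map_radical M.primeCompl,
      hrad.radical]
  have hR : ringKrullDim R ≤ N + 1 := by
    rw [MvPolynomial.ringKrullDim_of_isNoetherianRing]
    simp
  obtain ⟨a, ha, hlin⟩ := exists_isLinearType hg (depthAtLeast_localization M hM) hdimA
    (fun P hP x hx ↦ exists_mul_mem_of_isRadical hradA ⟨⟨P.isPrime, hP.1⟩, fun q hq hqP ↦ by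
      by_contra hne
      exact hP.2 (hdimA ⟨q, hq.1⟩ P hq.2 (lt_of_le_not_ge hqP hne))⟩ hx)
    (fun P hP ↦ finrank_cotangentSpace_localization_le hR M P hP.2)
  exact hlin.of_span_eq (hspan.trans ha.symm)

end LocalLinearType

section Descent

attribute [local instance] MvPolynomial.algebraMvPolynomial

variable {R ι : Type*} [CommRing R] [Fintype ι]

theorem linearRelations_le_map_of_isLocalization (M : Submonoid R) (A : Type*) [CommRing A]
    [Algebra R A] [IsLocalization M A] (f : ι → R) :
    linearRelations (fun i ↦ algebraMap R A (f i)) ≤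
      (linearRelations f).map (algebraMap (MvPolynomial ι R) (MvPolynomial ι A)) := by
  refine linearRelations_le_iff.mpr fun b hb ↦ ?_
  obtain ⟨s, hs⟩ := IsLocalization.exist_integer_multiples_of_finite M b
  choose c hc using hs
  simp only [Algebra.smul_def] at hc
  have h0 : algebraMap R A (∑ i, c i * f i) = algebraMap R A 0 := by
    simp only [map_sum, map_mul, hc, mul_assoc, ← Finset.mul_sum, hb, mul_zero, map_zero]
  obtain ⟨t, ht⟩ := (IsLocalization.eq_iff_exists M A).mp h0
  have hu : IsUnit (C (σ := ι) (algebraMap R A (t * s))) :=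
    (IsLocalization.map_units A (t * s)).map C
  rw [← Ideal.unit_mul_mem_iff_mem _ hu]
  have hrel : ∑ i, C (t * c i) * X i ∈ linearRelations f :=
    sum_mem_linearRelations (by simpa [mul_assoc, ← Finset.mul_sum] using ht)
  convert Ideal.mem_map_of_mem (algebraMap (MvPolynomial ι R) (MvPolynomial ι A)) hrel using 1
  simp only [map_sum, map_mul, algebraMap_def, map_C, map_X, hc, Finset.mul_sum]
  exact Finset.sum_congr rfl fun i _ ↦ by ring

theorem IsLinearType.exists_C_mul_mem (M : Submonoid R) (A : Type*) [CommRing A]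
    [Algebra R A] [IsLocalization M A] {f : ι → R}
    (h : IsLinearType fun i ↦ algebraMap R A (f i)) {d : ℕ} {F : MvPolynomial ι R}
    (hF : F.IsHomogeneous d) (hFf : eval f F = 0) : ∃ s ∈ M, C s * F ∈ linearRelations f := by
  have h1 : algebraMap (MvPolynomial ι R) (MvPolynomial ι A) F ∈
      (linearRelations f).map (algebraMap (MvPolynomial ι R) (MvPolynomial ι A)) := by
    refine linearRelations_le_map_of_isLocalization M A f (h d _ (hF.map _) ?_)
    rw [algebraMap_def, ← Function.comp_def, ← map_eval, hFf, map_zero]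
  rw [IsLocalization.algebraMap_mem_map_algebraMap_iff (M.map (C (σ := ι)))] at h1
  obtain ⟨_, ⟨s, hs, rfl⟩, hsF⟩ := h1
  exact ⟨s, hs, hsF⟩

/-- Let `φ : R → R[z]` be a coaction for which each `f i` is homogeneous. An element of `R` whose
degree zero part is a unit acts regularly modulo the linear relations of `f`. -/
theorem mem_linearRelations_of_C_mul_mem (φ : R →+* Polynomial R)
    (hφ : (Polynomial.evalRingHom 1).comp φ = RingHom.id R) {f : ι → R} {d : ι → ℕ}
    (hf : ∀ i, φ (f i) = Polynomial.C (f i) * Polynomial.X ^ d i) {s : R}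
    (hs : IsUnit ((φ s).coeff 0)) {F : MvPolynomial ι R} (hF : C s * F ∈ linearRelations f) :
    F ∈ linearRelations f := by
  let Φ : MvPolynomial ι R →+* Polynomial (MvPolynomial ι R) :=
    eval₂Hom ((Polynomial.mapRingHom C).comp φ) fun i ↦ Polynomial.C (X i) * Polynomial.X ^ d i
  have hΦ : (Polynomial.evalRingHom 1).comp Φ = RingHom.id _ := by
    refine MvPolynomial.ringHom_ext (fun r ↦ ?_) fun i ↦ by simp [Φ]
    have := congrArg (C (σ := ι)) (RingHom.congr_fun hφ r)
    simpa [Φ, Polynomial.eval_one_map] using this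
  have hΦL : linearRelations f ≤ ((linearRelations f).map Polynomial.C).comap Φ := by
    refine linearRelations_le_iff.mpr fun b hb ↦ ?_
    rw [Ideal.mem_comap, Ideal.mem_map_C_iff]
    intro e
    convert sum_mem_linearRelations (f := f)
      (b := fun i ↦ if d i ≤ e then (φ (b i)).coeff (e - d i) else 0) ?_ using 1
    · simp only [map_sum, map_mul, Polynomial.finsetSum_coeff]
      refine Finset.sum_congr rfl fun i _ ↦ ?_
      simp only [Φ, coe_eval₂Hom, eval₂_C, eval₂_X, RingHom.comp_apply, ← mul_assoc,
        Polynomial.coeff_mul_X_pow', Polynomial.coeff_mul_C, Polynomial.coe_mapRingHom,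
        Polynomial.coeff_map]
      split_ifs <;> simp
    · have := congrArg (Polynomial.coeff · e) (congrArg φ hb)
      simp only [map_sum, map_mul, hf, Polynomial.finsetSum_coeff, ← mul_assoc, map_zero,
        Polynomial.coeff_mul_X_pow', Polynomial.coeff_mul_C, Polynomial.coeff_zero] at this
      exact (Finset.sum_congr rfl fun i _ ↦ by split_ifs <;> simp).trans this
  let π := Polynomial.mapRingHom (Ideal.Quotient.mk (linearRelations f))
  have hπ (p : Polynomial (MvPolynomial ι R)) :
      π p = 0 ↔ p ∈ (linearRelations f).map Polynomial.C := by
    rw [Ideal.mem_map_C_iff, Polynomial.ext_iff]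
    simp [π, Ideal.Quotient.eq_zero_iff_mem]
  have hprod : π (Φ (C s)) * π (Φ F) = 0 := by
    rw [← map_mul, ← map_mul, hπ]
    exact hΦL hF
  have hunit : IsUnit (π (Φ (C s)) : PowerSeries (MvPolynomial ι R ⧸ linearRelations f)) := by
    rw [PowerSeries.isUnit_iff_constantCoeff, Polynomial.constantCoeff_coe]
    simpa [π, Φ] using (hs.map (C (σ := ι))).map (Ideal.Quotient.mk (linearRelations f))
  have hzero : π (Φ F) = 0 := by
    rw [← Polynomial.coe_eq_zero_iff, ← hunit.mul_right_eq_zero, ← Polynomial.coe_mul, hprod,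
      Polynomial.coe_zero]
  have := congrArg (Polynomial.evalRingHom 1) hzero
  rw [map_zero, ← RingHom.comp_apply] at this
  have hF1 : (Polynomial.evalRingHom 1) (Φ F) = F := RingHom.congr_fun hΦ F
  rw [← Ideal.Quotient.eq_zero_iff_mem, ← hF1]
  simpa [π, Polynomial.eval_one_map] using this

end Descent

section GradedDescent

attribute [local instance] RingHom.ker_isPrime

variable {K σ : Type*} [CommRing K]

/-- The coaction `X i ↦ z X i` defining the standard grading. -/
noncomputable def gradingCoaction : MvPolynomial σ K →+* Polynomial (MvPolynomial σ K) :=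
  eval₂Hom (Polynomial.C.comp C) fun i ↦ Polynomial.C (X i) * Polynomial.X

theorem evalRingHom_one_comp_gradingCoaction :
    (Polynomial.evalRingHom 1).comp (gradingCoaction (K := K) (σ := σ)) = RingHom.id _ :=
  MvPolynomial.ringHom_ext (fun r ↦ by simp [gradingCoaction])
    fun i ↦ by simp [gradingCoaction]

theorem coeff_zero_gradingCoaction (p : MvPolynomial σ K) :
    (gradingCoaction p).coeff 0 = C (constantCoeff p) := by
  have : Polynomial.constantCoeff.comp (gradingCoaction (K := K) (σ := σ)) =
      C.comp constantCoeff :=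
    MvPolynomial.ringHom_ext (fun r ↦ by simp [gradingCoaction])
      fun i ↦ by simp [gradingCoaction]
  exact RingHom.congr_fun this p

theorem gradingCoaction_of_isHomogeneous {d : ℕ} {p : MvPolynomial σ K} (hp : p.IsHomogeneous d) :
    gradingCoaction p = Polynomial.C p * Polynomial.X ^ d := by
  conv_rhs => rw [p.as_sum]
  rw [gradingCoaction, coe_eval₂Hom, eval₂_eq, map_sum, Finset.sum_mul]
  refine Finset.sum_congr rfl fun m hm ↦ ?_
  have : ∑ i ∈ m.support, m i = d := by
    rw [← hp.degree_eq_sum_deg_support hm]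
  rw [monomial_eq, Finsupp.prod]
  simp only [mul_pow, Finset.prod_mul_distrib, Finset.prod_pow_eq_pow_sum, this, map_mul, map_prod,
    map_pow, RingHom.comp_apply, mul_assoc]

theorem isLinearType_of_localization_ker_constantCoeff {K σ ι : Type*} [Field K] [Fintype ι]
    {f : ι → MvPolynomial σ K} {d : ι → ℕ} (hf : ∀ i, (f i).IsHomogeneous (d i))
    (h : IsLinearType fun i ↦ algebraMap _
      (Localization.AtPrime (RingHom.ker (constantCoeff (R := K) (σ := σ)))) (f i)) :
    IsLinearType f := by
  intro e F hF hFf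
  obtain ⟨s, hs, hsF⟩ := h.exists_C_mul_mem
    (RingHom.ker (constantCoeff (R := K) (σ := σ))).primeCompl _ hF hFf
  refine mem_linearRelations_of_C_mul_mem gradingCoaction evalRingHom_one_comp_gradingCoaction
    (fun i ↦ gradingCoaction_of_isHomogeneous (hf i)) ?_ hsF
  rw [coeff_zero_gradingCoaction]
  exact (isUnit_iff_ne_zero.mpr hs).map C

end GradedDescent

/-- an almost complete intersection ideal defining a reduced set of points in
`ℙ^N` is of linear type: the kernel of `R[T₁,…,T_m] → R[t]`, `Tᵢ ↦ fᵢ·t`, is generated by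
its elements of the form `b₁T₁ + ⋯ + b_mT_m` with `∑ bᵢfᵢ = 0`. -/
theorem aci_points_linear_type {K : Type*} [Field K] (N : ℕ) (hN : 1 ≤ N) (m : ℕ)
    (hm : m ≤ N + 1) (f : Fin m → MvPolynomial (Fin (N + 1)) K) (d : Fin m → ℕ)
    (hf : ∀ i, (f i).IsHomogeneous (d i))
    (I : Ideal (MvPolynomial (Fin (N + 1)) K))
    (hI : I = Ideal.span (Set.range f))
    (hbot : I ≠ ⊥) (htop : I ≠ ⊤) (hrad : I.IsRadical)
    (hdim : ringKrullDim (MvPolynomial (Fin (N + 1)) K ⧸ I) = 1) :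
    RingHom.ker
        (MvPolynomial.aeval (fun i : Fin m => Polynomial.C (f i) * Polynomial.X) :
          MvPolynomial (Fin m) (MvPolynomial (Fin (N + 1)) K) →ₐ[MvPolynomial (Fin (N + 1)) K]
            Polynomial (MvPolynomial (Fin (N + 1)) K)) =
      Ideal.span {p : MvPolynomial (Fin m) (MvPolynomial (Fin (N + 1)) K) |
        ∃ b : Fin m → MvPolynomial (Fin (N + 1)) K,
          (∑ i, b i * f i = 0) ∧ p = ∑ i, C (b i) * X i} := by
  have hlin : IsLinearType f := by
    have := RingHom.ker_isPrime (constantCoeff (R := K) (σ := Fin (N + 1)))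
    exact isLinearType_of_localization_ker_constantCoeff hf
      (isLinearType_localization hm hI hrad hdim.le _ fun i ↦ by simp [RingHom.mem_ker])
  exact hlin.ker_eq
end

section
/- For every integer r ≥ 1, the r-th ordinary power I^r of the Fermat ideal is minimally generated by binom(r+2, 2) elements; that is, the K-vector space I^r / ((x,y,z)·I^r) has dimension (r+1)(r+2)/2. -/
open MvPolynomial

/-- Polynomials whose leading exponents are linearly independent over `ℕ` are algebraically
independent. -/
theorem algebraicIndependent_of_linearIndependent_degree {K σ ι : Type*} [Field K] [Fintype ι]
    (m : MonomialOrder σ) {g : ι → MvPolynomial σ K} (hg : ∀ i, g i ≠ 0)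
    (hli : LinearIndependent ℕ (fun i ↦ m.degree (g i))) :
    AlgebraicIndependent K g := by
  classical
  rw [algebraicIndependent_iff]
  intro p hp
  by_contra hp0
  have hne (d : ι →₀ ℕ) : ∏ i, g i ^ d i ≠ 0 :=
    Finset.prod_ne_zero_iff.2 fun i _ ↦ pow_ne_zero _ (hg i)
  have hdeg (d : ι →₀ ℕ) : m.degree (∏ i, g i ^ d i) = ∑ i, d i • m.degree (g i) := by
    rw [m.degree_prod fun i _ ↦ pow_ne_zero _ (hg i)]
    simp [m.degree_pow]
  have hinj : Function.Injective fun d : ι →₀ ℕ ↦ m.degree (∏ i, g i ^ d i) := by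
    intro d e hde
    simp only [hdeg] at hde
    ext i
    exact Fintype.linearIndependent_iffₛ.1 hli _ _ hde i
  obtain ⟨d, hd, hmax⟩ := p.support.exists_max_image
    (fun d ↦ m.toSyn (m.degree (∏ i, g i ^ d i))) (support_nonempty.2 hp0)
  have hcoeff : coeff (m.degree (∏ i, g i ^ d i)) (aeval g p) =
      coeff d p * m.leadingCoeff (∏ i, g i ^ d i) := by
    rw [aeval_eq_eval₂Hom, coe_eval₂Hom, eval₂_eq', coeff_sum, Finset.sum_eq_single d]
    · rw [algebraMap_eq, coeff_C_mul, MonomialOrder.leadingCoeff]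
    · intro e he hed
      rw [algebraMap_eq, coeff_C_mul, m.coeff_eq_zero_of_lt, mul_zero]
      exact lt_of_le_of_ne (hmax e he) fun h ↦ hed (hinj (m.toSyn.injective h))
    · exact fun h ↦ absurd hd h
  rw [hp, coeff_zero, eq_comm, mul_eq_zero, m.leadingCoeff_eq_zero_iff] at hcoeff
  exact hcoeff.elim (mem_support_iff.1 hd) (hne d)

/-- The dimension of the space of forms of degree `r` is the number of multisets of `r`
variables. -/
theorem finrank_homogeneousSubmodule (K ι : Type*) [Field K] [Fintype ι] (r : ℕ) :
    Module.finrank K (homogeneousSubmodule ι K r) = (Fintype.card ι).multichoose r := by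
  classical
  rw [homogeneousSubmodule_eq_finsupp_supported,
    (AddMonoidAlgebra.supportedEquivFinsupp (R := K) (S := K)
      {d : ι →₀ ℕ | d.degree = r}).finrank_eq]
  have e : Sym ι r ≃ {d : ι →₀ ℕ | d.degree = r} :=
    (Sym.equivNatSum ι r).trans (Equiv.subtypeEquivRight fun d ↦ Iff.rfl)
  have := Fintype.ofEquiv _ e
  rw [Module.finrank_finsupp_self, ← Fintype.card_congr e, Sym.card_sym_eq_multichoose]

/-- An ideal generated by algebraically independent forms of the same degree has powers with the
largest possible number of minimal generators. -/
theorem finrank_pow_quotient_idealOfVars_mul_pow {K σ ι : Type*} [Field K] [Fintype ι]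
    {g : ι → MvPolynomial σ K} {e : ℕ} (hg : ∀ i, (g i).IsHomogeneous e)
    (hind : AlgebraicIndependent K g) (r : ℕ) :
    Module.finrank K (↥(Ideal.span (Set.range g) ^ r) ⧸
      Submodule.comap (Ideal.span (Set.range g) ^ r : Ideal (MvPolynomial σ K)).subtype
        (idealOfVars σ K * Ideal.span (Set.range g) ^ r)) =
      (Fintype.card ι).multichoose r := by
  classical
  set I := Ideal.span (Set.range g)
  have hmono (d : ι →₀ ℕ) (hd : d.degree = r) : ∏ i, g i ^ d i ∈ I ^ r := by
    rw [← hd, Finsupp.degree_eq_sum, ← Finset.prod_pow_eq_pow_sum]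
    exact Ideal.prod_mem_prod fun i _ ↦
      Ideal.pow_mem_pow (Ideal.subset_span (Set.mem_range_self i)) _
  have haeval (p : MvPolynomial ι K) (hp : p.IsHomogeneous r) : aeval g p ∈ I ^ r := by
    rw [aeval_eq_eval₂Hom, coe_eval₂Hom, eval₂_eq']
    refine Ideal.sum_mem _ fun d hd ↦ Ideal.mul_mem_left _ _ (hmono d ?_)
    rw [Finsupp.degree_eq_weight_one]
    exact hp (mem_support_iff.1 hd)
  have hI : I ≤ idealOfVars σ K ^ e := by
    rw [Ideal.span_le]
    rintro _ ⟨i, rfl⟩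
    rw [SetLike.mem_coe, mem_pow_idealOfVars_iff']
    exact fun d hd ↦ (hg i).coeff_eq_zero hd.ne
  have hmI : idealOfVars σ K * I ^ r ≤ idealOfVars σ K ^ (e * r + 1) := by
    rw [pow_succ', pow_mul]
    exact Ideal.mul_mono_right (Ideal.pow_right_mono hI r)
  let N := Submodule.comap (I ^ r).subtype (idealOfVars σ K * I ^ r)
  let φ : homogeneousSubmodule ι K r →ₗ[K] (↥(I ^ r) ⧸ N) :=
    (N.mkQ.restrictScalars K).comp
      (LinearMap.codRestrict ((I ^ r).restrictScalars K)
        ((aeval g).toLinearMap.comp (homogeneousSubmodule ι K r).subtype)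
        fun p ↦ haeval p p.2)
  have hφ : Function.Bijective φ := by
    constructor
    · rw [← LinearMap.ker_eq_bot, LinearMap.ker_eq_bot']
      intro p hp
      have hp' : aeval g (p : MvPolynomial ι K) ∈ idealOfVars σ K * I ^ r :=
        (Submodule.Quotient.mk_eq_zero N).1 hp
      have hzero : aeval g (p : MvPolynomial ι K) = 0 := by
        ext d
        by_cases hd : d.degree = e * r
        · exact (mem_pow_idealOfVars_iff' _ _).1 (hmI hp') d (by omega)
        · exact ((mem_homogeneousSubmodule _ _).1 p.2 |>.aeval g hg).coeff_eq_zero hd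
      exact Subtype.ext (algebraicIndependent_iff.1 hind _ hzero)
    · intro y
      obtain ⟨⟨y, hy⟩, rfl⟩ := N.mkQ_surjective y
      obtain ⟨p, hp, rfl⟩ := (Ideal.mem_span_pow_iff_exists_isHomogeneous g y).1 hy
      refine ⟨⟨map constantCoeff p, hp.map _⟩, ?_⟩
      refine (Submodule.Quotient.eq N).2 ?_
      change aeval g (map constantCoeff p) - eval g p ∈ idealOfVars σ K * I ^ r
      have hdiff : aeval g (map constantCoeff p) - eval g p =
          ∑ d ∈ p.support, (C (constantCoeff (coeff d p)) - coeff d p) * ∏ i, g i ^ d i := by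
        simp only [sub_mul, Finset.sum_sub_distrib]
        rw [aeval_def, eval₂_map, eval₂_eq', eval_eq']
        rfl
      rw [hdiff]
      refine Ideal.sum_mem _ fun d hd ↦ Ideal.mul_mem_mul ?_ (hmono d ?_)
      · rw [← pow_one (idealOfVars σ K), mem_pow_idealOfVars_iff']
        intro x hx
        obtain rfl : x = 0 := (Finsupp.degree_eq_zero_iff x).1 (by omega)
        simp [constantCoeff_eq]
      · rw [Finsupp.degree_eq_weight_one]
        exact hp (mem_support_iff.1 hd)
  rw [← finrank_homogeneousSubmodule K ι r]
  exact (LinearEquiv.ofBijective φ hφ).finrank_eq.symm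

theorem degree_monomial_sub_monomial {K σ : Type*} [Field K] (m : MonomialOrder σ)
    {a b : σ →₀ ℕ} (h : m.toSyn b < m.toSyn a) :
    m.degree (monomial a (1 : K) - monomial b 1) = a := by
  classical
  have ha : m.degree (monomial a (1 : K)) = a := by simp [m.degree_monomial]
  rw [sub_eq_add_neg, ← map_neg, m.degree_add_of_lt] <;> simp [m.degree_monomial, h]

/-- The generators of the Fermat ideal are algebraically independent. -/
theorem algebraicIndependent_fermat (K : Type*) [Field K] {n : ℕ} (hn : 2 ≤ n) :
    AlgebraicIndependent K ![(X 0 : MvPolynomial (Fin 3) K) * (X 1 ^ n - X 2 ^ n),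
      X 1 * (X 2 ^ n - X 0 ^ n), X 2 * (X 0 ^ n - X 1 ^ n)] := by
  let m : MonomialOrder (Fin 3) := MonomialOrder.lex
  have hmon (i j : Fin 3) : (X i : MvPolynomial (Fin 3) K) * X j ^ n =
      monomial (Finsupp.single i 1 + Finsupp.single j n) 1 := by
    rw [X_pow_eq_monomial, X, monomial_mul, one_mul]
  have h0 : m.degree ((X 0 : MvPolynomial (Fin 3) K) * (X 1 ^ n - X 2 ^ n)) =
      Finsupp.single 0 1 + Finsupp.single 1 n := by
    rw [mul_sub, hmon, hmon]
    refine degree_monomial_sub_monomial m (MonomialOrder.lex_lt_iff.2 ?_)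
    exact Finsupp.Lex.lt_iff.2 ⟨1, by simp +decide, by simp; omega⟩
  have h1 : m.degree ((X 1 : MvPolynomial (Fin 3) K) * (X 2 ^ n - X 0 ^ n)) =
      Finsupp.single 1 1 + Finsupp.single 0 n := by
    rw [← m.degree_neg, ← mul_neg, neg_sub, mul_sub, hmon, hmon]
    refine degree_monomial_sub_monomial m (MonomialOrder.lex_lt_iff.2 ?_)
    exact Finsupp.Lex.lt_iff.2 ⟨0, by simp +decide, by simp; omega⟩
  have h2 : m.degree ((X 2 : MvPolynomial (Fin 3) K) * (X 0 ^ n - X 1 ^ n)) =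
      Finsupp.single 2 1 + Finsupp.single 0 n := by
    rw [mul_sub, hmon, hmon]
    refine degree_monomial_sub_monomial m (MonomialOrder.lex_lt_iff.2 ?_)
    exact Finsupp.Lex.lt_iff.2 ⟨0, by simp +decide, by simp; omega⟩
  refine algebraicIndependent_of_linearIndependent_degree m ?_ ?_
  · intro i
    apply m.ne_zero_of_degree_ne_zero
    fin_cases i
    · exact h0 ▸ fun h ↦ by simpa using DFunLike.congr_fun h 0
    · exact h1 ▸ fun h ↦ by simpa using DFunLike.congr_fun h 1
    · exact h2 ▸ fun h ↦ by simpa using DFunLike.congr_fun h 2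
  · rw [Fintype.linearIndependent_iffₛ]
    intro a b hab
    simp only [Fin.sum_univ_three, Matrix.cons_val, h0, h1, h2] at hab
    have e0 : a 0 + (a 1 + a 2) * n = b 0 + (b 1 + b 2) * n := by
      simpa [add_mul, add_assoc] using DFunLike.congr_fun hab 0
    have e1 : a 0 * n + a 1 = b 0 * n + b 1 := by simpa using DFunLike.congr_fun hab 1
    have e2 : a 2 = b 2 := by simpa using DFunLike.congr_fun hab 2
    have e01 : a 0 = b 0 := by
      zify at *
      have : ((a 0 : ℤ) - b 0) * (n ^ 2 - 1) = 0 := by linear_combination n * e1 - e0 + n * e2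
      rcases mul_eq_zero.1 this with h | h
      · linarith
      · nlinarith
    have e11 : a 1 = b 1 := by rw [e01] at e1; omega
    intro i
    fin_cases i <;> assumption

open MvPolynomial

/-- for every `r ≥ 1`, the `r`-th power of the Fermat ideal is minimally
generated by `binom(r+2,2)` elements: `dim_K Iʳ/((x,y,z)·Iʳ) = (r+1)(r+2)/2`. -/
theorem fermat_power_min_gens {K : Type*} [Field K] (n : ℕ) (hn : 2 ≤ n)
    (hζ : ∃ ζ : K, IsPrimitiveRoot ζ n) (hinv : IsUnit (n : K)) (r : ℕ) (hr : 1 ≤ r) :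
    Module.finrank K
      (↥((Ideal.span {(X 0 : MvPolynomial (Fin 3) K) * (X 1 ^ n - X 2 ^ n),
            X 1 * (X 2 ^ n - X 0 ^ n), X 2 * (X 0 ^ n - X 1 ^ n)}) ^ r) ⧸
        (Submodule.comap
          ((Ideal.span {(X 0 : MvPolynomial (Fin 3) K) * (X 1 ^ n - X 2 ^ n),
            X 1 * (X 2 ^ n - X 0 ^ n), X 2 * (X 0 ^ n - X 1 ^ n)} ^ r) : Ideal (MvPolynomial (Fin 3) K)).subtype
          (Ideal.span {(X 0 : MvPolynomial (Fin 3) K), X 1, X 2} *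
            Ideal.span {(X 0 : MvPolynomial (Fin 3) K) * (X 1 ^ n - X 2 ^ n),
              X 1 * (X 2 ^ n - X 0 ^ n), X 2 * (X 0 ^ n - X 1 ^ n)} ^ r))) =
      (r + 1) * (r + 2) / 2 := by
  have hspan : Ideal.span {(X 0 : MvPolynomial (Fin 3) K) * (X 1 ^ n - X 2 ^ n),
      X 1 * (X 2 ^ n - X 0 ^ n), X 2 * (X 0 ^ n - X 1 ^ n)} =
      Ideal.span (Set.range ![(X 0 : MvPolynomial (Fin 3) K) * (X 1 ^ n - X 2 ^ n),
        X 1 * (X 2 ^ n - X 0 ^ n), X 2 * (X 0 ^ n - X 1 ^ n)]) := by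
    congr 1
    ext p
    simp [or_comm, or_left_comm]
  have hvars : Ideal.span {(X 0 : MvPolynomial (Fin 3) K), X 1, X 2} = idealOfVars (Fin 3) K := by
    rw [idealOfVars]
    congr 1
    ext p
    simp [Fin.exists_fin_succ, @eq_comm _ p]
  have hhom (i : Fin 3) : (![(X 0 : MvPolynomial (Fin 3) K) * (X 1 ^ n - X 2 ^ n),
      X 1 * (X 2 ^ n - X 0 ^ n), X 2 * (X 0 ^ n - X 1 ^ n)] i).IsHomogeneous (1 + n) := by
    fin_cases i <;>
      exact (isHomogeneous_X K _).mul ((isHomogeneous_X_pow _ _).sub (isHomogeneous_X_pow _ _))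
  rw [hspan, hvars, finrank_pow_quotient_idealOfVars_mul_pow hhom (algebraicIndependent_fermat K hn),
    Fintype.card_fin, Nat.multichoose_eq, Nat.choose_symm_of_eq_add (b := 2) (by omega),
    Nat.choose_two_right, mul_comm, show 3 + r - 1 = r + 2 by omega,
    show r + 2 - 1 = r + 1 by omega]
end

section
/- Let n > 0, t > 0 be integers and set f = y^n − z^n, g = z^n − x^n, h = x^n − y^n in R = K[x,y,z]. For each 0 ≤ j ≤ t, the determinant of the (t+1)×(t+1) matrix whose first t columns form H(f,g)_t and whose last column has its top t−j entries equal to 0 and its bottom j+1 entries equal to the binomial coefficients binom(j,0), binom(j,1), …, binom(j,j) (from top to bottom) equals (−1)^{t−j} · g^{t−j} · h^{j}. -/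
open MvPolynomial

/-- The determinant of `H(a,b)_t` completed by the column `v`. -/
theorem det_H_append_column {R : Type*} [CommRing R] (a b : R) (t : ℕ) (v : ℕ → R) :
    Matrix.det (Matrix.of fun i c : Fin (t + 1) =>
      if (c : ℕ) < t then
        (if (i : ℕ) = (c : ℕ) then -b else if (i : ℕ) = (c : ℕ) + 1 then a else 0)
      else v i) =
      (-1) ^ t * ∑ i ∈ Finset.range (t + 1), v i * b ^ i * a ^ (t - i) := by
  induction t generalizing v with
  | zero => simp
  | succ t ih =>
    have hlast : Matrix.det ((Matrix.of fun i c : Fin (t + 1 + 1) =>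
        if (c : ℕ) < t + 1 then
          (if (i : ℕ) = (c : ℕ) then -b else if (i : ℕ) = (c : ℕ) + 1 then a else 0)
        else v i).submatrix Fin.succ (Fin.last (t + 1)).succAbove) = a ^ (t + 1) := by
      rw [Matrix.det_of_isUpperTriangular]
      · simp [Fin.is_le]
      · intro i c hic
        have hic' : (c : ℕ) < i := hic
        have h₁ : (i : ℕ) + 1 ≠ c := by omega
        have h₂ : (i : ℕ) ≠ c := by omega
        simp [h₁, h₂, Nat.not_lt.mpr c.is_le]
    have hfirst : Matrix.det ((Matrix.of fun i c : Fin (t + 1 + 1) =>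
        if (c : ℕ) < t + 1 then
          (if (i : ℕ) = (c : ℕ) then -b else if (i : ℕ) = (c : ℕ) + 1 then a else 0)
        else v i).submatrix Fin.succ (Fin.succAbove 0)) =
        (-1) ^ t * ∑ i ∈ Finset.range (t + 1), v (i + 1) * b ^ i * a ^ (t - i) := by
      rw [← ih fun i => v (i + 1)]
      congr 1
      ext i c
      simp
    rw [Matrix.det_succ_row_zero, Fin.sum_univ_succ, Fin.sum_univ_castSucc, Finset.sum_eq_zero,
      Fin.succ_last, hlast, hfirst, Finset.sum_range_succ' _ (t + 1)]
    · have hsum : ∑ i ∈ Finset.range (t + 1), v (i + 1) * b ^ (i + 1) * a ^ (t + 1 - (i + 1)) =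
          b * ∑ i ∈ Finset.range (t + 1), v (i + 1) * b ^ i * a ^ (t - i) := by
        rw [Finset.mul_sum]
        refine Finset.sum_congr rfl fun i _ => ?_
        rw [Nat.add_sub_add_right]
        ring
      rw [hsum]
      simp
      ring
    · intro c _
      simp

/-- with `f = yⁿ−zⁿ`, `g = zⁿ−xⁿ`, `h = xⁿ−yⁿ` in `K[x,y,z]`, for
`0 ≤ j ≤ t` the determinant of the `(t+1)×(t+1)` matrix whose first `t` columns form
`H(f,g)_t` and whose last column has top `t−j` entries `0` and bottom `j+1` entries the
binomial coefficients `binom(j,0), …, binom(j,j)` equals `(−1)^{t−j} g^{t−j} h^{j}`. -/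
theorem det_H_bottom_binomial_column {K : Type*} [Field K] (n t : ℕ) (hn : 0 < n)
    (ht : 0 < t) (j : ℕ) (hj : j ≤ t) :
    Matrix.det (Matrix.of fun i c : Fin (t + 1) =>
      if (c : ℕ) < t then
        (if (i : ℕ) = (c : ℕ) then -((X 2 : MvPolynomial (Fin 3) K) ^ n - X 0 ^ n)
         else if (i : ℕ) = (c : ℕ) + 1 then (X 1 : MvPolynomial (Fin 3) K) ^ n - X 2 ^ n
         else 0)
      else (if t - j ≤ (i : ℕ) then ((j.choose ((i : ℕ) - (t - j)) : MvPolynomial (Fin 3) K))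
            else 0)) =
      (-1 : MvPolynomial (Fin 3) K) ^ (t - j) *
        ((X 2 : MvPolynomial (Fin 3) K) ^ n - X 0 ^ n) ^ (t - j) *
        ((X 0 : MvPolynomial (Fin 3) K) ^ n - X 1 ^ n) ^ j := by
  rw [det_H_append_column _ _ t fun i =>
    if t - j ≤ i then ((j.choose (i - (t - j)) : MvPolynomial (Fin 3) K)) else 0]
  obtain ⟨k, rfl⟩ := Nat.exists_eq_add_of_le' hj
  have hh : (X 0 : MvPolynomial (Fin 3) K) ^ n - X 1 ^ n =
      -((X 2 ^ n - X 0 ^ n) + (X 1 ^ n - X 2 ^ n)) := by ring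
  rw [hh, neg_pow (_ + _) j, add_pow, Nat.add_sub_cancel, add_assoc k j 1,
    Finset.sum_range_add, Finset.sum_eq_zero, zero_add, pow_add, Finset.mul_sum, Finset.mul_sum,
    Finset.mul_sum]
  · refine Finset.sum_congr rfl fun i _ => ?_
    rw [if_pos (Nat.le_add_right k i), Nat.add_sub_cancel_left, Nat.add_sub_add_left, pow_add]
    ring
  · intro i hi
    rw [if_neg (Nat.not_le.mpr (Finset.mem_range.mp hi)), zero_mul, zero_mul]
end

section
/- Let n > 0, t > 0 be integers and set f = y^n − z^n, g = z^n − x^n, h = x^n − y^n in R = K[x,y,z]. For each 0 ≤ j ≤ t, the determinant of the (t+1)×(t+1) matrix whose first t columns form H(f,g)_t and whose last column has its top j+1 entries equal to the binomial coefficients binom(j,0), binom(j,1), …, binom(j,j) (from top to bottom) and its remaining bottom t−j entries equal to 0 equals (−1)^{t−j} · f^{t−j} · h^{j}. -/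
open MvPolynomial

/-- Expansion along the last column of the determinant of `H(a,b)_t` bordered by a column `v`. -/
theorem det_H_border {R : Type*} [CommRing R] (a b : R) (t : ℕ) (v : ℕ → R) :
    Matrix.det (Matrix.of fun i c : Fin (t + 1) =>
      if (c : ℕ) < t then
        (if (i : ℕ) = (c : ℕ) then -b else if (i : ℕ) = (c : ℕ) + 1 then a else 0)
      else v i) =
      (-1) ^ t * ∑ i ∈ Finset.range (t + 1), b ^ i * a ^ (t - i) * v i := by
  induction t generalizing v with
  | zero => simp
  | succ t ih =>
    rw [Matrix.det_succ_row_zero, Fin.sum_univ_succ, Fin.sum_univ_castSucc,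
      Finset.sum_eq_zero (fun c _ => by simp), Finset.sum_range_succ']
    have first : Matrix.submatrix (Matrix.of fun i c : Fin (t + 1 + 1) =>
        if (c : ℕ) < t + 1 then
          (if (i : ℕ) = (c : ℕ) then -b else if (i : ℕ) = (c : ℕ) + 1 then a else 0)
        else v i) Fin.succ (Fin.succAbove 0) = Matrix.of fun i c : Fin (t + 1) =>
        if (c : ℕ) < t then
          (if (i : ℕ) = (c : ℕ) then -b else if (i : ℕ) = (c : ℕ) + 1 then a else 0)
        else v (i + 1) := by
      ext i c
      simp
    have last : (Matrix.submatrix (Matrix.of fun i c : Fin (t + 1 + 1) =>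
        if (c : ℕ) < t + 1 then
          (if (i : ℕ) = (c : ℕ) then -b else if (i : ℕ) = (c : ℕ) + 1 then a else 0)
        else v i) Fin.succ (Fin.succAbove (Fin.last t).succ)).det = a ^ (t + 1) := by
      rw [Matrix.det_of_isUpperTriangular]
      · simp [Nat.lt_succ_iff.mp (Fin.is_lt _)]
      · intro i c hic
        have hlt : (c : ℕ) < i := hic
        simp [show (i : ℕ) + 1 ≠ c by omega, hlt.ne', show ¬ t < (c : ℕ) by omega]
    rw [first, ih fun i => v (i + 1), last]
    have shift : ∑ k ∈ Finset.range (t + 1), b ^ (k + 1) * a ^ (t + 1 - (k + 1)) * v (k + 1) =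
        b * ∑ k ∈ Finset.range (t + 1), b ^ k * a ^ (t - k) * v (k + 1) := by
      rw [Finset.mul_sum]
      refine Finset.sum_congr rfl fun k _ => ?_
      rw [Nat.add_sub_add_right]
      ring
    rw [shift]
    simp
    ring

/-- Homogenized binomial theorem. -/
theorem sum_range_pow_mul_choose {R : Type*} [CommSemiring R] (a b : R) {j t : ℕ} (hj : j ≤ t) :
    ∑ i ∈ Finset.range (t + 1), b ^ i * a ^ (t - i) * (j.choose i : R) =
      a ^ (t - j) * (b + a) ^ j := by
  rw [add_pow, Finset.mul_sum]
  symm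
  refine Finset.sum_subset_zero_on_sdiff (Finset.range_mono (by omega)) ?_ ?_
  · intro i hi
    have hi' : j < i := by simpa using (Finset.mem_sdiff.mp hi).2
    simp [Nat.choose_eq_zero_of_lt hi']
  · intro i hi
    have hi' : i ≤ j := Nat.lt_succ_iff.mp (Finset.mem_range.mp hi)
    rw [show t - i = (t - j) + (j - i) by omega, pow_add]
    ring

/-- with `f = yⁿ−zⁿ`, `g = zⁿ−xⁿ`, `h = xⁿ−yⁿ` in `K[x,y,z]`, for
`0 ≤ j ≤ t` the determinant of the `(t+1)×(t+1)` matrix whose first `t` columns form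
`H(f,g)_t` and whose last column has top `j+1` entries the binomial coefficients
`binom(j,0), …, binom(j,j)` and remaining entries `0` equals `(−1)^{t−j} f^{t−j} h^{j}`. -/
theorem det_H_top_binomial_column {K : Type*} [Field K] (n t : ℕ) (hn : 0 < n)
    (ht : 0 < t) (j : ℕ) (hj : j ≤ t) :
    Matrix.det (Matrix.of fun i c : Fin (t + 1) =>
      if (c : ℕ) < t then
        (if (i : ℕ) = (c : ℕ) then -((X 2 : MvPolynomial (Fin 3) K) ^ n - X 0 ^ n)
         else if (i : ℕ) = (c : ℕ) + 1 then (X 1 : MvPolynomial (Fin 3) K) ^ n - X 2 ^ n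
         else 0)
      else (if (i : ℕ) ≤ j then ((j.choose (i : ℕ) : MvPolynomial (Fin 3) K)) else 0)) =
      (-1 : MvPolynomial (Fin 3) K) ^ (t - j) *
        ((X 1 : MvPolynomial (Fin 3) K) ^ n - X 2 ^ n) ^ (t - j) *
        ((X 0 : MvPolynomial (Fin 3) K) ^ n - X 1 ^ n) ^ j := by
  have choose_eq (i : ℕ) : (if i ≤ j then (j.choose i : MvPolynomial (Fin 3) K) else 0) =
      j.choose i := by
    split_ifs with hi
    · rfl
    · rw [Nat.choose_eq_zero_of_lt (by omega), Nat.cast_zero]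
  simp only [choose_eq]
  rw [det_H_border _ _ t fun i => (j.choose i : MvPolynomial (Fin 3) K),
    sum_range_pow_mul_choose _ _ hj]
  obtain ⟨k, rfl⟩ := Nat.exists_eq_add_of_le hj
  rw [show (X 2 : MvPolynomial (Fin 3) K) ^ n - X 0 ^ n + (X 1 ^ n - X 2 ^ n) =
    (-1) * (X 0 ^ n - X 1 ^ n) by ring, mul_pow, Nat.add_sub_cancel_left, pow_add]
  have neg_one_sq : (-1 : MvPolynomial (Fin 3) K) ^ j * (-1) ^ j = 1 := by
    rw [← mul_pow]; simp
  linear_combination ((-1 : MvPolynomial (Fin 3) K) ^ k * (X 1 ^ n - X 2 ^ n) ^ k *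
    (X 0 ^ n - X 1 ^ n) ^ j) * neg_one_sq
end

section
/- For all integers n ≥ 3 and k ≥ 1, the following equality of ideals of R = K[x,y,z] holds: (f, g)^{k(n−3)+3} ∩ (x, y)^n ∩ (y, z)^n ∩ (x, z)^n = (fgh)·(f, g)^{k(n−3)} + f^{(k−1)(n−3)+2} g^{n−2} x · (x, y)^{n−1} + g^{(k−1)(n−3)+2} h^{n−2} y · (y, z)^{n−1} + f^{n−2} h^{(k−1)(n−3)+2} z · (z, x)^{n−1}, where a product of elements with an ideal denotes the ideal of all such multiples and + denotes the sum of ideals. -/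
open MvPolynomial

noncomputable section

/-- `f = yⁿ − zⁿ` in `K[x,y,z]` (variables `x = X 0`, `y = X 1`, `z = X 2`). -/
def pf (K : Type*) [Field K] (n : ℕ) : MvPolynomial (Fin 3) K := X 1 ^ n - X 2 ^ n

/-- `g = zⁿ − xⁿ`. -/
def pg (K : Type*) [Field K] (n : ℕ) : MvPolynomial (Fin 3) K := X 2 ^ n - X 0 ^ n

/-- `h = xⁿ − yⁿ`. -/
def ph (K : Type*) [Field K] (n : ℕ) : MvPolynomial (Fin 3) K := X 0 ^ n - X 1 ^ n

/-- The ideal `(f, g)`. -/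
def Ifg (K : Type*) [Field K] (n : ℕ) : Ideal (MvPolynomial (Fin 3) K) :=
  Ideal.span {pf K n, pg K n}

/-- The ideal `(x, y)`. -/
def Ixy (K : Type*) [Field K] : Ideal (MvPolynomial (Fin 3) K) := Ideal.span {X 0, X 1}

/-- The ideal `(y, z)`. -/
def Iyz (K : Type*) [Field K] : Ideal (MvPolynomial (Fin 3) K) := Ideal.span {X 1, X 2}

/-- The ideal `(z, x)`. -/
def Izx (K : Type*) [Field K] : Ideal (MvPolynomial (Fin 3) K) := Ideal.span {X 2, X 0}

/-- The `m`-th symbolic power of the Fermat ideal `I = (xf, yg, zh)`: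
`I^{(m)} = (f,g)^m ∩ (x,y)^m ∩ (y,z)^m ∩ (z,x)^m`. -/
def symbPow (K : Type*) [Field K] (n m : ℕ) : Ideal (MvPolynomial (Fin 3) K) :=
  Ifg K n ^ m ⊓ Ixy K ^ m ⊓ Iyz K ^ m ⊓ Izx K ^ m

section IdealLemmas

variable {R : Type*} [CommRing R]

theorem pow_add_le_mul_sup {J U V W : Ideal R} (hU : J ≤ U ⊔ W) (hV : J ≤ V ⊔ W)
    (hUJ : U ≤ J) (hVJ : V ≤ J) (a b : ℕ) :
    J ^ (a + b) ≤ U ^ a * V ^ b ⊔ W * J ^ (a + b - 1) := by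
  have step : ∀ (r : ℕ) (P Q : Ideal R), P ≤ J ^ r → J ≤ Q ⊔ W →
      J ^ r ≤ P ⊔ W * J ^ (r - 1) → J ^ (r + 1) ≤ P * Q ⊔ W * J ^ r := by
    intro r P Q hP hQ h
    have h₁ : J ^ (r - 1) * J ≤ J ^ r := by
      rw [← pow_succ]
      exact Ideal.pow_le_pow_right (by omega)
    calc J ^ (r + 1) = J ^ r * J := pow_succ _ _
      _ ≤ (P ⊔ W * J ^ (r - 1)) * J := Ideal.mul_mono_left h
      _ = P * J ⊔ W * (J ^ (r - 1) * J) := by rw [Ideal.sup_mul, mul_assoc]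
      _ ≤ P * (Q ⊔ W) ⊔ W * J ^ r := sup_le_sup (Ideal.mul_mono_right hQ) (Ideal.mul_mono_right h₁)
      _ ≤ P * Q ⊔ W * J ^ r := by
        rw [Ideal.mul_sup]
        refine sup_le (sup_le le_sup_left (le_sup_of_le_right ?_)) le_sup_right
        rw [mul_comm]
        exact Ideal.mul_mono_right hP
  induction b with
  | zero =>
    induction a with
    | zero => simp
    | succ a ih =>
      have := step a (U ^ a) U (Ideal.pow_right_mono hUJ a) hU (by simpa using ih)
      simpa [pow_succ] using this
  | succ b ih =>
    have hP : U ^ a * V ^ b ≤ J ^ (a + b) := by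
      rw [pow_add]
      exact Ideal.mul_mono (Ideal.pow_right_mono hUJ a) (Ideal.pow_right_mono hVJ b)
    have := step (a + b) (U ^ a * V ^ b) V hP hV ih
    simpa [pow_succ, mul_assoc, ← add_assoc] using this

/-- Here `J` is generated by any two of the three ideals `U`, `V`, `W`. -/
theorem pow_add_two_le_sup {J U V W : Ideal R} (hUV : J = U ⊔ V) (hVW : J = V ⊔ W)
    (hUW : J = U ⊔ W) (a b : ℕ) :
    J ^ (a + b + 2) ≤ U * V * W * J ^ (a + b - 1) ⊔ U ^ (a + 1) * V ^ (b + 1) ⊔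
      V ^ (a + 1) * W ^ (b + 1) ⊔ U ^ (b + 1) * W ^ (a + 1) := by
  have hU : U ≤ J := hUV ▸ le_sup_left
  have hV : V ≤ J := hUV ▸ le_sup_right
  have hW : W ≤ J := hVW ▸ le_sup_right
  have h₂ : J * J ≤ U * V ⊔ V * W ⊔ U * W := by
    conv_lhs => rw [hUV, Ideal.sup_mul, ← hUV]
    refine sup_le ?_ ?_
    · rw [hVW, Ideal.mul_sup]
      exact sup_le (le_sup_of_le_left le_sup_left) le_sup_right
    · rw [hUW, Ideal.mul_sup, mul_comm V U]
      exact sup_le (le_sup_of_le_left le_sup_left) (le_sup_of_le_left le_sup_right)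
  have h₃ := pow_add_le_mul_sup hUW.le hVW.le hU hV a b
  have h₄ := pow_add_le_mul_sup (W := U) (by rw [hUV, sup_comm]) (by rw [hUW, sup_comm]) hV hW a b
  have h₅ := pow_add_le_mul_sup (W := V) hUV.le (by rw [hVW, sup_comm]) hU hW b a
  rw [add_comm b a] at h₅
  calc J ^ (a + b + 2) = J * J * J ^ (a + b) := by ring
    _ ≤ (U * V ⊔ V * W ⊔ U * W) * J ^ (a + b) := Ideal.mul_mono_left h₂
    _ = U * V * J ^ (a + b) ⊔ V * W * J ^ (a + b) ⊔ U * W * J ^ (a + b) := by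
      rw [Ideal.sup_mul, Ideal.sup_mul]
    _ ≤ U * V * (U ^ a * V ^ b ⊔ W * J ^ (a + b - 1)) ⊔
        V * W * (V ^ a * W ^ b ⊔ U * J ^ (a + b - 1)) ⊔
        U * W * (U ^ b * W ^ a ⊔ V * J ^ (a + b - 1)) :=
      sup_le_sup (sup_le_sup (Ideal.mul_mono_right h₃) (Ideal.mul_mono_right h₄))
        (Ideal.mul_mono_right h₅)
    _ = _ := by
      simp only [← Submodule.add_eq_sup, mul_add]
      generalize J ^ (a + b - 1) = Q
      have h : ∀ P : Ideal R, P + P = P := fun P => by simp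
      calc _ = U * V * W * Q + U * V * W * Q + U * V * W * Q + U ^ (a + 1) * V ^ (b + 1) +
            V ^ (a + 1) * W ^ (b + 1) + U ^ (b + 1) * W ^ (a + 1) := by ring
        _ = _ := by rw [h, h]

theorem mul_mem_span_mul_pow_sup {n : ℕ} {x y c A : R} (hn : n ≠ 0)
    (hA : A ∈ Ideal.span {x, y} ^ n) :
    A * c ∈ Ideal.span {c * x} * Ideal.span {x, y} ^ (n - 1) ⊔
      Ideal.span {c * (x ^ n - y ^ n)} := by
  obtain ⟨n, rfl⟩ := Nat.exists_eq_succ_of_ne_zero hn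
  have hle : Ideal.span {x, y} ≤ Ideal.span {y} ⊔ Ideal.span {x} := by
    rw [Ideal.span_insert, sup_comm]
  have hyI : Ideal.span {y} ≤ Ideal.span {x, y} := Ideal.span_mono (by simp)
  have h := pow_add_le_mul_sup hle hle hyI hyI (n + 1) 0 hA
  rw [pow_zero, mul_one, Ideal.span_singleton_pow, add_zero, Submodule.mem_sup] at h
  obtain ⟨s, hs, t, ht, rfl⟩ := h
  obtain ⟨s, rfl⟩ := Ideal.mem_span_singleton'.1 hs
  obtain ⟨r, hr, rfl⟩ := Ideal.mem_span_singleton_mul.1 ht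
  have hx : x ^ n ∈ Ideal.span {x, y} ^ n := Ideal.pow_mem_pow (Ideal.subset_span (by simp)) n
  refine Submodule.mem_sup.2 ⟨c * x * (r + s * x ^ n), Ideal.mul_mem_mul
    (Ideal.mem_span_singleton_self _) (add_mem hr (Ideal.mul_mem_left _ _ hx)),
    -s * (c * (x ^ (n + 1) - y ^ (n + 1))),
    Ideal.mul_mem_left _ _ (Ideal.mem_span_singleton_self _), by ring⟩

theorem pow_sub_pow_mem_span_pair_pow (n : ℕ) (x y : R) :
    x ^ n - y ^ n ∈ Ideal.span {x, y} ^ n :=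
  sub_mem (Ideal.pow_mem_pow (Ideal.subset_span (by simp)) n)
    (Ideal.pow_mem_pow (Ideal.subset_span (by simp)) n)

end IdealLemmas

section Monomials

variable {σ K : Type*} [Field K]

theorem mem_span_X_pair_pow_iff {i j : σ} (hij : i ≠ j) (N : ℕ) (p : MvPolynomial σ K) :
    p ∈ Ideal.span {(X i : MvPolynomial σ K), X j} ^ N ↔ ∀ m ∈ p.support, N ≤ m i + m j := by
  classical
  constructor
  · intro hp
    induction N generalizing p with
    | zero => simp
    | succ N ih =>
      rw [pow_succ] at hp
      refine Submodule.mul_induction_on hp ?_ ?_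
      · intro r hr s hs m hm
        obtain ⟨a, b, rfl⟩ := Ideal.mem_span_pair.1 hs
        rw [mul_add, ← mul_assoc, ← mul_assoc] at hm
        rcases Finset.mem_union.1 (support_add hm) with h | h <;>
        · rw [support_mul_X, Finset.mem_map] at h
          obtain ⟨m', hm', rfl⟩ := h
          have := ih _ (Ideal.mul_mem_right _ _ hr) m' hm'
          simp [hij, hij.symm]
          omega
      · intro r s hr hs m hm
        rcases Finset.mem_union.1 (support_add hm) with h | h
        exacts [hr m h, hs m h]
  · intro h
    rw [p.as_sum]
    refine Ideal.sum_mem _ fun m hm => ?_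
    have hd : (X i ^ m i * X j ^ m j : MvPolynomial σ K) ∣ monomial m (p.coeff m) := by
      rw [X_pow_eq_monomial, X_pow_eq_monomial, monomial_mul, monomial_dvd_monomial]
      refine ⟨Or.inr fun k => ?_, by simp⟩
      by_cases hi : i = k
      · subst hi; simp [hij.symm]
      · by_cases hj : j = k
        · subst hj; simp [hij]
        · simp [hi, hj]
    refine Ideal.mem_of_dvd _ hd (Ideal.pow_le_pow_right (h m hm) ?_)
    rw [pow_add]
    exact Ideal.mul_mem_mul (Ideal.pow_mem_pow (Ideal.subset_span (by simp)) _)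
      (Ideal.pow_mem_pow (Ideal.subset_span (by simp)) _)

theorem mem_span_X_pair_pow_of_mul_X_pow_mem {i j l : σ} (hij : i ≠ j) (hil : i ≠ l) (hjl : j ≠ l)
    {N M : ℕ} {A : MvPolynomial σ K} (h : A * X l ^ M ∈ Ideal.span {X i, X j} ^ N) :
    A ∈ Ideal.span {X i, X j} ^ N := by
  classical
  rw [mem_span_X_pair_pow_iff hij] at h ⊢
  intro m hm
  have := h (m + Finsupp.single l M) (by
    rw [mem_support_iff, X_pow_eq_monomial, coeff_mul_monomial, mul_one]
    exact mem_support_iff.1 hm)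
  simpa [Finsupp.single_apply, hil.symm, hjl.symm] using this

theorem mem_span_X_pair_pow_of_mul_mem {i j l : σ} (hij : i ≠ j) (hil : i ≠ l) (hjl : j ≠ l)
    {N M : ℕ} {A F : MvPolynomial σ K} (hF : F ^ 2 - X l ^ M ∈ Ideal.span {X i, X j})
    (h : A * F ∈ Ideal.span {X i, X j} ^ N) : A ∈ Ideal.span {X i, X j} ^ N := by
  refine mem_span_X_pair_pow_of_mul_X_pow_mem hij hil hjl (M := M * N) ?_
  obtain ⟨s, hs⟩ := sub_dvd_pow_sub_pow (X l ^ M : MvPolynomial σ K) (X l ^ M - F ^ 2) N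
  have hA : A * X l ^ (M * N) = A * (X l ^ M - F ^ 2) ^ N + A * F * (F * s) := by
    rw [pow_mul]
    linear_combination A * hs
  rw [hA]
  refine add_mem (Ideal.mul_mem_left _ _ (Ideal.pow_mem_pow ?_ N)) (Ideal.mul_mem_right _ _ h)
  rw [← neg_sub]
  exact neg_mem hF

theorem zero_sub_pow_mul_pow_sq {R : Type*} [CommRing R] (w : R) (n p q : ℕ) :
    ((0 - w ^ n) ^ p * (w ^ n - 0) ^ q) ^ 2 = w ^ (n * (p + q) * 2) := by
  rw [zero_sub, sub_zero, mul_pow, ← pow_mul, mul_comm p, pow_mul, neg_sq]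
  ring

theorem mem_span_X_pair_pow_of_mul_sub_pow_mem {i j l : σ} (hij : i ≠ j) (hil : i ≠ l)
    (hjl : j ≠ l) {n N p q : ℕ} (hn : n ≠ 0) {A : MvPolynomial σ K}
    (h : A * ((X j ^ n - X l ^ n) ^ p * (X l ^ n - X i ^ n) ^ q) ∈ Ideal.span {X i, X j} ^ N) :
    A ∈ Ideal.span {X i, X j} ^ N := by
  refine mem_span_X_pair_pow_of_mul_mem hij hil hjl (M := n * (p + q) * 2) ?_ h
  have hi : Ideal.Quotient.mk (Ideal.span {(X i : MvPolynomial σ K), X j}) (X i) = 0 :=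
    Ideal.Quotient.eq_zero_iff_mem.2 (Ideal.subset_span (by simp))
  have hj : Ideal.Quotient.mk (Ideal.span {(X i : MvPolynomial σ K), X j}) (X j) = 0 :=
    Ideal.Quotient.eq_zero_iff_mem.2 (Ideal.subset_span (by simp))
  rw [← Ideal.Quotient.eq]
  simp only [map_pow, map_mul, map_sub, hi, hj, zero_pow hn]
  exact zero_sub_pow_mul_pow_sq _ n p q

end Monomials

theorem Ifg_eq_sup (K : Type*) [Field K] (n : ℕ) :
    Ifg K n = Ideal.span {pf K n} ⊔ Ideal.span {pg K n} := Ideal.span_insert _ _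

theorem pf_mem (K : Type*) [Field K] (n : ℕ) : pf K n ∈ Ifg K n :=
  Ideal.subset_span (by simp)

theorem pg_mem (K : Type*) [Field K] (n : ℕ) : pg K n ∈ Ifg K n :=
  Ideal.subset_span (by simp)

theorem ph_eq (K : Type*) [Field K] (n : ℕ) : ph K n = -pf K n - pg K n := by
  unfold ph pf pg; ring

theorem ph_mem (K : Type*) [Field K] (n : ℕ) : ph K n ∈ Ifg K n := by
  rw [ph_eq]
  exact sub_mem (neg_mem (pf_mem K n)) (pg_mem K n)

theorem Ifg_eq_sup_pg_ph (K : Type*) [Field K] (n : ℕ) :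
    Ifg K n = Ideal.span {pg K n} ⊔ Ideal.span {ph K n} := by
  rw [← Ideal.span_insert]
  refine le_antisymm (Ideal.span_le.2 ?_) (Ideal.span_le.2 ?_)
  · rintro _ (rfl | rfl)
    · exact Ideal.mem_span_pair.2 ⟨-1, -1, by rw [ph_eq]; ring⟩
    · exact Ideal.subset_span (by simp)
  · rintro _ (rfl | rfl)
    exacts [pg_mem K n, ph_mem K n]

theorem Ifg_eq_sup_pf_ph (K : Type*) [Field K] (n : ℕ) :
    Ifg K n = Ideal.span {pf K n} ⊔ Ideal.span {ph K n} := by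
  rw [← Ideal.span_insert]
  refine le_antisymm (Ideal.span_le.2 ?_) (Ideal.span_le.2 ?_)
  · rintro _ (rfl | rfl)
    · exact Ideal.subset_span (by simp)
    · exact Ideal.mem_span_pair.2 ⟨-1, -1, by rw [ph_eq]; ring⟩
  · rintro _ (rfl | rfl)
    exacts [pf_mem K n, ph_mem K n]

theorem pf_mem_Iyz_pow (K : Type*) [Field K] (n : ℕ) : pf K n ∈ Iyz K ^ n :=
  pow_sub_pow_mem_span_pair_pow n _ _

theorem pg_mem_Izx_pow (K : Type*) [Field K] (n : ℕ) : pg K n ∈ Izx K ^ n :=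
  pow_sub_pow_mem_span_pair_pow n _ _

theorem ph_mem_Ixy_pow (K : Type*) [Field K] (n : ℕ) : ph K n ∈ Ixy K ^ n :=
  pow_sub_pow_mem_span_pair_pow n _ _

theorem span_mul_pow_le {R : Type*} [CommRing R] {J S T Q : Ideal R} {u v x : R} {n p q : ℕ}
    (hn : n ≠ 0) (hp : p ≠ 0) (hq : q ≠ 0) (hu : u ∈ J) (hv : v ∈ J) (huT : u ∈ T) (hvQ : v ∈ Q)
    (hx : x ∈ S) :
    Ideal.span {u ^ p * v ^ q * x} * S ^ (n - 1) ≤ J ^ (p + q) ⊓ S ^ n ⊓ T ⊓ Q := by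
  rw [Ideal.span_singleton_mul_le_iff]
  intro t ht
  refine ⟨⟨⟨?_, ?_⟩, ?_⟩, ?_⟩
  · rw [mul_assoc, pow_add]
    exact Ideal.mul_mem_right _ _
      (Ideal.mul_mem_mul (Ideal.pow_mem_pow hu p) (Ideal.pow_mem_pow hv q))
  · rw [mul_assoc, ← mul_pow_sub_one hn]
    exact Ideal.mul_mem_left _ _ (Ideal.mul_mem_mul hx ht)
  · exact Ideal.mem_of_dvd _ (Dvd.intro (v ^ q * x * t) (by ring))
      (Ideal.pow_mem_of_mem _ huT p (Nat.pos_of_ne_zero hp))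
  · exact Ideal.mem_of_dvd _ (Dvd.intro (u ^ p * x * t) (by ring))
      (Ideal.pow_mem_of_mem _ hvQ q (Nat.pos_of_ne_zero hq))

/-- The equality for arbitrary exponents `a`, `b`, without conditions on the field. -/
theorem Ifg_pow_inf_eq (K : Type*) [Field K] {n : ℕ} (hn : n ≠ 0) (a b : ℕ) (hab : 1 ≤ a + b) :
    Ifg K n ^ (a + b + 2) ⊓ Ixy K ^ n ⊓ Iyz K ^ n ⊓ Izx K ^ n =
      Ideal.span {pf K n * pg K n * ph K n} * Ifg K n ^ (a + b - 1) ⊔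
        Ideal.span {pf K n ^ (a + 1) * pg K n ^ (b + 1) * X 0} * Ixy K ^ (n - 1) ⊔
        Ideal.span {pg K n ^ (a + 1) * ph K n ^ (b + 1) * X 1} * Iyz K ^ (n - 1) ⊔
        Ideal.span {pf K n ^ (b + 1) * ph K n ^ (a + 1) * X 2} * Izx K ^ (n - 1) := by
  have hfg : ∀ u ∈ Ifg K n, ∀ v ∈ Ifg K n, ∀ r s : ℕ, r + s = a + b →
      ∀ w, w = pf K n * pg K n * ph K n * (u ^ r * v ^ s) →
      Ideal.span {w} ≤ Ideal.span {pf K n * pg K n * ph K n} * Ifg K n ^ (a + b - 1) := by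
    intro u hu v hv r s hrs w hw
    rw [hw, ← Ideal.span_singleton_mul_span_singleton]
    refine Ideal.mul_mono_right ((Ideal.span_singleton_le_iff_mem _).2 ?_)
    refine Ideal.pow_le_pow_right (n := r + s) (by omega) ?_
    rw [pow_add]
    exact Ideal.mul_mem_mul (Ideal.pow_mem_pow hu r) (Ideal.pow_mem_pow hv s)
  apply le_antisymm
  · rintro t ⟨⟨⟨ht, hxy⟩, hyz⟩, hzx⟩
    have ht' := pow_add_two_le_sup (Ifg_eq_sup K n) (Ifg_eq_sup_pg_ph K n)
      (Ifg_eq_sup_pf_ph K n) a b ht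
    simp only [Ideal.span_singleton_pow, Ideal.span_singleton_mul_span_singleton] at ht'
    obtain ⟨t₁, ht₁, w₃, hC, rfl⟩ := Submodule.mem_sup.1 ht'
    obtain ⟨t₂, ht₂, w₂, hB, rfl⟩ := Submodule.mem_sup.1 ht₁
    obtain ⟨d, hd, w₁, hA, rfl⟩ := Submodule.mem_sup.1 ht₂
    obtain ⟨A, rfl⟩ := Ideal.mem_span_singleton'.1 hA
    obtain ⟨B, rfl⟩ := Ideal.mem_span_singleton'.1 hB
    obtain ⟨C, rfl⟩ := Ideal.mem_span_singleton'.1 hC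
    obtain ⟨e, he, rfl⟩ := Ideal.mem_span_singleton_mul.1 hd
    have hA' : A ∈ Ixy K ^ n := by
      refine mem_span_X_pair_pow_of_mul_sub_pow_mem (l := 2) (n := n) (p := a + 1) (q := b + 1)
        (by decide) (by decide) (by decide) hn ?_
      have := sub_mem hxy (Ideal.mul_mem_right (pf K n * pg K n * e +
        B * (pg K n ^ (a + 1) * ph K n ^ b) + C * (pf K n ^ (b + 1) * ph K n ^ a)) _
        (ph_mem_Ixy_pow K n))
      change A * (pf K n ^ (a + 1) * pg K n ^ (b + 1)) ∈ Ixy K ^ n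
      convert this using 1
      ring
    have hB' : B ∈ Iyz K ^ n := by
      refine mem_span_X_pair_pow_of_mul_sub_pow_mem (l := 0) (n := n) (p := a + 1) (q := b + 1)
        (by decide) (by decide) (by decide) hn ?_
      have := sub_mem hyz (Ideal.mul_mem_right (pg K n * ph K n * e +
        A * (pf K n ^ a * pg K n ^ (b + 1)) + C * (pf K n ^ b * ph K n ^ (a + 1))) _
        (pf_mem_Iyz_pow K n))
      change B * (pg K n ^ (a + 1) * ph K n ^ (b + 1)) ∈ Iyz K ^ n
      convert this using 1
      ring
    have hC' : C ∈ Izx K ^ n := by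
      refine mem_span_X_pair_pow_of_mul_sub_pow_mem (l := 1) (n := n) (p := a + 1) (q := b + 1)
        (by decide) (by decide) (by decide) hn ?_
      have := sub_mem hzx (Ideal.mul_mem_right (pf K n * ph K n * e +
        A * (pf K n ^ (a + 1) * pg K n ^ b) + B * (pg K n ^ a * ph K n ^ (b + 1))) _
        (pg_mem_Izx_pow K n))
      change C * (ph K n ^ (a + 1) * pf K n ^ (b + 1)) ∈ Izx K ^ n
      convert this using 1
      ring
    refine add_mem (add_mem (add_mem ?_ ?_) ?_) ?_
    · exact Ideal.mem_sup_left (Ideal.mem_sup_left (Ideal.mem_sup_left hd))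
    · refine sup_le (α := Ideal (MvPolynomial (Fin 3) K)) ?_ ?_
        (mul_mem_span_mul_pow_sup hn (c := pf K n ^ (a + 1) * pg K n ^ (b + 1)) hA')
      · exact le_sup_of_le_left (le_sup_of_le_left le_sup_right)
      · refine le_sup_of_le_left (le_sup_of_le_left (le_sup_of_le_left ?_))
        refine hfg _ (pf_mem K n) _ (pg_mem K n) a b rfl _ ?_
        change pf K n ^ (a + 1) * pg K n ^ (b + 1) * ph K n = _
        ring
    · refine sup_le (α := Ideal (MvPolynomial (Fin 3) K)) ?_ ?_
        (mul_mem_span_mul_pow_sup hn (c := pg K n ^ (a + 1) * ph K n ^ (b + 1)) hB')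
      · exact le_sup_of_le_left le_sup_right
      · refine le_sup_of_le_left (le_sup_of_le_left (le_sup_of_le_left ?_))
        refine hfg _ (pg_mem K n) _ (ph_mem K n) a b rfl _ ?_
        change pg K n ^ (a + 1) * ph K n ^ (b + 1) * pf K n = _
        ring
    · refine sup_le (α := Ideal (MvPolynomial (Fin 3) K)) ?_ ?_
        (mul_mem_span_mul_pow_sup hn (c := pf K n ^ (b + 1) * ph K n ^ (a + 1)) hC')
      · exact le_sup_right
      · refine le_sup_of_le_left (le_sup_of_le_left (le_sup_of_le_left ?_))
        refine hfg _ (pf_mem K n) _ (ph_mem K n) b a (add_comm b a) _ ?_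
        change pf K n ^ (b + 1) * ph K n ^ (a + 1) * pg K n = _
        ring
  · refine sup_le (sup_le (sup_le ?_ ?_) ?_) ?_
    · rw [Ideal.span_singleton_mul_le_iff]
      intro e he
      refine ⟨⟨⟨?_, ?_⟩, ?_⟩, ?_⟩
      · have h : Ifg K n ^ (a + b + 2) =
            Ifg K n * Ifg K n * Ifg K n * Ifg K n ^ (a + b - 1) := by
          rw [← pow_three', ← pow_add]
          congr 1
          omega
        rw [h]
        exact Ideal.mul_mem_mul (Ideal.mul_mem_mul (Ideal.mul_mem_mul (pf_mem K n) (pg_mem K n))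
          (ph_mem K n)) he
      · exact Ideal.mem_of_dvd _ (Dvd.intro (pf K n * pg K n * e) (by ring)) (ph_mem_Ixy_pow K n)
      · exact Ideal.mem_of_dvd _ (Dvd.intro (pg K n * ph K n * e) (by ring)) (pf_mem_Iyz_pow K n)
      · exact Ideal.mem_of_dvd _ (Dvd.intro (pf K n * ph K n * e) (by ring)) (pg_mem_Izx_pow K n)
    · refine (span_mul_pow_le (S := Ixy K) hn a.succ_ne_zero b.succ_ne_zero (pf_mem K n) (pg_mem K n)
        (pf_mem_Iyz_pow K n) (pg_mem_Izx_pow K n) (Ideal.subset_span (by simp))).trans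
        (le_of_eq ?_)
      rw [show a + 1 + (b + 1) = a + b + 2 by ring]
    · refine (span_mul_pow_le (S := Iyz K) hn a.succ_ne_zero b.succ_ne_zero (pg_mem K n) (ph_mem K n)
        (pg_mem_Izx_pow K n) (ph_mem_Ixy_pow K n) (Ideal.subset_span (by simp))).trans
        (le_of_eq ?_)
      rw [show a + 1 + (b + 1) = a + b + 2 by ring]
      rw [inf_right_comm _ (Izx K ^ n), inf_right_comm _ (Iyz K ^ n)]
    · refine (span_mul_pow_le (S := Izx K) hn b.succ_ne_zero a.succ_ne_zero (pf_mem K n) (ph_mem K n)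
        (pf_mem_Iyz_pow K n) (ph_mem_Ixy_pow K n) (Ideal.subset_span (by simp))).trans
        (le_of_eq ?_)
      rw [show b + 1 + (a + 1) = a + b + 2 by ring]
      rw [inf_right_comm _ (Iyz K ^ n), inf_right_comm _ (Izx K ^ n),
        inf_right_comm _ (Izx K ^ n)]

/-- for `n ≥ 3`, `k ≥ 1`,
`(f,g)^{k(n−3)+3} ∩ (x,y)ⁿ ∩ (y,z)ⁿ ∩ (x,z)ⁿ
 = (fgh)(f,g)^{k(n−3)} + f^{(k−1)(n−3)+2} g^{n−2} x·(x,y)^{n−1}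
   + g^{(k−1)(n−3)+2} h^{n−2} y·(y,z)^{n−1} + f^{n−2} h^{(k−1)(n−3)+2} z·(z,x)^{n−1}`. -/
theorem fermat_symbolic_n_power {K : Type*} [Field K] (n k : ℕ) (hn : 3 ≤ n) (hk : 1 ≤ k)
    (hζ : ∃ ζ : K, IsPrimitiveRoot ζ n) (hinv : IsUnit (n : K)) :
    Ifg K n ^ (k * (n - 3) + 3) ⊓ Ixy K ^ n ⊓ Iyz K ^ n ⊓ Izx K ^ n =
      Ideal.span {pf K n * pg K n * ph K n} * Ifg K n ^ (k * (n - 3)) +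
        Ideal.span {pf K n ^ ((k - 1) * (n - 3) + 2) * pg K n ^ (n - 2) * X 0} * Ixy K ^ (n - 1) +
        Ideal.span {pg K n ^ ((k - 1) * (n - 3) + 2) * ph K n ^ (n - 2) * X 1} * Iyz K ^ (n - 1) +
        Ideal.span {pf K n ^ (n - 2) * ph K n ^ ((k - 1) * (n - 3) + 2) * X 2} * Izx K ^ (n - 1) := by
  obtain ⟨N, rfl⟩ := Nat.exists_eq_add_of_le' hn
  obtain ⟨k, rfl⟩ := Nat.exists_eq_add_of_le' hk
  have h := Ifg_pow_inf_eq K (n := N + 3) (by omega) (k * N + 1) N (by omega)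
  have h₁ : (k + 1) * (N + 3 - 3) + 3 = k * N + 1 + N + 2 := by
    rw [Nat.add_sub_cancel]; ring
  have h₂ : (k + 1) * (N + 3 - 3) = k * N + 1 + N - 1 := by omega
  have h₃ : (k + 1 - 1) * (N + 3 - 3) + 2 = k * N + 1 + 1 := by simp
  have h₄ : N + 3 - 2 = N + 1 := by omega
  rw [h₁, h₂, h₃, h₄]
  exact h
end
end

section
/- For all integers n ≥ 3 and k ≥ 1, the kn-th symbolic power of the Fermat ideal I satisfies the equality of ideals I^{(kn)} = (fgh)^k·(f,g)^{(n−3)k} + Σ_{i=1}^{k} f^{(k−i)(n−2)+2i} g^{k+i(n−3)} h^{k−i} x^{(i−1)n+1} · (x, y)^{n−1} + Σ_{i=1}^{k} f^{k−i} g^{(k−i)(n−2)+2i} h^{k+i(n−3)} y^{(i−1)n+1} · (y, z)^{n−1} + Σ_{i=1}^{k} f^{k+i(n−3)} g^{k−i} h^{(k−i)(n−2)+2i} z^{(i−1)n+1} · (z, x)^{n−1}, where the sums are sums of ideals. -/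
open MvPolynomial

noncomputable section

section Pair

variable {R : Type*} [CommRing R]

theorem span_pair_pow_le {x y : R} {N : ℕ} {J : Ideal R}
    (h : ∀ a b, a + b = N → x ^ a * y ^ b ∈ J) : Ideal.span {x, y} ^ N ≤ J := by
  induction N generalizing J with
  | zero => simpa [Ideal.eq_top_iff_one] using h 0 0 rfl
  | succ N ih =>
    have key : ∀ w : R, (∀ a b, a + b = N → w * (x ^ a * y ^ b) ∈ J) →
        ∀ v ∈ Ideal.span {x, y} ^ N, w * v ∈ J := fun w hw v hv =>
      (ih (J := Submodule.comap (LinearMap.mulLeft R w) J) hw) hv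
    rw [pow_succ', Ideal.mul_le]
    intro r hr v hv
    obtain ⟨s, t, rfl⟩ := Ideal.mem_span_pair.mp hr
    have hx := key x (fun a b hab => by
      convert h (a + 1) b (by omega) using 1; ring) v hv
    have hy := key y (fun a b hab => by
      convert h a (b + 1) (by omega) using 1; ring) v hv
    convert J.add_mem (J.mul_mem_left s hx) (J.mul_mem_left t hy) using 1
    ring

theorem pow_mul_pow_mem_span_pair_pow (x y : R) (a b : ℕ) :
    x ^ a * y ^ b ∈ Ideal.span {x, y} ^ (a + b) := by
  rw [pow_add]
  exact Ideal.mul_mem_mul (Ideal.pow_mem_pow (Ideal.subset_span (by simp)) a)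
    (Ideal.pow_mem_pow (Ideal.subset_span (by simp)) b)

/-- Modulo `u + v`, the ideal `(u, v) ^ m` is generated by any single `u ^ p * v ^ q`. -/
theorem span_pair_pow_succ_le (u v : R) {m p q : ℕ} (hpq : p + q = m + 1) :
    Ideal.span {u, v} ^ (m + 1) ≤
      Ideal.span {u ^ p * v ^ q} ⊔ Ideal.span {u + v} * Ideal.span {u, v} ^ m := by
  set J := Ideal.span {u ^ p * v ^ q} ⊔ Ideal.span {u + v} * Ideal.span {u, v} ^ m
  have step : ∀ a b, a + b = m → (u ^ (a + 1) * v ^ b ∈ J ↔ u ^ a * v ^ (b + 1) ∈ J) := by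
    intro a b hab
    have h : (u + v) * (u ^ a * v ^ b) ∈ J := Ideal.mem_sup_right <| Ideal.mul_mem_mul
      (Ideal.mem_span_singleton_self _) (hab ▸ pow_mul_pow_mem_span_pair_pow u v a b)
    have e : (u + v) * (u ^ a * v ^ b) = u ^ (a + 1) * v ^ b + u ^ a * v ^ (b + 1) := by ring
    rw [e] at h
    exact ⟨fun h' => (J.add_mem_iff_right h').mp h, fun h' => (J.add_mem_iff_left h').mp h⟩
  have all : ∀ b a, a + b = m + 1 → (u ^ (m + 1) ∈ J ↔ u ^ a * v ^ b ∈ J) := by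
    intro b
    induction b with
    | zero => rintro a rfl; simp
    | succ b ih =>
      intro a hab
      rw [ih (a + 1) (by omega), step a b (by omega)]
  refine span_pair_pow_le fun a b hab => ?_
  rw [← all b a hab, all q p hpq]
  exact Ideal.mem_sup_left (Ideal.mem_span_singleton_self _)

theorem span_pair_pow_succ_mul_le (x y : R) {n : ℕ} (hn : 0 < n) (s : ℕ) :
    Ideal.span {x, y} ^ ((s + 1) * n) ≤
      Ideal.span {x ^ (s * n + 1)} * Ideal.span {x, y} ^ (n - 1) ⊔
        Ideal.span {x ^ n - y ^ n} * Ideal.span {x, y} ^ (s * n) := by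
  refine span_pair_pow_le fun a b => ?_
  induction b using Nat.strong_induction_on generalizing a with
  | _ b ih =>
    intro hab
    rw [add_mul, one_mul] at hab
    rcases lt_or_ge b n with hb | hb
    · obtain ⟨c, rfl⟩ : ∃ c, a = s * n + 1 + c := ⟨a - (s * n + 1), by omega⟩
      rw [pow_add x (s * n + 1) c, mul_assoc]
      refine Ideal.mem_sup_left (Ideal.mul_mem_mul (Ideal.mem_span_singleton_self _) ?_)
      rw [show n - 1 = c + b by omega]
      exact pow_mul_pow_mem_span_pair_pow x y c b
    · obtain ⟨c, rfl⟩ := Nat.exists_eq_add_of_le hb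
      have e : x ^ a * y ^ (n + c) =
          x ^ (a + n) * y ^ c - (x ^ n - y ^ n) * (x ^ a * y ^ c) := by ring
      rw [e]
      refine Ideal.sub_mem _ (ih c (by omega) (a + n) (by rw [add_mul]; omega))
        (Ideal.mem_sup_right (Ideal.mul_mem_mul (Ideal.mem_span_singleton_self _) ?_))
      rw [show s * n = a + c by omega]
      exact pow_mul_pow_mem_span_pair_pow x y a c

end Pair

/-- If the constant coefficient of `E` is regular modulo `J`, then the low coefficients of `U` lie
in `J` as soon as those of `E * U` do. -/
theorem coeff_mem_of_coeff_mul_mem {R : Type*} [CommRing R] {J : Ideal R} {E U : Polynomial R}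
    (hE : ∀ r, E.coeff 0 * r ∈ J → r ∈ J) {a : ℕ} (h : ∀ d < a, (E * U).coeff d ∈ J) :
    ∀ d < a, U.coeff d ∈ J := by
  intro d
  induction d using Nat.strong_induction_on with
  | _ d ih =>
    intro hd
    have h' := h d hd
    rw [Polynomial.coeff_mul, ← Finset.add_sum_erase _ _ (show (0, d) ∈ _ by simp)] at h'
    refine hE _ ((J.add_mem_iff_left (J.sum_mem fun e he => J.mul_mem_left _ ?_)).mp h')
    obtain ⟨hne, he⟩ := Finset.mem_erase.mp he
    rw [Finset.HasAntidiagonal.mem_antidiagonal] at he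
    have : e.1 ≠ 0 := fun h0 => hne (Prod.ext h0 (by simp only; omega))
    exact ih _ (by omega) (by omega)

section Grading

variable {K : Type*} [Field K] {i j l : Fin 3} {n : ℕ}

/-- The homomorphism `F ↦ F(T xᵢ, T xⱼ, xₗ)` recording the degree in `xᵢ` and `xⱼ`. -/
def pairGrading (K : Type*) [Field K] (i j : Fin 3) :
    MvPolynomial (Fin 3) K →ₐ[K] Polynomial (MvPolynomial (Fin 3) K) :=
  aeval fun t => if t = i ∨ t = j then Polynomial.C (X t) * Polynomial.X else Polynomial.C (X t)

@[simp]
theorem pairGrading_left : pairGrading K i j (X i) = Polynomial.C (X i) * Polynomial.X := by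
  simp [pairGrading]

@[simp]
theorem pairGrading_right : pairGrading K i j (X j) = Polynomial.C (X j) * Polynomial.X := by
  simp [pairGrading]

theorem pairGrading_of_ne (hi : l ≠ i) (hj : l ≠ j) :
    pairGrading K i j (X l) = Polynomial.C (X l) := by
  simp [pairGrading, hi, hj]

theorem pairGrading_sub :
    pairGrading K i j (X i ^ n - X j ^ n) =
      Polynomial.C (X i ^ n - X j ^ n) * Polynomial.X ^ n := by
  simp only [map_sub, map_pow, pairGrading_left, pairGrading_right]
  ring

theorem coeff_pairGrading_mem (F : MvPolynomial (Fin 3) K) (d : ℕ) :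
    (pairGrading K i j F).coeff d ∈ Ideal.span {(X i : MvPolynomial (Fin 3) K), X j} ^ d := by
  refine (mem_reesAlgebra_iff _ _).mp ?_ d
  induction F using MvPolynomial.induction_on with
  | C a =>
    rw [← MvPolynomial.algebraMap_eq, AlgHom.commutes]
    exact (reesAlgebra _).algebraMap_mem (algebraMap K (MvPolynomial (Fin 3) K) a)
  | add p q hp hq => simpa using add_mem hp hq
  | mul_X p t hp =>
    rw [map_mul]
    refine mul_mem hp ?_
    by_cases ht : t = i ∨ t = j
    · have : pairGrading K i j (X t) = Polynomial.monomial 1 (X t) := by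
        simp [pairGrading, ht, Polynomial.C_mul_X_eq_monomial]
      rw [this, reesAlgebra.monomial_mem, pow_one]
      exact Ideal.subset_span (by rcases ht with rfl | rfl <;> simp)
    · push Not at ht
      rw [pairGrading_of_ne ht.1 ht.2]
      exact (reesAlgebra _).algebraMap_mem (X t)

theorem eval_one_pairGrading (F : MvPolynomial (Fin 3) K) :
    (pairGrading K i j F).eval 1 = F := by
  induction F using MvPolynomial.induction_on with
  | C a => rw [← MvPolynomial.algebraMap_eq, AlgHom.commutes, IsScalarTower.algebraMap_apply K
      (MvPolynomial (Fin 3) K) (Polynomial (MvPolynomial (Fin 3) K))]; simp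
  | add p q hp hq => simp [hp, hq]
  | mul_X p t hp =>
    rw [map_mul, Polynomial.eval_mul, hp]
    simp only [pairGrading, aeval_X]
    split_ifs <;> simp

theorem mem_pow_sup_of_coeff_mem {J : Ideal (MvPolynomial (Fin 3) K)} {a : ℕ}
    {F : MvPolynomial (Fin 3) K} (h : ∀ d < a, (pairGrading K i j F).coeff d ∈ J) :
    F ∈ Ideal.span {X i, X j} ^ a ⊔ J := by
  rw [← eval_one_pairGrading (i := i) (j := j) F, Polynomial.eval_eq_sum_range]
  refine Ideal.sum_mem _ fun d _ => ?_
  rw [one_pow, mul_one]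
  rcases lt_or_ge d a with hd | hd
  · exact Ideal.mem_sup_right (h d hd)
  · exact Ideal.mem_sup_left (Ideal.pow_le_pow_right hd (coeff_pairGrading_mem F d))

theorem X_pow_dvd_pairGrading {a : ℕ} {F : MvPolynomial (Fin 3) K}
    (hF : F ∈ Ideal.span {X i, X j} ^ a) : Polynomial.X ^ a ∣ pairGrading K i j F := by
  rw [← Ideal.mem_span_singleton, ← Ideal.span_singleton_pow]
  have h := Ideal.mem_map_of_mem (pairGrading K i j) hF
  rw [Ideal.map_pow, Ideal.map_span, Set.image_pair] at h
  refine Ideal.pow_right_mono (Ideal.span_le.mpr ?_) a h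
  rintro _ (rfl | rfl) <;> simp [Ideal.mem_span_singleton]

theorem mem_span_pair_pow_iff {a : ℕ} {F : MvPolynomial (Fin 3) K} :
    F ∈ Ideal.span {X i, X j} ^ a ↔ ∀ d < a, (pairGrading K i j F).coeff d = 0 := by
  refine ⟨fun hF => Polynomial.X_pow_dvd_iff.mp (X_pow_dvd_pairGrading hF), fun h => ?_⟩
  simpa using mem_pow_sup_of_coeff_mem (J := ⊥) (F := F) (by simpa using h)

theorem X_pow_sub_X_pow_ne_zero (hn : 0 < n) (hij : i ≠ j) :
    (X i ^ n - X j ^ n : MvPolynomial (Fin 3) K) ≠ 0 := by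
  intro h
  simpa [hij.symm, hn.ne'] using congrArg (eval (Pi.single i (1 : K))) h

theorem not_X_dvd_X_pow_sub_X_pow (hn : 0 < n) (hij : i ≠ j) (hil : i ≠ l) :
    ¬ (X l : MvPolynomial (Fin 3) K) ∣ X i ^ n - X j ^ n := by
  rintro ⟨w, h⟩
  simpa [hij.symm, hil.symm, hn.ne'] using congrArg (eval (Pi.single i (1 : K))) h

theorem mem_of_sub_mul_mem (hn : 0 < n) (hij : i ≠ j) {a : ℕ} {v : MvPolynomial (Fin 3) K}
    (hv : (X i ^ n - X j ^ n) * v ∈ Ideal.span {X i, X j} ^ (a + n)) :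
    v ∈ Ideal.span {X i, X j} ^ a := by
  rw [mem_span_pair_pow_iff] at hv ⊢
  intro d hd
  have h := hv (d + n) (by omega)
  rw [map_mul, pairGrading_sub, mul_assoc, Polynomial.coeff_C_mul, Polynomial.coeff_X_pow_mul] at h
  exact (mul_eq_zero.mp h).resolve_left (X_pow_sub_X_pow_ne_zero hn hij)

theorem mem_of_sub_mul_mem_of_ne (hn : 0 < n) (hij : i ≠ j) (hil : i ≠ l) {a : ℕ}
    {v : MvPolynomial (Fin 3) K} (hv : (X i ^ n - X j ^ n) * v ∈ Ideal.span {X j, X l} ^ a) :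
    v ∈ Ideal.span {X j, X l} ^ a := by
  rw [mem_span_pair_pow_iff] at hv ⊢
  refine coeff_mem_of_coeff_mul_mem (J := ⊥) (E := pairGrading K j l (X i ^ n - X j ^ n))
    (fun r hr => ?_) (by simpa using hv)
  rw [map_sub, map_pow, map_pow, pairGrading_left, pairGrading_of_ne hij hil] at hr
  simpa [Polynomial.coeff_zero_eq_eval_zero, hn.ne'] using hr

theorem dvd_of_dvd_X_pow_mul (hn : 0 < n) (hij : i ≠ j) (hil : i ≠ l) {N : ℕ}
    {r : MvPolynomial (Fin 3) K} (h : X i ^ n - X j ^ n ∣ X l ^ N * r) : X i ^ n - X j ^ n ∣ r := by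
  obtain ⟨w, hw⟩ := h
  obtain ⟨w', rfl⟩ := (X_prime (R := K) (i := l)).pow_dvd_of_dvd_mul_left N
    (not_X_dvd_X_pow_sub_X_pow hn hij hil) ⟨r, hw.symm⟩
  refine ⟨w', mul_left_cancel₀ (pow_ne_zero N (X_ne_zero l)) ?_⟩
  rw [hw]
  ring

theorem mem_sup_of_mul_mem_sup (hn : 0 < n) (hij : i ≠ j) (hjl : j ≠ l) (hil : i ≠ l)
    {a p q : ℕ} {u : MvPolynomial (Fin 3) K}
    (hu : (X j ^ n - X l ^ n) ^ p * (X l ^ n - X i ^ n) ^ q * u ∈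
      Ideal.span {X i, X j} ^ a ⊔ Ideal.span {X i ^ n - X j ^ n}) :
    u ∈ Ideal.span {X i, X j} ^ a ⊔ Ideal.span {X i ^ n - X j ^ n} := by
  obtain ⟨r, hr, t, ht, e⟩ := Submodule.mem_sup.mp hu
  obtain ⟨w, rfl⟩ := Ideal.mem_span_singleton.mp ht
  refine mem_pow_sup_of_coeff_mem (coeff_mem_of_coeff_mul_mem
    (E := pairGrading K i j ((X j ^ n - X l ^ n) ^ p * (X l ^ n - X i ^ n) ^ q))
    (fun v hv => ?_) fun d hd => ?_)
  · have hc : (pairGrading K i j ((X j ^ n - X l ^ n) ^ p * (X l ^ n - X i ^ n) ^ q)).coeff 0 =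
        (-1) ^ p * X l ^ (n * (p + q)) := by
      simp only [map_mul, map_pow, map_sub, pairGrading_left, pairGrading_right,
        pairGrading_of_ne hil.symm hjl.symm, Polynomial.coeff_zero_eq_eval_zero]
      simp only [Polynomial.eval_mul, Polynomial.eval_pow, Polynomial.eval_sub, Polynomial.eval_C,
        Polynomial.eval_X, mul_zero, zero_pow hn.ne', zero_sub, sub_zero]
      rw [neg_pow]
      ring
    rw [hc, Ideal.mem_span_singleton] at hv
    rw [Ideal.mem_span_singleton]
    refine dvd_of_dvd_X_pow_mul hn hij hil (N := n * (p + q)) (l := l) ?_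
    refine (hv.mul_left ((-1) ^ p)).trans (dvd_of_eq ?_)
    rw [← mul_assoc, ← mul_assoc, ← mul_pow]
    simp
  · rw [← map_mul, ← e, map_add, Polynomial.coeff_add, mem_span_pair_pow_iff.mp hr d hd, zero_add,
      map_mul, pairGrading_sub, mul_assoc, Polynomial.coeff_C_mul]
    exact Ideal.mul_mem_right _ _ (Ideal.mem_span_singleton_self _)

end Grading

section FatIdeal

/-- The linear form `xᵢⁿ - xⱼⁿ` in the `n`-th powers of the variables. -/
def powDiff (K : Type*) [Field K] (n : ℕ) (i j : Fin 3) : MvPolynomial (Fin 3) K :=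
  X i ^ n - X j ^ n

/-- The ideal `(xᵢ, xⱼ)`. -/
def pairIdeal (K : Type*) [Field K] (i j : Fin 3) : Ideal (MvPolynomial (Fin 3) K) :=
  Ideal.span {X i, X j}

/-- The ideal `(xⱼⁿ - xₗⁿ, xₗⁿ - xᵢⁿ)^m ∩ (xᵢ, xⱼ)^a ∩ (xⱼ, xₗ)^b ∩ (xₗ, xᵢ)^c`. -/
def fatIdeal (K : Type*) [Field K] (n : ℕ) (i j l : Fin 3) (m a b c : ℕ) :
    Ideal (MvPolynomial (Fin 3) K) :=
  Ideal.span {powDiff K n j l, powDiff K n l i} ^ m ⊓ pairIdeal K i j ^ a ⊓ pairIdeal K j l ^ b ⊓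
    pairIdeal K l i ^ c

variable {K : Type*} [Field K] {i j l : Fin 3} {n : ℕ}

theorem powDiff_pow_mem_pairIdeal {p b : ℕ} (hb : b ≤ n * p) :
    powDiff K n i j ^ p ∈ pairIdeal K i j ^ b := by
  refine Ideal.pow_le_pow_right hb ?_
  rw [pow_mul]
  refine Ideal.pow_mem_pow (Ideal.sub_mem _ ?_ ?_) p <;>
    exact Ideal.pow_mem_pow (Ideal.subset_span (by simp)) n

theorem span_powDiff_rotate : Ideal.span {powDiff K n j l, powDiff K n l i} =
    Ideal.span {powDiff K n l i, powDiff K n i j} := by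
  rw [show powDiff K n i j = -1 * powDiff K n j l + -1 * powDiff K n l i by
    simp only [powDiff]; ring]
  apply le_antisymm <;> rw [Ideal.span_le] <;> rintro _ (rfl | rfl)
  · exact Ideal.mem_span_pair.mpr ⟨-1, -1, by ring⟩
  · exact Ideal.subset_span (by simp)
  · exact Ideal.subset_span (by simp)
  · exact Ideal.mem_span_pair.mpr ⟨-1, -1, by ring⟩

theorem fatIdeal_rotate (m a b c : ℕ) : fatIdeal K n i j l m a b c = fatIdeal K n j l i m b c a := by
  simp only [fatIdeal, span_powDiff_rotate (i := i) (j := j) (l := l)]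
  ac_rfl

theorem fatIdeal_succ_le (hn : 0 < n) (hij : i ≠ j) (hjl : j ≠ l) (hil : i ≠ l)
    {m s b c p q : ℕ} (hpq : p + q = m + 1) (hb : b ≤ n * p) (hc : c ≤ n * q) :
    fatIdeal K n i j l (m + 1) ((s + 1) * n) b c ≤
      Ideal.span {powDiff K n j l ^ p * powDiff K n l i ^ q * X i ^ (s * n + 1)} *
          pairIdeal K i j ^ (n - 1) ⊔
        Ideal.span {powDiff K n i j} * fatIdeal K n i j l m (s * n) b c := by
  rintro F ⟨⟨⟨hm, ha⟩, hFb⟩, hFc⟩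
  set f := powDiff K n j l with hf
  set g := powDiff K n l i with hg
  set h := powDiff K n i j with hh
  have hfgh : f + g = -h := by simp only [hf, hg, hh, powDiff]; ring
  obtain ⟨r, hr, t, ht, rfl⟩ := Submodule.mem_sup.mp (span_pair_pow_succ_le f g hpq hm)
  obtain ⟨u, rfl⟩ := Ideal.mem_span_singleton.mp hr
  obtain ⟨v, hv, rfl⟩ := Ideal.mem_span_singleton_mul.mp ht
  rw [hfgh] at ha hFb hFc ⊢
  have hu : u ∈ pairIdeal K i j ^ ((s + 1) * n) ⊔ Ideal.span {h} := by
    refine mem_sup_of_mul_mem_sup hn hij hjl hil (p := p) (q := q) (l := l) ?_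
    refine (Submodule.add_mem_iff_left _ ?_).mp (Ideal.mem_sup_left ha)
    exact Ideal.mem_sup_right (Ideal.mem_span_singleton.mpr
      (Dvd.intro (-v) (show h * -v = -h * v by ring)))
  obtain ⟨u₁, hu₁, t, ht, rfl⟩ := Submodule.mem_sup.mp hu
  obtain ⟨w, rfl⟩ := Ideal.mem_span_singleton.mp ht
  obtain ⟨y, hy, t, ht, rfl⟩ := Submodule.mem_sup.mp
    (span_pair_pow_succ_mul_le (X i : MvPolynomial (Fin 3) K) (X j) hn s hu₁)
  obtain ⟨u₂, hu₂, rfl⟩ := Ideal.mem_span_singleton_mul.mp hy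
  obtain ⟨w₂, hw₂, rfl⟩ := Ideal.mem_span_singleton_mul.mp ht
  set v' := f ^ p * g ^ q * (w₂ + w) - v with hv'
  have e : f ^ p * g ^ q * (X i ^ (s * n + 1) * u₂ + (X i ^ n - X j ^ n) * w₂ + h * w) + -h * v =
      f ^ p * g ^ q * X i ^ (s * n + 1) * u₂ + h * v' := by
    change f ^ p * g ^ q * (X i ^ (s * n + 1) * u₂ + h * w₂ + h * w) + -h * v = _
    rw [hv']; ring
  rw [e] at ha hFb hFc ⊢
  refine Submodule.add_mem_sup
    (Ideal.mul_mem_mul (Ideal.mem_span_singleton_self _) hu₂)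
    (Ideal.mul_mem_mul (Ideal.mem_span_singleton_self _) ⟨⟨⟨?_, ?_⟩, ?_⟩, ?_⟩)
  · refine Ideal.sub_mem _ (Ideal.mul_mem_right _ _ (Ideal.pow_le_pow_right
      (show m ≤ p + q by omega) ?_)) hv
    exact pow_mul_pow_mem_span_pair_pow f g p q
  · refine mem_of_sub_mul_mem hn hij ?_
    rw [show s * n + n = (s + 1) * n by ring]
    refine (Submodule.add_mem_iff_right _ ?_).mp ha
    rw [mul_assoc]
    refine Ideal.mul_mem_left _ _ ?_
    rw [show (s + 1) * n = s * n + 1 + (n - 1) by rw [add_mul]; omega, pow_add]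
    exact Ideal.mul_mem_mul (Ideal.pow_mem_pow (Ideal.subset_span (by simp)) _) hu₂
  · refine mem_of_sub_mul_mem_of_ne hn hij hil ((Submodule.add_mem_iff_right _ ?_).mp hFb)
    rw [mul_assoc, mul_assoc]
    exact Ideal.mul_mem_right _ _ (powDiff_pow_mem_pairIdeal hb)
  · have hz := (Submodule.add_mem_iff_right _ ?_).mp hFc
    · rw [pairIdeal, Set.pair_comm] at hz ⊢
      refine mem_of_sub_mul_mem_of_ne hn hij.symm hjl ?_
      rw [← neg_mem_iff]
      convert hz using 1
      simp only [hh, powDiff]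
      ring
    · rw [mul_assoc]
      exact Ideal.mul_mem_right _ _ (Ideal.mul_mem_left _ _ (powDiff_pow_mem_pairIdeal hc))

theorem fatIdeal_le_sum (hn : 0 < n) (hij : i ≠ j) (hjl : j ≠ l) (hil : i ≠ l)
    {m s b c : ℕ} {p q : ℕ → ℕ} (hpq : ∀ t ∈ Finset.Icc 1 s, p t + q t = m + t)
    (hb : ∀ t ∈ Finset.Icc 1 s, b ≤ n * p t) (hc : ∀ t ∈ Finset.Icc 1 s, c ≤ n * q t) :
    fatIdeal K n i j l (m + s) (s * n) b c ≤
      (∑ t ∈ Finset.Icc 1 s,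
        Ideal.span {powDiff K n j l ^ p t * powDiff K n l i ^ q t * powDiff K n i j ^ (s - t) *
          X i ^ ((t - 1) * n + 1)} * pairIdeal K i j ^ (n - 1)) +
        Ideal.span {powDiff K n i j ^ s} * fatIdeal K n i j l m 0 b c := by
  induction s with
  | zero => simp [fatIdeal]
  | succ s ih =>
    have hs : s + 1 ∈ Finset.Icc 1 (s + 1) := by simp
    have hsub : ∀ t ∈ Finset.Icc 1 s, t ∈ Finset.Icc 1 (s + 1) := fun t ht => by
      rw [Finset.mem_Icc] at ht ⊢; omega
    refine (fatIdeal_succ_le hn hij hjl hil (p := p (s + 1)) (q := q (s + 1))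
      (hpq _ hs) (hb _ hs) (hc _ hs)).trans ?_
    rw [Finset.sum_Icc_succ_top (by omega)]
    simp only [Nat.sub_self, pow_zero, mul_one, Nat.add_sub_cancel]
    rw [add_comm (Finset.sum _ _), add_assoc, ← Submodule.add_eq_sup]
    refine add_le_add le_rfl ?_
    refine (Ideal.mul_mono_right (ih (fun t ht => hpq t (hsub t ht))
      (fun t ht => hb t (hsub t ht)) fun t ht => hc t (hsub t ht))).trans (le_of_eq ?_)
    rw [mul_add, Finset.mul_sum, ← mul_assoc, Ideal.span_singleton_mul_span_singleton, ← pow_succ']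
    refine congrArg₂ _ (Finset.sum_congr rfl fun t ht => ?_) rfl
    rw [← mul_assoc, Ideal.span_singleton_mul_span_singleton,
      Nat.sub_add_comm (Finset.mem_Icc.mp ht).2, pow_succ]
    congr 3
    ring

theorem span_mul_le_fatIdeal (hn : 0 < n) {m a b c p q r s : ℕ} (hm : m = p + q + r)
    (ha : a = r * n + (s * n + n)) (hb : b ≤ n * p) (hc : c ≤ n * q) :
    Ideal.span {powDiff K n j l ^ p * powDiff K n l i ^ q * powDiff K n i j ^ r *
      X i ^ (s * n + 1)} * pairIdeal K i j ^ (n - 1) ≤ fatIdeal K n i j l m a b c := by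
  rw [Ideal.span_singleton_mul_le_iff]
  refine fun z hz => ⟨⟨⟨?_, ?_⟩, ?_⟩, ?_⟩
  · refine Ideal.mul_mem_right _ _ (Ideal.mul_mem_right _ _ ?_)
    rw [hm, pow_add]
    refine Ideal.mul_mem_mul (pow_mul_pow_mem_span_pair_pow _ _ p q) (Ideal.pow_mem_pow ?_ r)
    rw [span_powDiff_rotate]
    exact Ideal.subset_span (by simp)
  · rw [ha, pow_add, mul_assoc]
    refine Ideal.mul_mem_mul
      (Ideal.mul_mem_left _ _ (powDiff_pow_mem_pairIdeal (mul_comm r n).le)) ?_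
    rw [show s * n + n = s * n + 1 + (n - 1) by omega, pow_add]
    exact Ideal.mul_mem_mul (Ideal.pow_mem_pow (Ideal.subset_span (by simp)) _) hz
  · simp only [mul_assoc]
    exact Ideal.mul_mem_right _ _ (powDiff_pow_mem_pairIdeal hb)
  · refine Ideal.mul_mem_right _ _ (Ideal.mul_mem_right _ _ (Ideal.mul_mem_right _ _ ?_))
    exact Ideal.mul_mem_left _ _ (powDiff_pow_mem_pairIdeal hc)

end FatIdeal

/-- minimal generators of the `kn`-th symbolic power of the Fermat ideal
(Theorem: `I^{(kn)}` equals the stated sum of ideals). -/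
theorem fermat_symbolic_kn_gens {K : Type*} [Field K] (n k : ℕ) (hn : 3 ≤ n) (hk : 1 ≤ k)
    (hζ : ∃ ζ : K, IsPrimitiveRoot ζ n) (hinv : IsUnit (n : K)) :
    symbPow K n (k * n) =
      Ideal.span {(pf K n * pg K n * ph K n) ^ k} * Ifg K n ^ ((n - 3) * k) +
        (∑ i ∈ Finset.Icc 1 k,
          Ideal.span {pf K n ^ ((k - i) * (n - 2) + 2 * i) * pg K n ^ (k + i * (n - 3)) *
            ph K n ^ (k - i) * X 0 ^ ((i - 1) * n + 1)} * Ixy K ^ (n - 1)) +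
        (∑ i ∈ Finset.Icc 1 k,
          Ideal.span {pf K n ^ (k - i) * pg K n ^ ((k - i) * (n - 2) + 2 * i) *
            ph K n ^ (k + i * (n - 3)) * X 1 ^ ((i - 1) * n + 1)} * Iyz K ^ (n - 1)) +
        (∑ i ∈ Finset.Icc 1 k,
          Ideal.span {pf K n ^ (k + i * (n - 3)) * pg K n ^ (k - i) *
            ph K n ^ ((k - i) * (n - 2) + 2 * i) * X 2 ^ ((i - 1) * n + 1)} * Izx K ^ (n - 1)) := by
  obtain ⟨r, rfl⟩ := Nat.exists_eq_add_of_le' hn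
  have hn0 : 0 < r + 3 := by omega
  have h01 : (0 : Fin 3) ≠ 1 := by decide
  have h12 : (1 : Fin 3) ≠ 2 := by decide
  have h20 : (2 : Fin 3) ≠ 0 := by decide
  simp only [Nat.add_sub_cancel, show r + 3 - 2 = r + 1 by omega, show r + 3 - 1 = r + 2 by omega]
  have hf : pf K (r + 3) = powDiff K (r + 3) 1 2 := rfl
  have hg : pg K (r + 3) = powDiff K (r + 3) 2 0 := rfl
  have hh : ph K (r + 3) = powDiff K (r + 3) 0 1 := rfl
  have bound : ∀ t ∈ Finset.Icc 1 k, k ≤ (k - t) * (r + 1) + 2 * t := fun t ht => by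
    have : k - t ≤ (k - t) * (r + 1) := Nat.le_mul_of_pos_right _ (Nat.succ_pos r)
    rw [Finset.mem_Icc] at ht
    omega
  have scale : ∀ a, k ≤ a → k * (r + 3) ≤ (r + 3) * a := fun a ha => by
    rw [mul_comm k]; exact Nat.mul_le_mul_left _ ha
  have scale' : ∀ t ∈ Finset.Icc 1 k,
      k * (r + 3) = (k - t) * (r + 3) + ((t - 1) * (r + 3) + (r + 3)) := fun t ht => by
    obtain ⟨h1, h2⟩ := Finset.mem_Icc.mp ht
    obtain ⟨u, rfl⟩ := Nat.exists_eq_add_of_le h2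
    obtain ⟨w, rfl⟩ := Nat.exists_eq_add_of_le' h1
    simp only [Nat.add_sub_cancel_left, Nat.add_sub_cancel]
    ring
  have total : ∀ t ∈ Finset.Icc 1 k,
      k * (r + 3) = (k - t) * (r + 1) + 2 * t + (k + t * r) + (k - t) := fun t ht => by
    obtain ⟨u, rfl⟩ := Nat.exists_eq_add_of_le (Finset.mem_Icc.mp ht).2
    simp only [Nat.add_sub_cancel_left]
    ring
  have total' : ∀ t ∈ Finset.Icc 1 k,
      (k - t) * (r + 1) + 2 * t + t * r = k * (r + 1) + t := fun t ht => by
    obtain ⟨u, rfl⟩ := Nat.exists_eq_add_of_le (Finset.mem_Icc.mp ht).2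
    simp only [Nat.add_sub_cancel_left]
    ring
  have hsymb : symbPow K (r + 3) (k * (r + 3)) = fatIdeal K (r + 3) 0 1 2 (k * (r + 3))
    (k * (r + 3)) (k * (r + 3)) (k * (r + 3)) := rfl
  rw [hsymb, hf, hg, hh]
  have add_le : ∀ {I J L : Ideal (MvPolynomial (Fin 3) K)}, I ≤ L → J ≤ L → I + J ≤ L :=
    fun hI hJ => sup_le hI hJ
  have sum_le : ∀ {S : Finset ℕ} {G : ℕ → Ideal (MvPolynomial (Fin 3) K)}
      {L : Ideal (MvPolynomial (Fin 3) K)}, (∀ t ∈ S, G t ≤ L) → ∑ t ∈ S, G t ≤ L :=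
    fun hS => Finset.sum_induction _ (· ≤ _) (fun _ _ => add_le) bot_le hS
  have span_mul_congr : ∀ {a b : MvPolynomial (Fin 3) K} {I J : Ideal (MvPolynomial (Fin 3) K)},
      a = b → I = J → Ideal.span {a} * I = Ideal.span {b} * J := by rintro _ _ _ _ rfl rfl; rfl
  set f := powDiff K (r + 3) 1 2 with hf'
  set g := powDiff K (r + 3) 2 0 with hg'
  set h := powDiff K (r + 3) 0 1 with hh'
  apply le_antisymm
  · have hx := fatIdeal_le_sum (K := K) hn0 h01 h12 h20.symm
      (m := k * (r + 2)) (s := k) (b := k * (r + 3)) (c := k * (r + 3))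
      (p := fun t => (k - t) * (r + 1) + 2 * t) (q := fun t => k + t * r)
      (fun t ht => by linarith [total' t ht])
      (fun t ht => scale _ (bound t ht)) (fun t ht => scale _ (Nat.le_add_right _ _))
    have hy := fatIdeal_le_sum (K := K) hn0 h12 h20 h01.symm
      (m := k * (r + 1)) (s := k) (b := k * (r + 3)) (c := 0)
      (p := fun t => (k - t) * (r + 1) + 2 * t) (q := fun t => t * r)
      total' (fun t ht => scale _ (bound t ht)) (fun t ht => Nat.zero_le _)
    have hz := fatIdeal_le_sum (K := K) hn0 h20 h01 h12.symm
      (m := r * k) (s := k) (b := 0) (c := 0)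
      (p := fun t => (k - t) * (r + 1) + 2 * t - k) (q := fun t => t * r)
      (fun t ht => by
        obtain ⟨w, hw⟩ := Nat.exists_eq_add_of_le (bound t ht)
        have := total' t ht
        rw [hw] at this ⊢
        rw [Nat.add_sub_cancel_left]
        linarith)
      (fun t ht => Nat.zero_le _) (fun t ht => Nat.zero_le _)
    rw [show k * (r + 2) + k = k * (r + 3) by ring, fatIdeal_rotate (m := k * (r + 2))] at hx
    rw [show k * (r + 1) + k = k * (r + 2) by ring, fatIdeal_rotate (m := k * (r + 1))] at hy
    rw [show r * k + k = k * (r + 1) by ring] at hz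
    have hT : fatIdeal K (r + 3) 2 0 1 (r * k) 0 0 0 = Ifg K (r + 3) ^ (r * k) := by
      rw [fatIdeal_rotate]
      simp [fatIdeal, Ifg, hf, hg, hf', hg']
    rw [hT] at hz
    refine (hx.trans (add_le_add le_rfl (Ideal.mul_mono_right
      (hy.trans (add_le_add le_rfl (Ideal.mul_mono_right hz)))))).trans (le_of_eq ?_)
    simp only [mul_add (R := Ideal _), Finset.mul_sum, ← mul_assoc, Ideal.span_singleton_mul_span_singleton,
      ← hf', ← hg', ← hh']
    have e : h ^ k * f ^ k * g ^ k = (f * g * h) ^ k := by ring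
    rw [e, ← add_assoc, ← add_assoc, add_comm _ (Ideal.span {(f * g * h) ^ k} * _), ← add_assoc,
      ← add_assoc]
    refine congrArg₂ _ (congrArg₂ _ rfl (Finset.sum_congr rfl fun t _ => ?_))
      (Finset.sum_congr rfl fun t ht => ?_)
    · exact span_mul_congr (by ring) rfl
    · obtain ⟨w, hw⟩ := Nat.exists_eq_add_of_le (bound t ht)
      rw [hw, Nat.add_sub_cancel_left]
      exact span_mul_congr (by ring) rfl
  · refine add_le (add_le (add_le ?_ ?_) ?_) ?_
    · rw [Ideal.span_singleton_mul_le_iff]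
      refine fun z hz => ⟨⟨⟨?_, ?_⟩, ?_⟩, ?_⟩
      · have hM : f * g * h ∈ Ideal.span {f, g} ^ 3 := by
          rw [pow_succ]
          refine Ideal.mul_mem_mul (by simpa using pow_mul_pow_mem_span_pair_pow f g 1 1) ?_
          rw [span_powDiff_rotate]
          exact Ideal.subset_span (by simp [hh'])
        rw [show k * (r + 3) = 3 * k + r * k by ring, pow_add, pow_mul]
        exact Ideal.mul_mem_mul (Ideal.pow_mem_pow hM k) hz
      all_goals
        simp only [mul_pow]
        refine Ideal.mul_mem_right _ _ ?_
      · exact Ideal.mul_mem_left _ _ (powDiff_pow_mem_pairIdeal (scale k le_rfl))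
      · exact Ideal.mul_mem_right _ _
          (Ideal.mul_mem_right _ _ (powDiff_pow_mem_pairIdeal (scale k le_rfl)))
      · exact Ideal.mul_mem_right _ _
          (Ideal.mul_mem_left _ _ (powDiff_pow_mem_pairIdeal (scale k le_rfl)))
    · refine sum_le fun t ht => ?_
      exact span_mul_le_fatIdeal hn0 (total t ht) (scale' t ht)
        (scale _ (bound t ht)) (scale _ (Nat.le_add_right _ _))
    · refine sum_le fun t ht => ?_
      rw [fatIdeal_rotate]
      refine le_trans (le_of_eq ?_) (span_mul_le_fatIdeal hn0 (total t ht)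
        (scale' t ht) (scale _ (bound t ht)) (scale _ (Nat.le_add_right _ _)))
      exact span_mul_congr (by ring) rfl
    · refine sum_le fun t ht => ?_
      rw [fatIdeal_rotate, fatIdeal_rotate]
      refine le_trans (le_of_eq ?_) (span_mul_le_fatIdeal hn0 (total t ht)
        (scale' t ht) (scale _ (bound t ht)) (scale _ (Nat.le_add_right _ _)))
      exact span_mul_congr (by ring) rfl
end
end
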